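/- Let d_1 ≥ … ≥ d_r be positive integers with largest value k, grouped as in the context, and for 1 ≤ h ≤ t set s(𝐤_h) = max{u_0(𝐤_h), (k/2)(1+ϖ_h)}. Suppose s ≥ 2·Σ_{h=1}^{t} (μ_h − μ_{h+1}) s(𝐤_h) + M. Then every highly non-singular system Σ_{j=1}^s c_{ij} x_j^{d_i} = 0 (1 ≤ i ≤ r) with nonzero integer coefficients which possesses a non-singular real solution with all coordinates positive and, for every prime p, a non-singular solution in ℚ_p^s, has a solution in positive integers x_1, …, x_s. -/

import Mathlib

open MeasureTheory Filter Finset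
open scoped Classical

noncomputable section

/-- `e(θ) = exp(2πiθ)`. -/
def eC (θ : ℝ) : ℂ := Complex.exp (2 * Real.pi * Complex.I * θ)

/-- Index pairs `(l, n)` for the distinct exponents `k_{l,n}`. -/
abbrev KIdx (t : ℕ) (ν : Fin t → ℕ) := Σ l : Fin t, Fin (ν l)

/-- Equation indices `(l, n, m)`: the `μ_l` equations of exponent `k_{l,n}`
(the interval `𝓘_{l,n}`). -/
abbrev EqIdx (t : ℕ) (ν μ : Fin t → ℕ) := Σ l : Fin t, Fin (ν l) × Fin (μ l)

variable (t : ℕ) (ν μ : Fin t → ℕ) (k : (l : Fin t) → Fin (ν l) → ℕ)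

/-- The degree `d_i` of equation `i`. -/
def deg (i : EqIdx t ν μ) : ℕ := k i.1 i.2.1

/-- `μ_h` for `1 ≤ h ≤ t` (`1`-based), with the convention `μ_{t+1} = 0`. -/
def mu1 (h : ℕ) : ℕ := if hh : 1 ≤ h ∧ h ≤ t then μ ⟨h - 1, by omega⟩ else 0

/-- `ϖ_h = ν(1) + ⋯ + ν(h)`. -/
def varpi (h : ℕ) : ℕ := ∑ l : Fin t, if (l : ℕ) < h then ν l else 0

/-- `K_1 + ⋯ + K_h`. -/
def Ksum (h : ℕ) : ℕ := ∑ p : KIdx t ν, if (p.1 : ℕ) < h then k p.1 p.2 else 0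

/-- The largest degree `k`. -/
def kmax : ℕ := Finset.univ.sup fun p : KIdx t ν => k p.1 p.2

/-- The total degree `K = d_1 + ⋯ + d_r`. -/
def Ktot : ℕ := ∑ i : EqIdx t ν μ, deg t ν μ k i

/-- The grouping hypotheses: `t ≥ 1`, all `ν l ≥ 1`, the multiplicities are
positive and strictly decreasing `μ_1 > ⋯ > μ_t`, and the exponents `k_{l,n}`
are positive and pairwise distinct. -/
def GroupedDegrees : Prop :=
  0 < t ∧ (∀ l, 0 < ν l) ∧ (∀ l, 0 < μ l) ∧ StrictAnti μ ∧
    (∀ l n, 0 < k l n) ∧ Function.Injective fun p : KIdx t ν => k p.1 p.2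

/-- `ℤ ∩ [1, P]` as a finite set. -/
def completeFS (P : ℝ) : Finset ℕ := Finset.Icc 1 ⌊P⌋₊

/-- `𝒜(P,R)`: the `R`-smooth numbers up to `P`. -/
def smoothFS (P R : ℝ) : Finset ℕ :=
  (Finset.Icc 1 ⌊P⌋₊).filter fun n => ∀ p : ℕ, p.Prime → p ∣ n → (p : ℝ) ≤ R

/-- The exponential sum `f_{𝐤_h}(γ; 𝒜) = Σ_{x ∈ 𝒜} e(Σ_{l ≤ h, n} γ_{l,n} x^{k_{l,n}})`. -/
def fA (A : Finset ℕ) (h : ℕ) (γ : KIdx t ν → ℝ) : ℂ :=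
  ∑ x ∈ A, eC (∑ p : KIdx t ν, if (p.1 : ℕ) < h then γ p * (x : ℝ) ^ (k p.1 p.2) else 0)

/-- The mean value `J_{u,𝐤_h}(𝒜)` (the coordinates `γ_{l,n}` with `l > h` are
dummy variables over the probability box, so this agrees with the
`ϖ_h`-dimensional integral). -/
def JA (A : Finset ℕ) (u h : ℕ) : ℝ :=
  ∫ γ in Set.univ.pi fun _ : KIdx t ν => Set.Ico (0 : ℝ) 1, ‖fA t ν k A h γ‖ ^ (2 * u)

variable (s : ℕ) (c : EqIdx t ν μ → Fin s → ℤ)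

/-- The system `Σ_j c_{ij} x_j^{d_i} = 0` is highly non-singular: all coefficients
are nonzero and every `μ_l × μ_l` minor taken from the rows `𝓘_{l,n}` is nonzero. -/
def HighlyNonSingular : Prop :=
  (∀ i j, c i j ≠ 0) ∧
  ∀ (l : Fin t) (n : Fin (ν l)) (J : Fin (μ l) → Fin s), Function.Injective J →
    (Matrix.of fun m m' : Fin (μ l) => c ⟨l, (n, m)⟩ (J m')).det ≠ 0

/-- `x` is a solution of the system, with coordinates in a commutative ring. -/
def IsSol {A : Type*} [CommRing A] (x : Fin s → A) : Prop :=
  ∀ i, ∑ j, (c i j : A) * x j ^ deg t ν μ k i = 0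

/-- The Jacobian `(d_i c_{ij} x_j^{d_i - 1})` has full rank `r` at `x`. -/
def JacFullRank {A : Type*} [CommRing A] (x : Fin s → A) : Prop :=
  (Matrix.of fun (i : EqIdx t ν μ) (j : Fin s) =>
      (deg t ν μ k i : A) * (c i j : A) * x j ^ (deg t ν μ k i - 1)).rank
    = Fintype.card (EqIdx t ν μ)

/-- The generalized exponential sum `f_j(α; 𝒜) = Σ_{x ∈ 𝒜} e(Σ_{l,n} γ_{j,l,n} x^{k_{l,n}})`,
where `γ_{j,l,n} = Σ_{i ∈ 𝓘_{l,n}} c_{ij} α_i`. -/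
def fj (A : Finset ℕ) (α : EqIdx t ν μ → ℝ) (j : Fin s) : ℂ :=
  ∑ x ∈ A, eC (∑ i : EqIdx t ν μ, (c i j : ℝ) * α i * (x : ℝ) ^ deg t ν μ k i)

end

noncomputable section

/-- `u_0(𝐤_h)`: the least `u` such that for all sufficiently small `η > 0` one has
`∫ |f_{𝐤_h}(γ; 𝒜(P,P^η))|^{2u} dγ ≪ P^{2u - (K_1+⋯+K_h)}` for all large `P`. -/
def u0 (t : ℕ) (ν : Fin t → ℕ) (k : (l : Fin t) → Fin (ν l) → ℕ) (h : ℕ) : ℕ :=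
  sInf {u : ℕ | ∃ η₀ : ℝ, 0 < η₀ ∧ ∀ η ∈ Set.Ioc (0 : ℝ) η₀, ∃ C : ℝ, ∃ P₀ : ℝ,
    ∀ P : ℝ, P₀ ≤ P →
      JA t ν k (smoothFS P (P ^ η)) u h ≤ C * P ^ ((2 * u : ℝ) - (Ksum t ν k h : ℝ))}

end

noncomputable section

lemma eC_eq (θ : ℝ) : eC θ = Complex.exp (Complex.I * (2 * Real.pi * θ : ℝ)) := by
  unfold eC; congr 1; push_cast; ring

lemma eC_add (x y : ℝ) : eC (x + y) = eC x * eC y := by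
  simp only [eC]; rw [← Complex.exp_add]; congr 1; push_cast; ring

@[simp] lemma eC_zero : eC 0 = 1 := by simp [eC]

@[simp] lemma norm_eC (x : ℝ) : ‖eC x‖ = 1 := by
  rw [eC_eq, mul_comm, Complex.norm_exp_ofReal_mul_I]

lemma eC_int (n : ℤ) : eC n = 1 := by
  rw [eC, Complex.exp_eq_one_iff]; exact ⟨n, by push_cast; ring⟩

lemma eC_add_int (x : ℝ) (n : ℤ) : eC (x + n) = eC x := by
  rw [eC_add, eC_int, mul_one]

lemma eC_neg (x : ℝ) : eC (-x) = (starRingEnd ℂ) (eC x) := by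
  simp only [eC]; rw [← Complex.exp_conj]; congr 1; simp [Complex.conj_ofNat]

lemma eC_sub (x y : ℝ) : eC (x - y) = eC x * (starRingEnd ℂ) (eC y) := by
  rw [sub_eq_add_neg, eC_add, eC_neg]

lemma continuous_eC : Continuous eC := by
  unfold eC; fun_prop

@[fun_prop] lemma Continuous.eC' {X : Type*} [TopologicalSpace X] {f : X → ℝ}
    (hf : Continuous f) : Continuous fun x => eC (f x) := continuous_eC.comp hf

lemma eC_sum {X : Type*} (S : Finset X) (f : X → ℝ) : eC (∑ i ∈ S, f i) = ∏ i ∈ S, eC (f i) := by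
  induction S using Finset.induction_on with
  | empty => simp
  | insert a S ha ih => rw [Finset.sum_insert ha, Finset.prod_insert ha, eC_add, ih]

lemma eC_nat_mul (n : ℕ) (x : ℝ) : eC (n * x) = eC x ^ n := by
  simp only [eC]; rw [← Complex.exp_nat_mul]; congr 1; push_cast; ring

lemma norm_eC_sub_one_le (x : ℝ) : ‖eC x - 1‖ ≤ 2 * Real.pi * |x| := by
  rw [eC_eq]
  refine Real.norm_exp_I_mul_ofReal_sub_one_le.trans ?_
  rw [Real.norm_eq_abs, abs_mul, abs_of_pos Real.two_pi_pos]

lemma norm_eC_sub_eC_le (x y : ℝ) : ‖eC x - eC y‖ ≤ 2 * Real.pi * |x - y| := by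
  have : eC x - eC y = (eC (x - y) - 1) * eC y := by
    rw [sub_mul, ← eC_add]; simp
  rw [this, norm_mul, norm_eC, mul_one]; exact norm_eC_sub_one_le _

lemma le_norm_eC_sub_one {x : ℝ} (hx : |x| ≤ 1 / 2) : 4 * |x| ≤ ‖eC x - 1‖ := by
  rw [eC_eq, Complex.norm_exp_I_mul_ofReal_sub_one, norm_mul]
  have h1 : 2 * Real.pi * x / 2 = Real.pi * x := by ring
  rw [h1]
  have h2 : 2 * |x| ≤ |Real.sin (Real.pi * x)| := by
    have hs : |Real.sin (Real.pi * x)| = |Real.sin (Real.pi * |x|)| := by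
      rcases abs_cases x with ⟨h, _⟩ | ⟨h, _⟩ <;> rw [h]
      rw [mul_neg, Real.sin_neg, abs_neg]
    rw [hs]
    have hp := Real.pi_pos
    have := Real.mul_le_sin (x := Real.pi * |x|) (by positivity) (by nlinarith)
    have h3 : 2 / Real.pi * (Real.pi * |x|) = 2 * |x| := by field_simp
    rw [h3] at this
    exact this.trans (le_abs_self _)
  simp only [Real.norm_eq_abs, abs_two]
  linarith

/-- The half-open unit box. -/
def ubox (ι : Type*) : Set (ι → ℝ) := Set.univ.pi fun _ : ι => Set.Ico (0 : ℝ) 1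

section box
variable {ι : Type*} [Fintype ι]

lemma measurableSet_ubox : MeasurableSet (ubox ι) :=
  MeasurableSet.univ_pi fun _ => measurableSet_Ico

lemma volume_ubox : volume (ubox ι) = 1 := by
  rw [ubox, Real.volume_pi_Ico]; simp

instance : IsProbabilityMeasure (volume.restrict (ubox ι)) :=
  ⟨by rw [Measure.restrict_apply_univ, volume_ubox]⟩

lemma integrableOn_ubox {E : Type*} [NormedAddCommGroup E] {f : (ι → ℝ) → E} (hf : Continuous f) :
    IntegrableOn f (ubox ι) := by
  have : IntegrableOn f (Set.univ.pi fun _ : ι => Set.Icc (0 : ℝ) 1) :=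
    hf.continuousOn.integrableOn_compact (isCompact_univ_pi fun _ => isCompact_Icc)
  exact this.mono_set (Set.pi_mono fun _ _ => Set.Ico_subset_Icc_self)

lemma integral_eC_one (n : ℤ) : ∫ x in Set.Ico (0 : ℝ) 1, eC (n * x) = if n = 0 then 1 else 0 := by
  rw [integral_Ico_eq_integral_Ioc, ← intervalIntegral.integral_of_le zero_le_one]
  split_ifs with h
  · simp [h]
  · have hc : (2 * Real.pi * Complex.I * n : ℂ) ≠ 0 := by
      simp [Real.pi_ne_zero, h]
    have : ∀ x : ℝ, eC (n * x) = Complex.exp ((2 * Real.pi * Complex.I * n) * x) := by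
      intro x; rw [eC]; congr 1; push_cast; ring
    simp_rw [this]
    rw [integral_exp_mul_complex hc]
    have h1 : Complex.exp (2 * Real.pi * Complex.I * n * (1 : ℝ)) = 1 := by
      rw [← eC_int n, eC]; congr 1; push_cast; ring
    rw [h1]; simp

lemma integral_eC_lin (n : ι → ℤ) :
    ∫ α in ubox ι, eC (∑ i, (n i : ℝ) * α i) = if n = 0 then 1 else 0 := by
  simp_rw [eC_sum]
  rw [ubox, volume_pi, Measure.restrict_pi_pi]
  rw [integral_fintype_prod_eq_prod (fun i x => eC ((n i : ℝ) * x))]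
  simp_rw [integral_eC_one]
  split_ifs with h
  · simp [h]
  · obtain ⟨i, hi⟩ := Function.ne_iff.1 h
    exact Finset.prod_eq_zero (Finset.mem_univ i) (by simpa using hi)

lemma integral_sum_eC {Ω : Type*} (S : Finset Ω) (φ : Ω → ι → ℤ) :
    ∫ α in ubox ι, ∑ ω ∈ S, eC (∑ i, (φ ω i : ℝ) * α i) = ((S.filter fun ω => φ ω = 0).card : ℂ) := by
  rw [integral_finsetSum]
  · simp_rw [integral_eC_lin]
    rw [Finset.sum_boole]
  · intro ω _
    exact integrableOn_ubox (by fun_prop)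

/-- Pairs of `u`-tuples from `A`. -/
def tuples (A : Finset ℕ) (u : ℕ) : Finset ((Fin u → ℕ) × (Fin u → ℕ)) :=
  (Fintype.piFinset fun _ => A) ×ˢ (Fintype.piFinset fun _ => A)

/-- The difference of the sums of `ψ` over the two halves of a pair of tuples. -/
def tdiff {G : Type*} [AddCommGroup G] {u : ℕ} (ψ : ℕ → G) (z : (Fin u → ℕ) × (Fin u → ℕ)) : G :=
  ∑ a, ψ (z.1 a) - ∑ a, ψ (z.2 a)

lemma tdiff_apply {κ : Type*} {u : ℕ} (ψ : ℕ → κ → ℤ) (z : (Fin u → ℕ) × (Fin u → ℕ)) (i : κ) :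
    tdiff ψ z i = tdiff (fun x => ψ x i) z := by
  simp [tdiff, Finset.sum_apply]

lemma sum_eC_pow (A : Finset ℕ) (u : ℕ) (L : ℕ → ℝ) :
    (∑ x ∈ A, eC (L x)) ^ u = ∑ x ∈ Fintype.piFinset (fun _ : Fin u => A), eC (∑ a, L (x a)) := by
  simp_rw [eC_sum]
  rw [← Finset.prod_univ_sum (fun _ : Fin u => A) (fun _ x => eC (L x))]
  simp

lemma normpow_expand (A : Finset ℕ) (u : ℕ) (L : ℕ → ℝ) :
    ((‖∑ x ∈ A, eC (L x)‖ ^ (2 * u) : ℝ) : ℂ) = ∑ z ∈ tuples A u, eC (tdiff L z) := by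
  rw [tuples, Finset.sum_product]
  simp only [tdiff]
  simp_rw [eC_sub, ← Finset.mul_sum]
  rw [← Finset.sum_mul, ← map_sum, ← sum_eC_pow, pow_mul, ← Complex.normSq_eq_norm_sq]
  push_cast
  rw [map_pow, ← mul_pow, Complex.mul_conj]

lemma tdiff_lin {u : ℕ} (ψ : ℕ → ι → ℤ) (α : ι → ℝ) (z : (Fin u → ℕ) × (Fin u → ℕ)) :
    tdiff (fun x => ∑ i, (ψ x i : ℝ) * α i) z = ∑ i, (tdiff ψ z i : ℝ) * α i := by
  simp only [tdiff, Pi.sub_apply, Finset.sum_apply]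
  push_cast
  simp_rw [sub_mul, Finset.sum_mul, Finset.sum_sub_distrib]
  rw [Finset.sum_comm]
  congr 1
  rw [Finset.sum_comm]

lemma integral_normpow (A : Finset ℕ) (u : ℕ) (ψ : ℕ → ι → ℤ) :
    ∫ α in ubox ι, ‖∑ x ∈ A, eC (∑ i, (ψ x i : ℝ) * α i)‖ ^ (2 * u) =
      (((tuples A u).filter fun z => tdiff ψ z = 0).card : ℝ) := by
  have h := integral_sum_eC (tuples A u) (fun z => tdiff ψ z)
  have h2 : ∀ α : ι → ℝ, ∑ ω ∈ tuples A u, eC (∑ i, (tdiff ψ ω i : ℝ) * α i) =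
      ((‖∑ x ∈ A, eC (∑ i, (ψ x i : ℝ) * α i)‖ ^ (2 * u) : ℝ) : ℂ) := by
    intro α
    rw [normpow_expand]
    simp_rw [tdiff_lin]
  simp_rw [h2] at h
  rw [integral_complex_ofReal] at h
  exact_mod_cast h

/-- The number of solutions of the shifted system is at most that of the unshifted one. -/
lemma card_tdiff_eq_le (A : Finset ℕ) (u : ℕ) (ψ : ℕ → ι → ℤ) (v : ι → ℤ) :
    ((tuples A u).filter fun z => tdiff ψ z = v).card ≤
      ((tuples A u).filter fun z => tdiff ψ z = 0).card := by
  have h := integral_sum_eC (tuples A u) (fun z => tdiff ψ z - v)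
  have h2 : ∀ α : ι → ℝ, ∑ ω ∈ tuples A u, eC (∑ i, ((tdiff ψ ω - v) i : ℝ) * α i) =
      ((‖∑ x ∈ A, eC (∑ i, (ψ x i : ℝ) * α i)‖ ^ (2 * u) : ℝ) : ℂ) * eC (-∑ i, (v i : ℝ) * α i) := by
    intro α
    rw [normpow_expand, Finset.sum_mul]
    refine Finset.sum_congr rfl fun z _ => ?_
    rw [tdiff_lin, ← eC_add]
    congr 1
    rw [← sub_eq_add_neg, ← Finset.sum_sub_distrib]
    refine Finset.sum_congr rfl fun i _ => ?_
    simp only [Pi.sub_apply]; push_cast; ring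
  simp_rw [h2] at h
  have h3 := norm_integral_le_integral_norm (μ := volume.restrict (ubox ι))
    (fun α : ι → ℝ => ((‖∑ x ∈ A, eC (∑ i, (ψ x i : ℝ) * α i)‖ ^ (2 * u) : ℝ) : ℂ) *
      eC (-∑ i, (v i : ℝ) * α i))
  rw [h] at h3
  simp only [norm_mul, norm_eC, mul_one, Complex.norm_real, norm_pow, norm_norm,
    Complex.norm_natCast] at h3
  rw [integral_normpow] at h3
  have h4 : ((tuples A u).filter fun z => tdiff ψ z = v) =
      ((tuples A u).filter fun z => tdiff ψ z - v = 0) := by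
    simp_rw [sub_eq_zero]
  rw [h4]
  exact_mod_cast h3

end box

lemma card_modEq_le {S : Finset ℕ} {N b : ℕ} (hS : S ⊆ Finset.Icc 1 N)
    (hc : ∀ x ∈ S, ∀ y ∈ S, x % b = y % b) : S.card ≤ N / b + 1 := by
  have : S.card ≤ (Finset.range (N / b + 1)).card := by
    refine Finset.card_le_card_of_injOn (fun h => h / b) ?_ ?_
    · intro h hh
      have := Finset.mem_Icc.1 (hS hh)
      simp only [Finset.coe_range, Set.mem_Iio]
      exact Nat.lt_succ_of_le (Nat.div_le_div_right this.2)
    · intro x hx y hy hxy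
      have h1 := Nat.div_add_mod x b
      have h2 := Nat.div_add_mod y b
      simp only at hxy
      rw [hc x hx y hy, hxy] at h1
      omega
  simpa using this

/-- If many multiples of `θ` are close to integers, then `θ` is close to a rational number of
small denominator. -/
lemma exists_approx_of_many {θ ε K : ℝ} {N : ℕ} {S : Finset ℕ} (hS : S ⊆ Finset.Icc 1 N)
    (hK : 1 ≤ K) (hcard : (N : ℝ) ≤ K * S.card) (hε0 : 0 ≤ ε) (hε : 40 * K * ε ≤ 1)
    (hN : 6 * K ≤ N) (h : ∀ x ∈ S, ∃ z : ℤ, |θ * x - z| ≤ ε) :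
    ∃ q : ℕ, 1 ≤ q ∧ (q : ℝ) ≤ 3 * K ∧ ∃ z : ℤ, |q * θ - z| * N ≤ 3 * K ^ 2 * ε := by
  have hN0 : (0 : ℝ) < N := by linarith
  have hN1 : 0 < N := by exact_mod_cast hN0
  obtain ⟨r, hr, hrd⟩ := Real.exists_rat_abs_sub_le_and_den_le θ (n := 4 * N) (by omega)
  set b := r.den with hb
  set a := r.num with ha
  have hb0 : 0 < b := r.den_pos
  have hbR : (0 : ℝ) < b := by exact_mod_cast hb0
  have hrab : (r : ℝ) = a / b := by
    rw [ha, hb]; exact_mod_cast (Rat.num_div_den r).symm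
  have hβ : b * |θ - a / b| ≤ 1 / (4 * N + 1) := by
    rw [hrab] at hr
    calc b * |θ - a / b| ≤ b * (1 / ((((4 * N : ℕ) : ℝ) + 1) * b)) := by gcongr
      _ = 1 / (4 * N + 1) := by push_cast; field_simp
  choose! z hz using h
  have hv : ∀ x ∈ S, (|((x : ℤ) * a - b * z x : ℤ)| : ℝ) ≤ b * ε + 1 / 4 := by
    intro x hx
    have hxN : (x : ℝ) ≤ N := by exact_mod_cast (Finset.mem_Icc.1 (hS hx)).2
    have e : (((x : ℤ) * a - b * z x : ℤ) : ℝ) = b * (θ * x - z x) - x * (b * (θ - a / b)) := by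
      push_cast; field_simp; ring
    rw [e]
    refine (abs_sub _ _).trans ?_
    rw [abs_mul, abs_mul, abs_mul, Nat.abs_cast, Nat.abs_cast]
    have h1 : (x : ℝ) * (b * |θ - a / b|) ≤ N * (1 / (4 * N + 1)) := by gcongr
    have h2 : (N : ℝ) * (1 / (4 * N + 1)) ≤ 1 / 4 := by
      rw [mul_one_div, div_le_div_iff₀ (by positivity) (by norm_num)]; linarith
    have h3 := mul_le_mul_of_nonneg_left (hz x hx) hbR.le
    linarith
  have hcop : IsCoprime a (b : ℤ) := by
    rw [Int.isCoprime_iff_gcd_eq_one]; exact r.reduced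
  have hcount : (S.card : ℝ) ≤ (N / b + 1) * (2 * (b * ε + 1 / 4) + 1) := by
    set V : ℤ := ⌊(b * ε + 1 / 4 : ℝ)⌋ with hV
    have hV0 : 0 ≤ V := Int.floor_nonneg.2 (by positivity)
    set f : ℕ → ℤ := fun x => (x : ℤ) * a - b * z x
    have hf : S.image f ⊆ Finset.Icc (-V) V := by
      intro v hv'
      obtain ⟨x, hx, rfl⟩ := Finset.mem_image.1 hv'
      have := hv x hx
      rw [Finset.mem_Icc, ← abs_le]
      rw [hV, Int.le_floor]
      simpa [f] using this
    have h1 := Finset.card_le_mul_card_image (f := f) S (N / b + 1) (by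
      intro v _
      refine card_modEq_le ((Finset.filter_subset _ _).trans hS) ?_
      intro x hx y hy
      have hx' := (Finset.mem_filter.1 hx).2
      have hy' := (Finset.mem_filter.1 hy).2
      have : ((x : ℤ) - y) * a = b * (z x - z y) := by
        simp only [f] at hx' hy'; linear_combination hx' - hy'
      have hd : (b : ℤ) ∣ (x : ℤ) - y :=
        hcop.symm.dvd_of_dvd_mul_right (Dvd.intro _ this.symm)
      have h5 : (x : ℤ) % b = y % b := Int.emod_eq_emod_iff_emod_sub_eq_zero.2 (Int.emod_eq_zero_of_dvd hd)
      exact_mod_cast h5)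
    have h2 : (S.image f).card ≤ (2 * V + 1).toNat := by
      refine (Finset.card_le_card hf).trans ?_
      rw [Int.card_Icc]; apply Int.toNat_le_toNat; linarith
    have h3 : ((2 * V + 1).toNat : ℝ) ≤ 2 * (b * ε + 1 / 4) + 1 := by
      have : ((2 * V + 1).toNat : ℤ) = 2 * V + 1 := Int.toNat_of_nonneg (by linarith)
      have h4 : ((2 * V + 1).toNat : ℝ) = 2 * V + 1 := by exact_mod_cast this
      rw [h4]
      have := Int.floor_le (b * ε + 1 / 4 : ℝ)
      rw [← hV] at this
      linarith
    have h4 : ((N / b : ℕ) : ℝ) ≤ N / b := Nat.cast_div_le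
    calc (S.card : ℝ) ≤ ((N / b + 1) * (S.image f).card : ℕ) := by exact_mod_cast h1
      _ ≤ ((N / b + 1) * (2 * V + 1).toNat : ℕ) := by exact_mod_cast Nat.mul_le_mul_left _ h2
      _ = ((N / b : ℕ) + 1) * ((2 * V + 1).toNat : ℝ) := by push_cast; ring
      _ ≤ _ := by gcongr
  have hb4 : (b : ℝ) ≤ 4 * N := by exact_mod_cast hrd
  have hbK : (b : ℝ) ≤ 3 * K := by
    have h1 : (N : ℝ) ≤ K * ((N / b + 1) * (2 * (b * ε + 1 / 4) + 1)) :=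
      hcard.trans (by gcongr)
    have h2 : ((N : ℝ) / b + 1) * (2 * (b * ε + 1 / 4) + 1)
        = 2 * N * ε + 2 * b * ε + 3 / 2 * (N / b) + 3 / 2 := by field_simp; ring
    rw [h2] at h1
    have h3 : 2 * N * ε + 2 * b * ε ≤ 10 * N * ε := by nlinarith
    have h4 : K * (10 * N * ε) ≤ N / 4 := by nlinarith
    have h5 : (N : ℝ) / 2 ≤ K * (3 / 2 * (N / b)) := by nlinarith
    have h6 : (N : ℝ) / 2 * b ≤ K * (3 / 2 * N) := by
      calc (N : ℝ) / 2 * b ≤ K * (3 / 2 * (N / b)) * b := by gcongr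
        _ = _ := by field_simp
    nlinarith
  refine ⟨b, hb0, hbK, a, ?_⟩
  have hKS : (N : ℝ) / K ≤ S.card := by
    rw [div_le_iff₀ (by linarith)]; linarith
  obtain ⟨x, hxS, hx⟩ : ∃ x ∈ S, (S.card : ℝ) ≤ x := by
    have hne : S.Nonempty := by
      rw [← Finset.card_pos]
      have : (0 : ℝ) < S.card := lt_of_lt_of_le (by positivity) hKS
      exact_mod_cast this
    refine ⟨S.max' hne, S.max'_mem hne, ?_⟩
    have : S ⊆ Finset.Icc 1 (S.max' hne) := fun y hy =>
      Finset.mem_Icc.2 ⟨(Finset.mem_Icc.1 (hS hy)).1, S.le_max' y hy⟩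
    have := Finset.card_le_card this
    simp only [Nat.card_Icc, Nat.add_sub_cancel] at this
    exact_mod_cast this
  have hv0 : (x : ℤ) * a - b * z x = 0 := by
    have h1 := hv x hxS
    have h2 : (b : ℝ) * ε ≤ 3 / 40 := by nlinarith
    have h3 : (|((x : ℤ) * a - b * z x : ℤ)| : ℝ) < 1 := by linarith
    have h4 : |(x : ℤ) * a - b * z x| < 1 := by
      exact_mod_cast h3
    exact Int.abs_lt_one_iff.1 h4
  have hv1 : (x : ℝ) * a = b * z x := by
    have : (x : ℤ) * a = b * z x := by linarith
    exact_mod_cast this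
  have h1 : x * |b * θ - a| = b * |θ * x - z x| := by
    have : (x : ℝ) * |b * θ - a| = |x * (b * θ - a)| := by rw [abs_mul, Nat.abs_cast]
    rw [this]
    have h2 : (b : ℝ) * |θ * x - z x| = |b * (θ * x - z x)| := by rw [abs_mul, Nat.abs_cast]
    rw [h2]; congr 1; linear_combination -hv1
  have h2 : x * |b * θ - a| ≤ 3 * K * ε := by
    rw [h1]; exact mul_le_mul hbK (hz x hxS) (abs_nonneg _) (by linarith)
  have h3 : (N : ℝ) ≤ K * x := by
    calc (N : ℝ) ≤ K * S.card := hcard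
      _ ≤ K * x := by gcongr
  calc |b * θ - a| * N ≤ |b * θ - a| * (K * x) := by gcongr
    _ = K * (x * |b * θ - a|) := by ring
    _ ≤ K * (3 * K * ε) := by gcongr
    _ = _ := by ring

lemma geom_eC_bound {φ : ℝ} (hφ : |φ| ≤ 1 / 2) (L : ℕ) :
    ‖∑ m ∈ Finset.range L, eC (m * φ)‖ * (4 * |φ|) ≤ 2 := by
  have h : (∑ m ∈ Finset.range L, eC (m * φ)) * (eC φ - 1) = eC φ ^ L - 1 := by
    simp_rw [eC_nat_mul]; exact geom_sum_mul _ _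
  calc _ ≤ ‖∑ m ∈ Finset.range L, eC (m * φ)‖ * ‖eC φ - 1‖ := by
        gcongr; exact le_norm_eC_sub_one hφ
    _ = ‖eC φ ^ L - 1‖ := by rw [← norm_mul, h]
    _ ≤ ‖eC φ ^ L‖ + ‖(1 : ℂ)‖ := norm_sub_le _ _
    _ = 2 := by rw [norm_pow, norm_eC]; norm_num

/-- `q α` is within `K ^ B / N ^ j` of an integer. -/
def App (N : ℕ) (K : ℝ) (B q : ℕ) (α : ℝ) (j : ℕ) : Prop :=
  ∃ z : ℤ, |q * α - z| * (N : ℝ) ^ j ≤ K ^ B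

lemma App.mul {N : ℕ} {K : ℝ} {B q : ℕ} {α : ℝ} {j : ℕ} (h : App N K B q α j) {m C : ℕ}
    (hm : (m : ℝ) ≤ K ^ C) : App N K (C + B) (m * q) α j := by
  obtain ⟨z, hz⟩ := h
  have hC : 0 ≤ K ^ C := (Nat.cast_nonneg m).trans hm
  refine ⟨m * z, ?_⟩
  have : ((m * q : ℕ) : ℝ) * α - ((m * z : ℤ) : ℝ) = m * (q * α - z) := by push_cast; ring
  rw [this, abs_mul, Nat.abs_cast, pow_add, mul_assoc]
  gcongr

lemma App.mono {N : ℕ} {K : ℝ} {B B' q : ℕ} {α : ℝ} {j : ℕ} (h : App N K B q α j)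
    (hK : 1 ≤ K) (hB : B ≤ B') : App N K B' q α j := by
  obtain ⟨z, hz⟩ := h
  exact ⟨z, hz.trans (pow_le_pow_right₀ hK hB)⟩

lemma App.of_small {N : ℕ} {K : ℝ} {B : ℕ} {α : ℝ} {j : ℕ} (hN : (N : ℝ) ≤ K ^ B) :
    App N K (B * j) 1 α j := by
  refine ⟨round α, ?_⟩
  have : |((1 : ℕ) : ℝ) * α - round α| ≤ 1 := by
    rw [Nat.cast_one, one_mul]; exact (abs_sub_round α).trans (by norm_num)
  calc _ ≤ 1 * (N : ℝ) ^ j := by gcongr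
    _ ≤ K ^ (B * j) := by rw [one_mul, pow_mul]; gcongr

/-- The complete polynomial exponential sum. -/
def wsum (N D : ℕ) (α : ℕ → ℝ) : ℂ :=
  ∑ n ∈ Finset.Icc 1 N, eC (∑ j ∈ Finset.range (D + 1), α j * (n : ℝ) ^ j)

/-- Coefficients of the difference polynomial. -/
def dcoef (D : ℕ) (α : ℕ → ℝ) (h i : ℕ) : ℝ :=
  ∑ j ∈ Finset.Ico (i + 1) (D + 1), α j * (j.choose i * (h : ℝ) ^ (j - i))

lemma sum_shift_sub (D : ℕ) (α : ℕ → ℝ) (n h : ℕ) :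
    ∑ j ∈ Finset.range (D + 1), α j * ((n + h : ℕ) : ℝ) ^ j -
      ∑ j ∈ Finset.range (D + 1), α j * (n : ℝ) ^ j =
    ∑ i ∈ Finset.range D, dcoef D α h i * (n : ℝ) ^ i := by
  rw [← Finset.sum_sub_distrib]
  have h1 : ∀ j, α j * ((n + h : ℕ) : ℝ) ^ j - α j * (n : ℝ) ^ j =
      ∑ i ∈ Finset.range j, α j * (j.choose i * (h : ℝ) ^ (j - i)) * (n : ℝ) ^ i := by
    intro j
    push_cast
    rw [add_pow, Finset.sum_range_succ]
    simp only [Nat.sub_self, pow_zero, mul_one, Nat.choose_self, Nat.cast_one]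
    rw [mul_add, add_sub_cancel_right, Finset.mul_sum]
    refine Finset.sum_congr rfl fun i _ => by ring
  simp_rw [h1, dcoef, Finset.sum_mul]
  rw [Finset.sum_comm']
  intro x y
  simp only [Finset.mem_range, Finset.mem_Ico]
  omega

lemma two_le_pow_bounds {K : ℝ} (hK : 2 ≤ K) (D : ℕ) : (D : ℝ) ≤ K ^ D ∧ (2 : ℝ) ^ D ≤ K ^ D := by
  have h2 : (2 : ℝ) ^ D ≤ K ^ D := by gcongr
  refine ⟨?_, h2⟩
  have : (D : ℝ) ≤ 2 ^ D := by exact_mod_cast Nat.lt_two_pow_self.le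
  linarith

lemma weyl_descend (D B₁ m : ℕ) (hm : m + 1 ≤ D) :
    ∃ B : ℕ, ∀ (N : ℕ) (K : ℝ) (α : ℕ → ℝ) (q₁ : ℕ) (H : Finset ℕ), 1 ≤ N → 2 ≤ K → K ^ B ≤ N →
      1 ≤ q₁ → (q₁ : ℝ) ≤ K ^ B₁ → H ⊆ Finset.Icc 1 N → (N : ℝ) ≤ K ^ B₁ * H.card →
      (∀ h ∈ H, ∀ i, 1 ≤ i → i < D → App N K B₁ q₁ (dcoef D α h i) i) →
      ∃ q : ℕ, 1 ≤ q ∧ (q : ℝ) ≤ K ^ B ∧ ∀ j, D < j + m → j ≤ D → App N K B q (α j) j := by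
  induction m with
  | zero =>
    refine ⟨0, fun N K α q₁ H _ _ _ _ _ _ _ _ => ⟨1, le_rfl, by simp, fun j h1 h2 => by omega⟩⟩
  | succ m ih =>
    obtain ⟨B, hB⟩ := ih (by omega)
    obtain ⟨i₀, hi₀⟩ : ∃ i₀, D = i₀ + 1 + m := ⟨D - m - 1, by omega⟩
    have hi1 : 1 ≤ i₀ := by omega
    set Bx := B + B₁ + 2 * D + 1 with hBx
    refine ⟨3 * B₁ + Bx + B + D + 10, fun N K α q₁ H hN hK hNK hq₁ hq₁K hHN hH hApp => ?_⟩
    have hK1 : 1 ≤ K := by linarith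
    have hK0 : 0 < K := by linarith
    have hN0 : (0 : ℝ) < N := by exact_mod_cast hN
    obtain ⟨q, hq1, hqK, hq⟩ := hB N K α q₁ H hN hK
      ((pow_le_pow_right₀ hK1 (by omega)).trans hNK) hq₁ hq₁K hHN hH hApp
    obtain ⟨hDK, h2K⟩ := two_le_pow_bounds hK D
    set ε : ℝ := K ^ Bx / (N : ℝ) ^ i₀ with hε
    have hε0 : 0 ≤ ε := by positivity
    have hεN : ε ≤ K ^ Bx / N := by
      rw [hε]; gcongr
      calc (N : ℝ) = N ^ 1 := (pow_one _).symm
        _ ≤ N ^ i₀ := pow_le_pow_right₀ (by exact_mod_cast hN) hi1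
    have key : ∀ h ∈ H, ∃ z : ℤ, |((i₀ + 1 : ℕ) * (q * q₁ : ℕ) * α (i₀ + 1)) * h - z| ≤ ε := by
      intro h hh
      have hhN : (h : ℝ) ≤ N := by exact_mod_cast (Finset.mem_Icc.1 (hHN hh)).2
      obtain ⟨z₀, hz₀⟩ := hApp h hh i₀ hi1 (by omega)
      have hex : ∀ j, ∃ z : ℤ, j ∈ Finset.Ico (i₀ + 2) (D + 1) →
          |q * α j - z| * (N : ℝ) ^ j ≤ K ^ B := by
        intro j
        by_cases hj : j ∈ Finset.Ico (i₀ + 2) (D + 1)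
        · obtain ⟨z, hz⟩ := hq j (by have := Finset.mem_Ico.1 hj; omega)
            (by have := Finset.mem_Ico.1 hj; omega)
          exact ⟨z, fun _ => hz⟩
        · exact ⟨0, fun h => absurd h hj⟩
      choose z hz using hex
      have hsplit : dcoef D α h i₀ = α (i₀ + 1) * ((i₀ + 1 : ℕ) * h) +
          ∑ j ∈ Finset.Ico (i₀ + 2) (D + 1), α j * (j.choose i₀ * (h : ℝ) ^ (j - i₀)) := by
        rw [dcoef, Finset.sum_eq_sum_Ico_succ_bot (by omega)]
        simp
      refine ⟨q * z₀ - ∑ j ∈ Finset.Ico (i₀ + 2) (D + 1),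
        q₁ * z j * (j.choose i₀ * (h : ℤ) ^ (j - i₀)), ?_⟩
      have e : ((i₀ + 1 : ℕ) * (q * q₁ : ℕ) * α (i₀ + 1)) * h -
          ((q * z₀ - ∑ j ∈ Finset.Ico (i₀ + 2) (D + 1),
            q₁ * z j * (j.choose i₀ * (h : ℤ) ^ (j - i₀)) : ℤ) : ℝ) =
          q * (q₁ * dcoef D α h i₀ - z₀) -
          ∑ j ∈ Finset.Ico (i₀ + 2) (D + 1),
            (q * α j - z j) * (q₁ * (j.choose i₀ * (h : ℝ) ^ (j - i₀))) := by
        rw [hsplit]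
        push_cast
        simp_rw [sub_mul]
        rw [Finset.sum_sub_distrib, mul_sub, mul_add, mul_add, Finset.mul_sum, Finset.mul_sum]
        have e1 : ∑ j ∈ Finset.Ico (i₀ + 2) (D + 1),
            (q : ℝ) * (q₁ * (α j * (j.choose i₀ * (h : ℝ) ^ (j - i₀)))) =
            ∑ j ∈ Finset.Ico (i₀ + 2) (D + 1),
              q * α j * (q₁ * (j.choose i₀ * (h : ℝ) ^ (j - i₀))) :=
          Finset.sum_congr rfl fun _ _ => by ring
        have e2 : ∑ j ∈ Finset.Ico (i₀ + 2) (D + 1),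
            (q₁ : ℝ) * z j * (j.choose i₀ * (h : ℝ) ^ (j - i₀)) =
            ∑ j ∈ Finset.Ico (i₀ + 2) (D + 1),
              z j * (q₁ * (j.choose i₀ * (h : ℝ) ^ (j - i₀))) :=
          Finset.sum_congr rfl fun _ _ => by ring
        rw [e1, e2]
        ring
      rw [e]
      refine (abs_sub _ _).trans ?_
      have b1 : |q * (q₁ * dcoef D α h i₀ - z₀)| ≤ K ^ (B + B₁ + 2 * D) / N ^ i₀ := by
        rw [abs_mul, Nat.abs_cast, le_div_iff₀ (by positivity), mul_assoc]
        calc (q : ℝ) * (|q₁ * dcoef D α h i₀ - z₀| * N ^ i₀) ≤ K ^ B * K ^ B₁ := by gcongr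
          _ = K ^ (B + B₁) := by rw [pow_add]
          _ ≤ _ := pow_le_pow_right₀ hK1 (by omega)
      have b2 : |∑ j ∈ Finset.Ico (i₀ + 2) (D + 1),
            (q * α j - z j) * (q₁ * (j.choose i₀ * (h : ℝ) ^ (j - i₀)))| ≤
          K ^ (B + B₁ + 2 * D) / N ^ i₀ := by
        refine (Finset.abs_sum_le_sum_abs _ _).trans ?_
        have : ∀ j ∈ Finset.Ico (i₀ + 2) (D + 1),
            |(q * α j - z j) * (q₁ * (j.choose i₀ * (h : ℝ) ^ (j - i₀)))| ≤
            K ^ (B + B₁ + D) / N ^ i₀ := by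
          intro j hj
          have hj' := Finset.mem_Ico.1 hj
          have hc : (j.choose i₀ : ℝ) ≤ K ^ D := by
            calc (j.choose i₀ : ℝ) ≤ 2 ^ j := by exact_mod_cast Nat.choose_le_two_pow j i₀
              _ ≤ 2 ^ D := pow_le_pow_right₀ (by norm_num) (by omega)
              _ ≤ _ := h2K
          rw [abs_mul, abs_of_nonneg (a := (q₁ * (j.choose i₀ * (h : ℝ) ^ (j - i₀)))) (by positivity),
            le_div_iff₀ (by positivity)]
          calc |q * α j - z j| * (q₁ * (j.choose i₀ * (h : ℝ) ^ (j - i₀))) * N ^ i₀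
              ≤ |q * α j - z j| * (K ^ B₁ * (K ^ D * (N : ℝ) ^ (j - i₀))) * N ^ i₀ := by gcongr
            _ = (|q * α j - z j| * ((N : ℝ) ^ (j - i₀) * N ^ i₀)) * (K ^ B₁ * K ^ D) := by ring
            _ = (|q * α j - z j| * (N : ℝ) ^ j) * (K ^ B₁ * K ^ D) := by
                rw [← pow_add, Nat.sub_add_cancel (by omega)]
            _ ≤ K ^ B * (K ^ B₁ * K ^ D) := by
                gcongr; exact hz j hj
            _ = _ := by rw [pow_add, pow_add]; ring
        refine (Finset.sum_le_card_nsmul _ _ _ this).trans ?_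
        rw [nsmul_eq_mul, Nat.card_Ico]
        have hc : ((D + 1 - (i₀ + 2) : ℕ) : ℝ) ≤ K ^ D :=
          le_trans (by exact_mod_cast (by omega)) hDK
        calc _ ≤ K ^ D * (K ^ (B + B₁ + D) / N ^ i₀) := by gcongr
          _ = _ := by rw [← mul_div_assoc, ← pow_add]; congr 2; ring
      calc _ ≤ K ^ (B + B₁ + 2 * D) / N ^ i₀ + K ^ (B + B₁ + 2 * D) / N ^ i₀ := add_le_add b1 b2
        _ = K ^ (B + B₁ + 2 * D) * 2 / N ^ i₀ := by ring
        _ ≤ K ^ (B + B₁ + 2 * D) * K / N ^ i₀ := by gcongr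
        _ = ε := by rw [hε, hBx, pow_succ]
    have hP : ∀ n : ℕ, n ≤ 3 * B₁ + Bx + B + D + 10 → K ^ n ≤ N := fun n hn =>
      (pow_le_pow_right₀ hK1 hn).trans hNK
    have h64 : (64 : ℝ) ≤ K ^ 6 := by
      calc (64 : ℝ) = 2 ^ 6 := by norm_num
        _ ≤ K ^ 6 := by gcongr
    have h8 : (8 : ℝ) ≤ K ^ 3 := by
      calc (8 : ℝ) = 2 ^ 3 := by norm_num
        _ ≤ K ^ 3 := by gcongr
    have h4 : (4 : ℝ) ≤ K ^ 2 := by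
      calc (4 : ℝ) = 2 ^ 2 := by norm_num
        _ ≤ K ^ 2 := by gcongr
    obtain ⟨q₂, hq₂1, hq₂K, w, hw⟩ := exists_approx_of_many hHN (one_le_pow₀ hK1 : 1 ≤ K ^ B₁) hH hε0
      (by
        calc 40 * K ^ B₁ * ε ≤ K ^ 6 * K ^ B₁ * (K ^ Bx / N) := by gcongr; linarith
          _ = K ^ (6 + B₁ + Bx) / N := by rw [pow_add, pow_add]; ring
          _ ≤ 1 := by
            rw [div_le_one hN0]; exact hP _ (by omega))
      (by
        calc 6 * K ^ B₁ ≤ K ^ 3 * K ^ B₁ := by gcongr; linarith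
          _ = K ^ (3 + B₁) := by rw [pow_add]
          _ ≤ N := hP _ (by omega)) key
    have hq₂K' : (q₂ : ℝ) ≤ K ^ (B₁ + 2) := by
      calc (q₂ : ℝ) ≤ 3 * K ^ B₁ := hq₂K
        _ ≤ K ^ 2 * K ^ B₁ := by gcongr; linarith
        _ = _ := by rw [pow_add]; ring
    have hmult : ((q₂ * ((i₀ + 1) * q₁) : ℕ) : ℝ) ≤ K ^ (2 * B₁ + D + 2) := by
      have hi : ((i₀ + 1 : ℕ) : ℝ) ≤ K ^ D := le_trans (by exact_mod_cast (by omega)) hDK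
      push_cast at hi ⊢
      calc (q₂ : ℝ) * ((i₀ + 1) * q₁) ≤ K ^ (B₁ + 2) * (K ^ D * K ^ B₁) := by gcongr
        _ = _ := by rw [← pow_add, ← pow_add]; congr 1; omega
    refine ⟨q₂ * ((i₀ + 1) * q₁) * q, ?_, ?_, ?_⟩
    · exact Nat.one_le_iff_ne_zero.2 (by positivity)
    · rw [Nat.cast_mul]
      calc _ ≤ K ^ (2 * B₁ + D + 2) * K ^ B := by gcongr
        _ = K ^ (2 * B₁ + D + 2 + B) := by rw [pow_add _ (2 * B₁ + D + 2) B]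
        _ ≤ _ := pow_le_pow_right₀ hK1 (by omega)
    · intro j hj1 hj2
      by_cases hj : D < j + m
      · exact ((hq j hj hj2).mul hmult).mono hK1 (by omega)
      · obtain rfl : j = i₀ + 1 := by omega
        refine ⟨w, ?_⟩
        have e : ((q₂ * ((i₀ + 1) * q₁) * q : ℕ) : ℝ) * α (i₀ + 1) =
            q₂ * ((i₀ + 1 : ℕ) * (q * q₁ : ℕ) * α (i₀ + 1)) := by push_cast; ring
        rw [e, pow_succ, mul_comm _ (N : ℝ), ← mul_assoc]
        calc _ ≤ 3 * (K ^ B₁) ^ 2 * ε * N ^ i₀ := by gcongr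
          _ = 3 * (K ^ B₁) ^ 2 * K ^ Bx := by rw [hε]; field_simp
          _ ≤ K ^ 2 * (K ^ B₁) ^ 2 * K ^ Bx := by gcongr; linarith
          _ = K ^ (2 + B₁ * 2 + Bx) := by rw [← pow_mul, ← pow_add, ← pow_add]
          _ ≤ _ := pow_le_pow_right₀ hK1 (by omega)

lemma norm_sum_eC_le {X : Type*} (S : Finset X) (f : X → ℝ) : ‖∑ x ∈ S, eC (f x)‖ ≤ S.card := by
  refine (norm_sum_le _ _).trans ?_
  simp

lemma norm_shift_sum_sub_le (N a : ℕ) (g : ℕ → ℝ) :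
    ‖∑ n ∈ Finset.Icc 1 N, eC (g n) - ∑ n ∈ Finset.Icc 1 N, eC (g (n + a))‖ ≤ 2 * a := by
  have h1 : ∑ n ∈ Finset.Icc 1 N, eC (g (n + a)) = ∑ n ∈ Finset.Ico (1 + a) (N + 1 + a), eC (g n) := by
    rw [← Finset.sum_Ico_add' (fun n => eC (g n)) 1 (N + 1) a]
    rfl
  have h2 : ∑ n ∈ Finset.Icc 1 N, eC (g n) = ∑ n ∈ Finset.Ico 1 (N + 1), eC (g n) := rfl
  have h3 := Finset.sum_Ico_consecutive (fun n => eC (g n)) (show 1 ≤ N + 1 by omega)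
    (show N + 1 ≤ N + 1 + a by omega)
  have h4 := Finset.sum_Ico_consecutive (fun n => eC (g n)) (show 1 ≤ 1 + a by omega)
    (show 1 + a ≤ N + 1 + a by omega)
  have h5 : ∑ n ∈ Finset.Icc 1 N, eC (g n) - ∑ n ∈ Finset.Icc 1 N, eC (g (n + a)) =
      ∑ n ∈ Finset.Ico 1 (1 + a), eC (g n) - ∑ n ∈ Finset.Ico (N + 1) (N + 1 + a), eC (g n) := by
    rw [h1, h2]; linear_combination h3 - h4
  rw [h5]
  refine (norm_sub_le _ _).trans ?_
  have h6 := norm_sum_eC_le (Finset.Ico 1 (1 + a)) g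
  have h7 := norm_sum_eC_le (Finset.Ico (N + 1) (N + 1 + a)) g
  simp only [Nat.card_Ico, Nat.add_sub_cancel_left] at h6 h7
  linarith

lemma exists_long_progression {N q L : ℕ} {K : ℝ} {g : ℕ → ℝ} (hN : 1 ≤ N) (hK : 1 ≤ K)
    (hS : (N : ℝ) ≤ K * ‖∑ n ∈ Finset.Icc 1 N, eC (g n)‖) (hL : 4 * (q : ℝ) * K * L ≤ N) :
    ∃ n ∈ Finset.Icc 1 N, (L : ℝ) ≤ 2 * K * ‖∑ m ∈ Finset.range L, eC (g (n + q * m))‖ := by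
  by_contra! hcon
  have hN0 : (0 : ℝ) < N := by exact_mod_cast hN
  have h2 : ‖(L : ℂ) * ∑ n ∈ Finset.Icc 1 N, eC (g n)‖ ≤
      ‖∑ m ∈ Finset.range L, ∑ n ∈ Finset.Icc 1 N, eC (g (n + q * m))‖ + L * (2 * (q * L)) := by
    have e : (L : ℂ) * ∑ n ∈ Finset.Icc 1 N, eC (g n) =
        ∑ m ∈ Finset.range L, ∑ n ∈ Finset.Icc 1 N, eC (g (n + q * m)) +
        ∑ m ∈ Finset.range L, (∑ n ∈ Finset.Icc 1 N, eC (g n) -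
          ∑ n ∈ Finset.Icc 1 N, eC (g (n + q * m))) := by
      rw [Finset.sum_sub_distrib]; simp
    rw [e]
    refine (norm_add_le _ _).trans ?_
    gcongr
    refine (norm_sum_le_of_le _ (fun m hm => ?_)).trans (b := ∑ m ∈ Finset.range L, 2 * ((q : ℝ) * L)) (by simp)
    refine (norm_shift_sum_sub_le N (q * m) g).trans ?_
    push_cast; gcongr; exact (Finset.mem_range.1 hm).le
  rw [Finset.sum_comm, norm_mul, Complex.norm_natCast] at h2
  have h3 : 2 * K * ‖∑ n ∈ Finset.Icc 1 N, ∑ m ∈ Finset.range L, eC (g (n + q * m))‖ <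
      N * L := by
    calc _ ≤ 2 * K * ∑ n ∈ Finset.Icc 1 N, ‖∑ m ∈ Finset.range L, eC (g (n + q * m))‖ := by
          gcongr; exact norm_sum_le _ _
      _ = ∑ n ∈ Finset.Icc 1 N, 2 * K * ‖∑ m ∈ Finset.range L, eC (g (n + q * m))‖ := by
          rw [Finset.mul_sum]
      _ < ∑ n ∈ Finset.Icc 1 N, (L : ℝ) :=
          Finset.sum_lt_sum_of_nonempty ⟨1, by simp [hN]⟩ hcon
      _ = N * L := by simp
  have hL0 : (0 : ℝ) ≤ L := Nat.cast_nonneg L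
  have h4 := mul_le_mul_of_nonneg_left hS hL0
  have h5 := mul_le_mul_of_nonneg_left h2 (by linarith : 0 ≤ 2 * K)
  have h6 := mul_le_mul_of_nonneg_left hL hL0
  nlinarith

lemma pow_add_sub_eq (n d j : ℕ) (hj : 1 ≤ j) :
    ∃ G : ℕ, (n + d) ^ j = n ^ j + d * G ∧ G ≤ j * (n + d) ^ (j - 1) := by
  refine ⟨∑ i ∈ Finset.range j, (n + d) ^ i * n ^ (j - 1 - i), ?_, ?_⟩
  · have := (Commute.all ((n + d : ℕ) : ℤ) (n : ℤ)).geom_sum₂_mul j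
    zify
    push_cast at this
    linear_combination -this
  · calc _ ≤ ∑ i ∈ Finset.range j, (n + d) ^ (j - 1) := by
          refine Finset.sum_le_sum fun i hi => ?_
          have := Finset.mem_range.1 hi
          calc (n + d) ^ i * n ^ (j - 1 - i) ≤ (n + d) ^ i * (n + d) ^ (j - 1 - i) := by
                gcongr; omega
            _ = (n + d) ^ (j - 1) := by rw [← pow_add]; congr 1; omega
      _ = _ := by simp

lemma weyl_linear (D B : ℕ) : ∃ B' : ℕ, B ≤ B' ∧
    ∀ (N : ℕ) (K : ℝ) (α : ℕ → ℝ) (q : ℕ), 1 ≤ N → 2 ≤ K → K ^ B' ≤ N →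
      (N : ℝ) ≤ K * ‖wsum N (D + 1) α‖ → 1 ≤ q → (q : ℝ) ≤ K ^ B →
      (∀ j, 1 < j → j ≤ D + 1 → App N K B q (α j) j) → App N K B' q (α 1) 1 := by
  set B2 := B + 3 * D + 12 with hB2
  refine ⟨B2 + 4, by omega, fun N K α q hN hK hNK hS hq1 hqK hq => ?_⟩
  have hK1 : 1 ≤ K := by linarith
  have hK0 : 0 < K := by linarith
  have hN0 : (0 : ℝ) < N := by exact_mod_cast hN
  obtain ⟨hDK, h2K⟩ := two_le_pow_bounds hK (D + 1)
  set L := ⌊(N : ℝ) / K ^ B2⌋₊ with hL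
  have hLle : (L : ℝ) ≤ N / K ^ B2 := Nat.floor_le (by positivity)
  have hNB : K ^ B2 ≤ N := (pow_le_pow_right₀ hK1 (by omega)).trans hNK
  have hL1 : 1 ≤ L := by
    rw [hL, Nat.one_le_floor_iff, one_le_div (by positivity)]; exact hNB
  have hLge : (N : ℝ) ≤ 2 * K ^ B2 * L := by
    have h1 : (N : ℝ) / K ^ B2 < L + 1 := Nat.lt_floor_add_one _
    have h2 : (1 : ℝ) ≤ L := by exact_mod_cast hL1
    rw [div_lt_iff₀ (by positivity)] at h1
    nlinarith [show (0 : ℝ) < K ^ B2 by positivity]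
  have h4 : (4 : ℝ) ≤ K ^ 2 := by nlinarith
  have h4qKL : 4 * (q : ℝ) * K * L ≤ N := by
    calc 4 * (q : ℝ) * K * L ≤ K ^ 2 * K ^ B * K * (N / K ^ B2) := by gcongr
      _ = K ^ (B + 3) * N / K ^ B2 := by ring
      _ ≤ K ^ B2 * N / K ^ B2 := by
        gcongr
        omega
      _ = N := by field_simp
  obtain ⟨n, hn, hsum⟩ := exists_long_progression (q := q) (L := L) hN hK1 hS h4qKL
  have hnN : (n : ℝ) ≤ N := by exact_mod_cast (Finset.mem_Icc.1 hn).2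
  set g : ℕ → ℝ := fun n => ∑ j ∈ Finset.range (D + 1 + 1), α j * (n : ℝ) ^ j with hg
  have hex : ∀ j, ∃ z : ℤ, 1 < j → j ≤ D + 1 → |q * α j - z| * (N : ℝ) ^ j ≤ K ^ B := by
    intro j
    by_cases hj : 1 < j ∧ j ≤ D + 1
    · obtain ⟨z, hz⟩ := hq j hj.1 hj.2
      exact ⟨z, fun _ _ => hz⟩
    · exact ⟨0, fun h h' => absurd ⟨h, h'⟩ hj⟩
  choose z hz using hex
  have hqL : (q : ℝ) * L ≤ N := by nlinarith [show (0 : ℝ) ≤ q * L by positivity]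
  have hterm : ∀ m ∈ Finset.range L,
      ‖eC (g (n + q * m)) - eC (g n) * eC (m * (q * α 1))‖ ≤ 1 / (4 * K) := by
    intro m hm
    have hmL : (m : ℝ) ≤ L := by exact_mod_cast (Finset.mem_range.1 hm).le
    have hGex : ∀ j, ∃ G : ℕ, 1 ≤ j → (n + q * m) ^ j = n ^ j + q * m * G ∧
        G ≤ j * (n + q * m) ^ (j - 1) := by
      intro j
      by_cases hj : 1 ≤ j
      · obtain ⟨G, hG⟩ := pow_add_sub_eq n (q * m) j hj
        exact ⟨G, fun _ => hG⟩
      · exact ⟨0, fun h => absurd h hj⟩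
    choose G hG using hGex
    have e : g (n + q * m) = (g n + m * (q * α 1)) +
        ∑ j ∈ Finset.Ico 2 (D + 1 + 1), m * G j * (q * α j - z j) +
        ((∑ j ∈ Finset.Ico 2 (D + 1 + 1), m * G j * z j : ℤ) : ℝ) := by
      have hr : ∀ f : ℕ → ℝ, ∑ j ∈ Finset.range (D + 1 + 1), f j =
          f 0 + f 1 + ∑ j ∈ Finset.Ico 2 (D + 1 + 1), f j := by
        intro f
        rw [Finset.range_eq_Ico, Finset.sum_eq_sum_Ico_succ_bot (by omega),
          Finset.sum_eq_sum_Ico_succ_bot (by omega)]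
        simp only [zero_add, one_add_one_eq_two, add_assoc]
      simp only [hg]
      rw [hr, hr]
      have h2 : ∀ j ∈ Finset.Ico 2 (D + 1 + 1), α j * ((n + q * m : ℕ) : ℝ) ^ j =
          α j * (n : ℝ) ^ j + (m * G j * (q * α j - z j) + m * G j * z j) := by
        intro j hj
        have h3 := (hG j (by have := Finset.mem_Ico.1 hj; omega)).1
        have h4 : ((n + q * m : ℕ) : ℝ) ^ j = (n : ℝ) ^ j + q * m * G j := by exact_mod_cast h3
        rw [h4]; ring
      rw [Finset.sum_congr rfl h2, Finset.sum_add_distrib, Finset.sum_add_distrib]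
      push_cast
      ring
    have hb : |∑ j ∈ Finset.Ico 2 (D + 1 + 1), (m : ℝ) * G j * (q * α j - z j)| ≤
        (D + 1 : ℕ) * (L * ((D + 1 : ℕ) * 2 ^ (D + 1)) * K ^ B / N) := by
      refine (Finset.abs_sum_le_sum_abs _ _).trans ?_
      have : ∀ j ∈ Finset.Ico 2 (D + 1 + 1), |(m : ℝ) * G j * (q * α j - z j)| ≤
          L * ((D + 1 : ℕ) * 2 ^ (D + 1)) * K ^ B / N := by
        intro j hj
        have hj' := Finset.mem_Ico.1 hj
        have h3 := (hG j (by omega)).2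
        have h4 : (G j : ℝ) ≤ (D + 1 : ℕ) * (2 ^ (D + 1) * (N : ℝ) ^ (j - 1)) := by
          calc (G j : ℝ) ≤ j * ((n : ℝ) + q * m) ^ (j - 1) := by exact_mod_cast h3
            _ ≤ (D + 1 : ℕ) * (2 * (N : ℝ)) ^ (j - 1) := by
              have : (n : ℝ) + q * m ≤ 2 * N := by
                have : (q : ℝ) * m ≤ q * L := by gcongr
                linarith
              gcongr
              omega
            _ ≤ _ := by
              rw [mul_pow]; gcongr
              · norm_num
              · omega
        rw [abs_mul, abs_of_nonneg (a := (m : ℝ) * G j) (by positivity), le_div_iff₀ hN0]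
        calc (m : ℝ) * G j * |q * α j - z j| * N
            ≤ L * ((D + 1 : ℕ) * (2 ^ (D + 1) * (N : ℝ) ^ (j - 1))) * |q * α j - z j| * N := by gcongr
          _ = L * ((D + 1 : ℕ) * 2 ^ (D + 1)) * (|q * α j - z j| * ((N : ℝ) ^ (j - 1) * N)) := by ring
          _ = L * ((D + 1 : ℕ) * 2 ^ (D + 1)) * (|q * α j - z j| * (N : ℝ) ^ j) := by
              rw [← pow_succ, Nat.sub_add_cancel (by omega)]
          _ ≤ _ := by gcongr; exact hz j (by omega) (by omega)
      refine (Finset.sum_le_card_nsmul _ _ _ this).trans ?_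
      rw [nsmul_eq_mul, Nat.card_Ico]
      gcongr
      omega
    rw [e, eC_add_int, eC_add, eC_add]
    rw [← mul_sub_one, norm_mul, norm_mul, norm_eC, norm_eC, one_mul, one_mul]
    refine (norm_eC_sub_one_le _).trans ?_
    have h8 : (32 : ℝ) ≤ K ^ 5 := by
      calc (32 : ℝ) = 2 ^ 5 := by norm_num
        _ ≤ K ^ 5 := by gcongr
    have hpi := Real.pi_le_four
    calc _ ≤ 2 * Real.pi * ((D + 1 : ℕ) * (L * ((D + 1 : ℕ) * 2 ^ (D + 1)) * K ^ B / N)) := by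
          gcongr
      _ ≤ 2 * 4 * (K ^ (D + 1) * ((N / K ^ B2) * (K ^ (D + 1) * K ^ (D + 1)) * K ^ B / N)) := by
          gcongr
      _ = 32 * K ^ (3 * D + 3 + B) / K ^ B2 / 4 := by field_simp; ring
      _ ≤ K ^ 5 * K ^ (3 * D + 3 + B) / K ^ B2 / 4 := by gcongr
      _ = K ^ (3 * D + 8 + B) * K / K ^ B2 / (4 * K) := by field_simp; ring
      _ ≤ 1 / (4 * K) := by
          gcongr
          rw [div_le_one (by positivity), ← pow_succ]
          exact pow_le_pow_right₀ hK1 (by omega)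
  have hgeo : (L : ℝ) ≤ 4 * K * ‖∑ m ∈ Finset.range L, eC (m * (q * α 1))‖ := by
    have h1 : ‖∑ m ∈ Finset.range L, eC (g (n + q * m)) -
        eC (g n) * ∑ m ∈ Finset.range L, eC (m * (q * α 1))‖ ≤ L * (1 / (4 * K)) := by
      rw [Finset.mul_sum, ← Finset.sum_sub_distrib]
      refine (norm_sum_le_of_le _ hterm).trans ?_
      simp
    have h2 := norm_le_norm_add_norm_sub' (∑ m ∈ Finset.range L, eC (g (n + q * m)))
      (eC (g n) * ∑ m ∈ Finset.range L, eC (m * (q * α 1)))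
    rw [norm_mul, norm_eC, one_mul] at h2
    have h3 : 4 * K * (L * (1 / (4 * K))) = L := by field_simp
    have h4 := mul_le_mul_of_nonneg_left (h2.trans (add_le_add_right h1 _))
      (by positivity : 0 ≤ 4 * K)
    have h5 : (L : ℝ) ≤ 2 * K * ‖∑ m ∈ Finset.range L, eC (g (n + q * m))‖ := hsum
    nlinarith
  set φ : ℝ := q * α 1 - round (q * α 1) with hφ
  have hgeo2 : ∑ m ∈ Finset.range L, eC (m * (q * α 1)) = ∑ m ∈ Finset.range L, eC (m * φ) := by
    refine Finset.sum_congr rfl fun m _ => ?_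
    have : (m : ℝ) * (q * α 1) = m * φ + ((m * round (q * α 1) : ℤ) : ℝ) := by
      rw [hφ]; push_cast; ring
    rw [this, eC_add_int]
  rw [hgeo2] at hgeo
  have h1 := geom_eC_bound (abs_sub_round (q * α 1)) L
  refine ⟨round (q * α 1), ?_⟩
  rw [pow_one]
  have h2 : (L : ℝ) * |φ| ≤ 2 * K := by
    have := mul_le_mul_of_nonneg_right hgeo (abs_nonneg φ)
    nlinarith
  calc |φ| * N ≤ |φ| * (2 * K ^ B2 * L) := by gcongr
    _ = 2 * K ^ B2 * (L * |φ|) := by ring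
    _ ≤ 2 * K ^ B2 * (2 * K) := by gcongr
    _ = 4 * K ^ (B2 + 1) := by ring
    _ ≤ K ^ 2 * K ^ (B2 + 1) := by gcongr
    _ = K ^ (B2 + 3) := by ring
    _ ≤ _ := pow_le_pow_right₀ hK1 (by omega)

lemma van_der_corput (N : ℕ) (g : ℕ → ℝ) :
    ‖∑ n ∈ Finset.Icc 1 N, eC (g n)‖ ^ 2 ≤
      N + 2 * ∑ h ∈ Finset.Icc 1 N, ‖∑ n ∈ Finset.Icc 1 (N - h), eC (g (n + h) - g n)‖ := by
  set S := ∑ n ∈ Finset.Icc 1 N, eC (g n) with hS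
  set T := ∑ h ∈ Finset.Icc 1 N, ∑ n ∈ Finset.Icc 1 (N - h), eC (g (n + h) - g n) with hT
  have hsq : S * (starRingEnd ℂ) S =
      ∑ x ∈ (Finset.Icc 1 N) ×ˢ (Finset.Icc 1 N), eC (g x.1 - g x.2) := by
    rw [Finset.sum_product, hS, map_sum, Finset.sum_mul_sum]
    simp_rw [eC_sub]
  have hlt : ∑ x ∈ ((Finset.Icc 1 N) ×ˢ (Finset.Icc 1 N)).filter (fun x => x.2 < x.1),
      eC (g x.1 - g x.2) = T := by
    rw [hT, Finset.sum_sigma']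
    refine Finset.sum_bij' (fun x _ => ⟨x.1 - x.2, x.2⟩) (fun y _ => (y.2 + y.1, y.2)) ?_ ?_ ?_ ?_ ?_
    · intro x hx
      simp only [Finset.mem_filter, Finset.mem_product, Finset.mem_Icc, Finset.mem_sigma] at hx ⊢
      omega
    · intro y hy
      simp only [Finset.mem_filter, Finset.mem_product, Finset.mem_Icc, Finset.mem_sigma] at hy ⊢
      omega
    · intro x hx
      simp only [Finset.mem_filter] at hx
      ext <;> simp; omega
    · intro y hy
      simp
    · intro x hx
      simp only [Finset.mem_filter] at hx
      simp only
      rw [Nat.add_sub_cancel' hx.2.le]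
  have hgt : ∑ x ∈ ((Finset.Icc 1 N) ×ˢ (Finset.Icc 1 N)).filter (fun x => x.1 < x.2),
      eC (g x.1 - g x.2) = (starRingEnd ℂ) T := by
    rw [← hlt, map_sum]
    refine Finset.sum_bij' (fun x _ => x.swap) (fun x _ => x.swap) ?_ ?_ ?_ ?_ ?_
    · intro x hx
      simp only [Finset.mem_filter, Finset.mem_product, Prod.fst_swap, Prod.snd_swap] at hx ⊢
      tauto
    · intro x hx
      simp only [Finset.mem_filter, Finset.mem_product, Prod.fst_swap, Prod.snd_swap] at hx ⊢
      tauto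
    · simp
    · simp
    · intro x hx
      rw [← eC_neg]; simp
  have heq : ∑ x ∈ ((Finset.Icc 1 N) ×ˢ (Finset.Icc 1 N)).filter (fun x => x.1 = x.2),
      eC (g x.1 - g x.2) = N := by
    rw [Finset.sum_filter, Finset.sum_product]
    have h0 : ∀ x ∈ Finset.Icc 1 N, ∑ y ∈ Finset.Icc 1 N,
        (if x = y then eC (g x - g y) else 0) = 1 := by
      intro x hx
      rw [Finset.sum_ite_eq, if_pos hx, sub_self, eC_zero]
    rw [Finset.sum_congr rfl h0]
    simp
  have htot : S * (starRingEnd ℂ) S = N + T + (starRingEnd ℂ) T := by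
    rw [hsq, ← Finset.sum_filter_add_sum_filter_not _ (fun x : ℕ × ℕ => x.2 < x.1), hlt,
      ← Finset.sum_filter_add_sum_filter_not (Finset.filter _ _) (fun x : ℕ × ℕ => x.1 < x.2),
      Finset.filter_filter, Finset.filter_filter, ← hgt, ← heq]
    have e1 : ((Finset.Icc 1 N) ×ˢ (Finset.Icc 1 N)).filter (fun x => ¬ x.2 < x.1 ∧ x.1 < x.2) =
        ((Finset.Icc 1 N) ×ˢ (Finset.Icc 1 N)).filter (fun x => x.1 < x.2) :=
      Finset.filter_congr fun x _ => by omega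
    have e2 : ((Finset.Icc 1 N) ×ˢ (Finset.Icc 1 N)).filter (fun x => ¬ x.2 < x.1 ∧ ¬ x.1 < x.2) =
        ((Finset.Icc 1 N) ×ˢ (Finset.Icc 1 N)).filter (fun x => x.1 = x.2) :=
      Finset.filter_congr fun x _ => by omega
    rw [e1, e2]; ring
  have h1 : ‖S‖ ^ 2 = ‖S * (starRingEnd ℂ) S‖ := by
    rw [norm_mul, RCLike.norm_conj, sq]
  have hTn : ‖T‖ ≤ ∑ h ∈ Finset.Icc 1 N, ‖∑ n ∈ Finset.Icc 1 (N - h), eC (g (n + h) - g n)‖ :=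
    norm_sum_le _ _
  rw [h1, htot]
  calc ‖(N : ℂ) + T + (starRingEnd ℂ) T‖ ≤ ‖(N : ℂ)‖ + ‖T‖ + ‖(starRingEnd ℂ) T‖ := norm_add₃_le
    _ = N + 2 * ‖T‖ := by rw [RCLike.norm_conj, Complex.norm_natCast]; ring
    _ ≤ _ := by gcongr

lemma many_large_differences {N : ℕ} {K : ℝ} {g : ℕ → ℝ} (hN : 2 * K ^ 2 ≤ N) (hK : 0 < K)
    (hS : (N : ℝ) ≤ K * ‖∑ n ∈ Finset.Icc 1 N, eC (g n)‖) :
    (N : ℝ) ≤ 8 * K ^ 2 * ((Finset.Icc 1 N).filter fun h =>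
      (N : ℝ) ≤ 8 * K ^ 2 * ‖∑ n ∈ Finset.Icc 1 (N - h), eC (g (n + h) - g n)‖).card := by
  have hN0 : (0 : ℝ) < N := lt_of_lt_of_le (by positivity) hN
  set F : ℕ → ℝ := fun h => ‖∑ n ∈ Finset.Icc 1 (N - h), eC (g (n + h) - g n)‖ with hF
  set H := (Finset.Icc 1 N).filter fun h => (N : ℝ) ≤ 8 * K ^ 2 * F h with hH
  have h1 := van_der_corput N g
  have hFN : ∀ h, F h ≤ N := fun h =>
    (norm_sum_eC_le _ _).trans (by rw [Nat.card_Icc]; exact_mod_cast (by omega))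
  have h2 : 8 * K ^ 2 * ∑ h ∈ Finset.Icc 1 N, F h ≤ 8 * K ^ 2 * (H.card * N) + N * N := by
    rw [← Finset.sum_filter_add_sum_filter_not (Finset.Icc 1 N)
      (fun h => (N : ℝ) ≤ 8 * K ^ 2 * F h), mul_add]
    refine add_le_add (mul_le_mul_of_nonneg_left ?_ (by positivity)) ?_
    · refine (Finset.sum_le_card_nsmul _ _ _ fun h _ => hFN h).trans ?_
      rw [nsmul_eq_mul]
    · rw [Finset.mul_sum]
      refine (Finset.sum_le_card_nsmul _ _ (N : ℝ) fun h hh => ?_).trans ?_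
      · exact (not_le.1 (Finset.mem_filter.1 hh).2).le
      · rw [nsmul_eq_mul]
        gcongr
        exact (Finset.card_filter_le _ _).trans (by simp)
  have h3 : (N : ℝ) ^ 2 ≤ K ^ 2 * ‖∑ n ∈ Finset.Icc 1 N, eC (g n)‖ ^ 2 := by
    rw [← mul_pow]; gcongr
  have h4 : (N : ℝ) ^ 2 ≤ K ^ 2 * (N + 2 * ∑ h ∈ Finset.Icc 1 N, F h) :=
    h3.trans (by gcongr)
  have h5 : (N : ℝ) * N ≤ N * (8 * K ^ 2 * H.card) := by nlinarith
  exact le_of_mul_le_mul_left h5 hN0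

theorem weyl (D : ℕ) : ∃ A : ℕ, ∀ (N : ℕ) (K : ℝ) (α : ℕ → ℝ), 1 ≤ N → 2 ≤ K →
    (N : ℝ) ≤ K * ‖wsum N D α‖ →
    ∃ q : ℕ, 1 ≤ q ∧ (q : ℝ) ≤ K ^ A ∧ ∀ j, 1 ≤ j → j ≤ D → App N K A q (α j) j := by
  induction D with
  | zero => exact ⟨0, fun N K α _ _ _ => ⟨1, le_rfl, by simp, fun j h1 h2 => by omega⟩⟩
  | succ D ih =>
    obtain ⟨A, hA⟩ := ih
    set B₁ := 5 * A + 5 * D + 5 with hB₁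
    obtain ⟨B, hB⟩ := weyl_descend (D + 1) B₁ D (by omega)
    obtain ⟨B', hBB', hB'⟩ := weyl_linear D B
    set X := B + B' + 3 with hX
    refine ⟨X * (D + 1), fun N K α hN hK hS => ?_⟩
    have hK1 : 1 ≤ K := by linarith
    have hK0 : 0 < K := by linarith
    have hN0 : (0 : ℝ) < N := by exact_mod_cast hN
    rcases le_total (N : ℝ) (K ^ X) with hNX | hNX
    · refine ⟨1, le_rfl, ?_, fun j h1 h2 => (App.of_small hNX).mono hK1 ?_⟩
      · rw [Nat.cast_one]; exact one_le_pow₀ hK1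
      · gcongr
    have hXX : X ≤ X * (D + 1) := Nat.le_mul_of_pos_right _ (by omega)
    have hP : ∀ n : ℕ, n ≤ X → K ^ n ≤ N := fun n hn => (pow_le_pow_right₀ hK1 hn).trans hNX
    have h8 : (8 : ℝ) ≤ K ^ 3 := by
      calc (8 : ℝ) = 2 ^ 3 := by norm_num
        _ ≤ K ^ 3 := by gcongr
    set g : ℕ → ℝ := fun n => ∑ j ∈ Finset.range (D + 1 + 1), α j * (n : ℝ) ^ j with hg
    have hmany := many_large_differences (g := g) (N := N) (K := K)
      (by
        calc 2 * K ^ 2 ≤ K * K ^ 2 := by gcongr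
          _ = K ^ 3 := by ring
          _ ≤ N := hP 3 (by omega)) hK0 hS
    set H := (Finset.Icc 1 N).filter fun h =>
      (N : ℝ) ≤ 8 * K ^ 2 * ‖∑ n ∈ Finset.Icc 1 (N - h), eC (g (n + h) - g n)‖ with hH
    have h85 : 8 * K ^ 2 ≤ K ^ 5 := by
      calc 8 * K ^ 2 ≤ K ^ 3 * K ^ 2 := by gcongr
        _ = K ^ 5 := by ring
    have hHA : ∀ h, ∃ q : ℕ, h ∈ H → 1 ≤ q ∧ (q : ℝ) ≤ K ^ (5 * A) ∧
        ∀ i, 1 ≤ i → i < D + 1 → App N K B₁ q (dcoef (D + 1) α h i) i := by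
      intro h
      by_cases hh : h ∈ H
      swap
      · exact ⟨0, fun h' => absurd h' hh⟩
      have hh' := (Finset.mem_filter.1 hh).2
      have hw : ∑ n ∈ Finset.Icc 1 (N - h), eC (g (n + h) - g n) =
          wsum (N - h) D (dcoef (D + 1) α h) := by
        rw [wsum]
        refine Finset.sum_congr rfl fun n _ => ?_
        rw [hg]
        simp only
        rw [sum_shift_sub]
      rw [hw] at hh'
      have hle : ‖wsum (N - h) D (dcoef (D + 1) α h)‖ ≤ (N - h : ℕ) := by
        refine (norm_sum_eC_le _ _).trans ?_
        simp
      have hNh : (N : ℝ) ≤ K ^ 5 * (N - h : ℕ) :=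
        hh'.trans (by gcongr)
      have hNh1 : 1 ≤ N - h := by
        by_contra h0
        have : N - h = 0 := by omega
        rw [this] at hNh
        simp at hNh
        omega
      obtain ⟨q, hq1, hqK, hq⟩ := hA (N - h) (K ^ 5) (dcoef (D + 1) α h) hNh1
        (by linarith [pow_le_pow_right₀ hK1 (show 3 ≤ 5 by norm_num)])
        (by
          calc ((N - h : ℕ) : ℝ) ≤ N := by exact_mod_cast Nat.sub_le _ _
            _ ≤ _ := hh'
            _ ≤ _ := by gcongr)
      refine ⟨q, fun _ => ⟨hq1, by rwa [pow_mul], fun i hi1 hi2 => ?_⟩⟩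
      obtain ⟨z, hz⟩ := hq i hi1 (by omega)
      refine ⟨z, ?_⟩
      calc |q * dcoef (D + 1) α h i - z| * (N : ℝ) ^ i
          ≤ |q * dcoef (D + 1) α h i - z| * (K ^ 5 * (N - h : ℕ)) ^ i := by gcongr
        _ = (|q * dcoef (D + 1) α h i - z| * ((N - h : ℕ) : ℝ) ^ i) * (K ^ 5) ^ i := by
            rw [mul_pow]; ring
        _ ≤ (K ^ 5) ^ A * (K ^ 5) ^ i := by gcongr
        _ = K ^ (5 * (A + i)) := by rw [← pow_add, ← pow_mul]
        _ ≤ _ := pow_le_pow_right₀ hK1 (by omega)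
    choose q hq using hHA
    set M := ⌊K ^ (5 * A)⌋₊ with hM
    have hM1 : 1 ≤ M := (Nat.one_le_floor_iff _).2 (one_le_pow₀ hK1)
    have hMK : (M : ℝ) ≤ K ^ (5 * A) := Nat.floor_le (by positivity)
    have hmaps : ∀ h ∈ H, q h ∈ Finset.Icc 1 M := fun h hh =>
      Finset.mem_Icc.2 ⟨(hq h hh).1, Nat.le_floor (hq h hh).2.1⟩
    obtain ⟨q₁, hq₁M, hq₁⟩ := Finset.exists_le_card_fiber_of_nsmul_le_card_of_maps_to
      (M := ℝ) (b := (H.card : ℝ) / M) hmaps ⟨1, by simp [hM1]⟩ (by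
        rw [nsmul_eq_mul, Nat.card_Icc, Nat.add_sub_cancel, mul_div_cancel₀]
        positivity)
    have hM0 : (0 : ℝ) < M := by exact_mod_cast hM1
    have hq₁' := Finset.mem_Icc.1 hq₁M
    have hq₁K : (q₁ : ℝ) ≤ K ^ (5 * A) := le_trans (by exact_mod_cast hq₁'.2) hMK
    rw [div_le_iff₀ hM0] at hq₁
    obtain ⟨q₂, hq₂1, hq₂K, hq₂⟩ := hB N K α q₁ (H.filter fun h => q h = q₁) hN hK (hP B (by omega))
      hq₁'.1 (hq₁K.trans (pow_le_pow_right₀ hK1 (by omega)))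
      ((Finset.filter_subset _ _).trans (Finset.filter_subset _ _))
      (by
        calc (N : ℝ) ≤ 8 * K ^ 2 * H.card := hmany
          _ ≤ K ^ 5 * ((H.filter fun h => q h = q₁).card * K ^ (5 * A)) := by
              gcongr; exact hq₁.trans (by gcongr)
          _ = K ^ (5 + 5 * A) * (H.filter fun h => q h = q₁).card := by rw [pow_add]; ring
          _ ≤ _ := by
              gcongr
              omega)
      (by
        intro h hh i hi1 hi2
        obtain ⟨hh1, rfl⟩ := Finset.mem_filter.1 hh
        exact (hq h hh1).2.2 i hi1 hi2)
    refine ⟨q₂, hq₂1, hq₂K.trans (pow_le_pow_right₀ hK1 (by omega)), fun j hj1 hj2 => ?_⟩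
    rcases Nat.eq_or_lt_of_le hj1 with rfl | hj
    · exact (hB' N K α q₂ hN hK (hP B' (by omega)) hS hq₂1 hq₂K
        (fun j h1 h2 => hq₂ j (by omega) h2)).mono hK1 (by omega)
    · exact (hq₂ j (by omega) hj2).mono hK1 (by omega)

lemma volume_near_le {q : ℕ} (hq : 1 ≤ q) {δ : ℝ} (hδ : 0 ≤ δ) :
    volume {x : ℝ | x ∈ Set.Ico (0 : ℝ) 1 ∧ ∃ z : ℤ, |q * x - z| ≤ δ} ≤ ENNReal.ofReal (4 * δ) := by
  have hq0 : (0 : ℝ) < q := by exact_mod_cast hq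
  rcases lt_or_ge δ 1 with h | h
  · have hsub : {x : ℝ | x ∈ Set.Ico (0 : ℝ) 1 ∧ ∃ z : ℤ, |q * x - z| ≤ δ} ⊆
        ⋃ z ∈ Finset.Icc (0 : ℤ) q, Set.Icc ((z - δ) / q) ((z + δ) / q) := by
      rintro x ⟨⟨hx0, hx1⟩, z, hz⟩
      rw [abs_le] at hz
      have h1 : (-1 : ℝ) < z := by nlinarith
      have h2 : (z : ℝ) < q + 1 := by nlinarith
      have h1' : -1 < z := by exact_mod_cast h1
      have h2' : z < q + 1 := by exact_mod_cast h2
      simp only [Set.mem_iUnion, Finset.mem_Icc]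
      refine ⟨z, ⟨by omega, by omega⟩, ?_, ?_⟩
      · rw [div_le_iff₀ hq0]; linarith
      · rw [le_div_iff₀ hq0]; linarith
    refine (measure_mono hsub).trans ((measure_biUnion_finset_le _ _).trans ?_)
    simp_rw [Real.volume_Icc]
    have e : ∀ z : ℤ, ((z : ℝ) + δ) / q - (z - δ) / q = 2 * δ / q := fun z => by ring
    simp_rw [e]
    rw [Finset.sum_const, Int.card_Icc, nsmul_eq_mul]
    have h3 : (((q : ℤ) + 1 - 0).toNat : ENNReal) = ENNReal.ofReal (q + 1) := by
      have : ((q : ℤ) + 1 - 0).toNat = q + 1 := by omega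
      rw [this, ← ENNReal.ofReal_natCast]; push_cast; rfl
    rw [h3, ← ENNReal.ofReal_mul (by positivity)]
    apply ENNReal.ofReal_le_ofReal
    have : (1 : ℝ) ≤ q := by exact_mod_cast hq
    rw [← mul_div_assoc, div_le_iff₀ hq0]
    nlinarith
  · calc _ ≤ volume (Set.Ico (0 : ℝ) 1) := measure_mono fun x hx => hx.1
      _ = ENNReal.ofReal 1 := by rw [Real.volume_Ico]; simp
      _ ≤ _ := ENNReal.ofReal_le_ofReal (by linarith)

section meanvalue
variable {ι : Type*} [Fintype ι]

lemma measureReal_major_le (N M : ℕ) (d : ι → ℕ) {W : ℝ} (hW : 0 ≤ W) (hN : 1 ≤ N)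
    (E : Set (ι → ℝ)) (hE : ∀ γ ∈ E, γ ∈ ubox ι → ∃ q : ℕ, 1 ≤ q ∧ q ≤ M ∧
      ∀ p, d p ≠ 0 → ∃ z : ℤ, |q * γ p - z| * (N : ℝ) ^ d p ≤ W) (hW1 : 1 ≤ 4 * W) :
    (volume.restrict (ubox ι)).real E ≤
      M * ((4 * W) ^ Fintype.card ι / (N : ℝ) ^ ∑ p, d p) := by
  have hN0 : (0 : ℝ) < N := by exact_mod_cast hN
  set T : ℕ → ι → Set ℝ := fun q p =>
    {x : ℝ | x ∈ Set.Ico (0 : ℝ) 1 ∧ ∃ z : ℤ, |q * x - z| ≤ if d p = 0 then 1 else W / (N : ℝ) ^ d p}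
  have hsub : E ∩ ubox ι ⊆ ⋃ q ∈ Finset.Icc 1 M, Set.univ.pi (T q) := by
    rintro γ ⟨hγ, hγ'⟩
    obtain ⟨q, hq1, hqM, hq⟩ := hE γ hγ hγ'
    simp only [Set.mem_iUnion]
    refine ⟨q, Finset.mem_Icc.2 ⟨hq1, hqM⟩, fun p _ => ⟨hγ' p trivial, ?_⟩⟩
    split_ifs with hd
    · exact ⟨round (q * γ p), (abs_sub_round _).trans (by norm_num)⟩
    · obtain ⟨z, hz⟩ := hq p hd
      exact ⟨z, by rwa [le_div_iff₀ (by positivity)]⟩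
  have hTle : ∀ q ∈ Finset.Icc 1 M, volume (Set.univ.pi (T q)) ≤
      ENNReal.ofReal ((4 * W) ^ Fintype.card ι / (N : ℝ) ^ ∑ p, d p) := by
    intro q hq
    have hq1 := (Finset.mem_Icc.1 hq).1
    rw [volume_pi_pi]
    have h1 : ∀ p, volume (T q p) ≤ ENNReal.ofReal (4 * W / (N : ℝ) ^ d p) := by
      intro p
      by_cases hd : d p = 0
      · refine (measure_mono (fun x hx => hx.1) : _ ≤ volume (Set.Ico (0 : ℝ) 1)).trans ?_
        rw [Real.volume_Ico, hd]
        exact ENNReal.ofReal_le_ofReal (by simpa using hW1)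
      · have := volume_near_le hq1 (δ := W / (N : ℝ) ^ d p) (by positivity)
        simp only [T, if_neg hd]
        rwa [mul_div_assoc]
    refine (Finset.prod_le_prod' fun p _ => h1 p).trans ?_
    rw [← ENNReal.ofReal_prod_of_nonneg (fun p _ => by positivity), Finset.prod_div_distrib,
      Finset.prod_const, Finset.prod_pow_eq_pow_sum, Finset.card_univ]
  have h2 : volume (E ∩ ubox ι) ≤
      ENNReal.ofReal (M * ((4 * W) ^ Fintype.card ι / (N : ℝ) ^ ∑ p, d p)) := by
    refine (measure_mono hsub).trans ((measure_biUnion_finset_le _ _).trans ?_)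
    refine (Finset.sum_le_card_nsmul _ _ _ hTle).trans ?_
    rw [nsmul_eq_mul, Nat.card_Icc, Nat.add_sub_cancel, ENNReal.ofReal_mul (by positivity),
      ENNReal.ofReal_natCast]
  rw [measureReal_def, Measure.restrict_apply' measurableSet_ubox]
  exact ENNReal.toReal_le_of_le_ofReal (by positivity) h2

lemma integral_pow_le_of_levels {f : (ι → ℝ) → ℂ} (hf : Continuous f) {N X : ℝ} {B v : ℕ}
    (hN : 0 < N) (hX : 0 < X) (hfN : ∀ γ, ‖f γ‖ ≤ N) (hv : B + 1 ≤ v)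
    (hlev : ∀ i : ℕ, 1 ≤ i →
      (volume.restrict (ubox ι)).real {γ | N ≤ 2 ^ i * ‖f γ‖} ≤ (2 ^ i) ^ B / X) :
    ∫ γ in ubox ι, ‖f γ‖ ^ v ≤ (2 ^ v + 1) * N ^ v / X := by
  obtain ⟨I, hI⟩ : ∃ I : ℕ, X ≤ 2 ^ I := by
    obtain ⟨I, hI⟩ := pow_unbounded_of_one_lt X (by norm_num : (1 : ℝ) < 2)
    exact ⟨I, hI.le⟩
  set E : ℕ → Set (ι → ℝ) := fun i => {γ | N ≤ 2 ^ i * ‖f γ‖} with hE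
  have hEm : ∀ i, MeasurableSet (E i) := fun i =>
    (isClosed_le continuous_const (by fun_prop)).measurableSet
  have hpt : ∀ γ, ‖f γ‖ ^ v ≤
      ∑ i ∈ Finset.Icc 1 (I + 1), (E i).indicator (fun _ => (N * 2 / 2 ^ i) ^ v) γ + N ^ v / X := by
    intro γ
    have hnn : ∀ i ∈ Finset.Icc 1 (I + 1),
        0 ≤ (E i).indicator (fun _ => (N * 2 / 2 ^ i) ^ v) γ := fun i _ =>
      Set.indicator_nonneg (fun _ _ => by positivity) _
    by_cases hγ : ∃ i, γ ∈ E (i + 1)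
    · set i := Nat.find hγ with hi
      have hiE : γ ∈ E (i + 1) := Nat.find_spec hγ
      have hfi : ‖f γ‖ ≤ N / 2 ^ i := by
        rcases Nat.eq_zero_or_pos i with h0 | h0
        · rw [h0]; simpa using hfN γ
        · have h1 := Nat.find_min hγ (m := i - 1) (by omega)
          have h2 : i - 1 + 1 = i := by omega
          rw [h2] at h1
          have h3 : 2 ^ i * ‖f γ‖ < N := not_le.1 h1
          rw [le_div_iff₀ (by positivity)]; linarith
      by_cases hiI : i ≤ I
      · have h1 := Finset.single_le_sum hnn (Finset.mem_Icc.2 ⟨by omega, by omega⟩ : i + 1 ∈ _)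
        rw [Set.indicator_of_mem hiE] at h1
        have h2 : ‖f γ‖ ^ v ≤ (N * 2 / 2 ^ (i + 1)) ^ v := by
          gcongr
          rw [pow_succ]
          calc _ ≤ _ := hfi
            _ = _ := by field_simp
        have : 0 ≤ N ^ v / X := by positivity
        linarith
      · have h1 : ‖f γ‖ ^ v ≤ N ^ v / X := by
          calc ‖f γ‖ ^ v ≤ (N / 2 ^ i) ^ v := by gcongr
            _ = N ^ v / (2 ^ i) ^ v := by rw [div_pow]
            _ ≤ N ^ v / X := by
              gcongr
              calc X ≤ 2 ^ I := hI
                _ ≤ 2 ^ i := pow_le_pow_right₀ (by norm_num) (by omega)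
                _ = (2 ^ i) ^ 1 := by ring
                _ ≤ (2 ^ i) ^ v := pow_le_pow_right₀ (one_le_pow₀ (by norm_num)) (by omega)
        linarith [Finset.sum_nonneg hnn]
    · push Not at hγ
      have h0 : ‖f γ‖ ≤ N / 2 ^ I := by
        have h3 : 2 ^ (I + 1) * ‖f γ‖ < N := not_le.1 (hγ I)
        rw [le_div_iff₀ (by positivity)]
        have : 0 ≤ ‖f γ‖ * 2 ^ I := by positivity
        rw [pow_succ] at h3
        linarith
      have h1 : ‖f γ‖ ^ v ≤ N ^ v / X := by
        calc ‖f γ‖ ^ v ≤ (N / 2 ^ I) ^ v := by gcongr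
          _ = N ^ v / (2 ^ I) ^ v := by rw [div_pow]
          _ ≤ N ^ v / X := by
            gcongr
            calc X ≤ 2 ^ I := hI
              _ = (2 ^ I) ^ 1 := by ring
              _ ≤ (2 ^ I) ^ v := pow_le_pow_right₀ (one_le_pow₀ (by norm_num)) (by omega)
      linarith [Finset.sum_nonneg hnn]
  have hInt : ∀ i, Integrable ((E i).indicator (fun _ => (N * 2 / 2 ^ i) ^ v))
      (volume.restrict (ubox ι)) := fun i => (integrable_const _).indicator (hEm i)
  have h1 := integral_mono (μ := volume.restrict (ubox ι)) (integrableOn_ubox (by fun_prop))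
    ((integrable_finsetSum _ fun i _ => hInt i).add (integrable_const _)) hpt
  refine h1.trans ?_
  simp only [Pi.add_apply]
  rw [integral_add (integrable_finsetSum _ fun i _ => hInt i) (integrable_const _),
    integral_finsetSum _ fun i _ => hInt i, integral_const]
  simp_rw [integral_indicator_const _ (hEm _)]
  simp only [probReal_univ, smul_eq_mul, one_mul]
  have h2 : ∀ i ∈ Finset.Icc 1 (I + 1), (volume.restrict (ubox ι)).real (E i) * (N * 2 / 2 ^ i) ^ v ≤
      2 ^ v * N ^ v / X * (1 / 2) ^ i := by
    intro i hi
    calc _ ≤ (2 ^ i) ^ B / X * (N * 2 / 2 ^ i) ^ v := by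
          gcongr; exact hlev i (Finset.mem_Icc.1 hi).1
      _ = 2 ^ v * N ^ v / X * ((2 ^ i) ^ B / (2 ^ i) ^ v) := by
          rw [div_pow, mul_pow]; ring
      _ ≤ 2 ^ v * N ^ v / X * ((2 ^ i) ^ B / (2 ^ i) ^ (B + 1)) := by
          gcongr; exact one_le_pow₀ (by norm_num)
      _ = _ := by
          congr 1
          rw [pow_succ, one_div, inv_pow]
          field_simp
  calc _ ≤ ∑ i ∈ Finset.Icc 1 (I + 1), 2 ^ v * N ^ v / X * (1 / 2) ^ i + N ^ v / X := by
        exact add_le_add (Finset.sum_le_sum h2) le_rfl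
    _ ≤ 2 ^ v * N ^ v / X * 1 + N ^ v / X := by
        rw [← Finset.mul_sum]
        gcongr
        have : ∀ I : ℕ, ∑ i ∈ Finset.Icc 1 I, (1 / 2 : ℝ) ^ i = 1 - (1 / 2) ^ I := by
          intro I
          induction I with
          | zero => simp
          | succ n ih => rw [Finset.sum_Icc_succ_top (by omega), ih]; ring
        rw [this]
        have : (0 : ℝ) ≤ (1 / 2) ^ (I + 1) := by positivity
        linarith
    _ = _ := by ring

end meanvalue

section u0
variable {t : ℕ} {ν : Fin t → ℕ} {k : (l : Fin t) → Fin (ν l) → ℕ}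

/-- The vector of the powers of `x` whose group index is below `h`. -/
def pvec (k : (l : Fin t) → Fin (ν l) → ℕ) (h x : ℕ) (p : KIdx t ν) : ℤ :=
  if (p.1 : ℕ) < h then (x : ℤ) ^ k p.1 p.2 else 0

lemma fA_eq (A : Finset ℕ) (h : ℕ) (γ : KIdx t ν → ℝ) :
    fA t ν k A h γ = ∑ x ∈ A, eC (∑ p, (pvec k h x p : ℝ) * γ p) := by
  unfold fA
  refine Finset.sum_congr rfl fun x _ => ?_
  congr 1
  refine Finset.sum_congr rfl fun p _ => ?_
  rw [pvec]; split_ifs <;> push_cast <;> ring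

lemma JA_eq (A : Finset ℕ) (u h : ℕ) :
    JA t ν k A u h = (((tuples A u).filter fun z => tdiff (pvec k h) z = 0).card : ℝ) := by
  rw [← integral_normpow]
  simp_rw [← fA_eq]
  rfl

lemma JA_nonneg (A : Finset ℕ) (u h : ℕ) : 0 ≤ JA t ν k A u h := by
  rw [JA_eq]; positivity

lemma tuples_mono {A A' : Finset ℕ} (h : A ⊆ A') (u : ℕ) : tuples A u ⊆ tuples A' u :=
  Finset.product_subset_product (Fintype.piFinset_subset _ _ fun _ => h)
    (Fintype.piFinset_subset _ _ fun _ => h)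

lemma JA_mono {A A' : Finset ℕ} (hA : A ⊆ A') (u h : ℕ) : JA t ν k A u h ≤ JA t ν k A' u h := by
  rw [JA_eq, JA_eq]
  exact_mod_cast Finset.card_le_card (Finset.filter_subset_filter _ (tuples_mono hA u))

lemma JA_succ_le (A : Finset ℕ) (u h : ℕ) :
    JA t ν k A (u + 1) h ≤ (A.card : ℝ) ^ 2 * JA t ν k A u h := by
  unfold JA
  rw [← integral_const_mul]
  simp_rw [fA_eq]
  refine integral_mono (μ := volume.restrict (ubox (KIdx t ν))) (integrableOn_ubox (by fun_prop))
    (integrableOn_ubox (by fun_prop)) fun γ => ?_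
  have h1 : 2 * (u + 1) = 2 + 2 * u := by ring
  simp only
  rw [h1, pow_add]
  gcongr
  exact norm_sum_eC_le _ _

lemma fA_Icc_eq_wsum (hinj : Function.Injective fun p : KIdx t ν => k p.1 p.2)
    (N h : ℕ) (γ : KIdx t ν → ℝ) :
    ∃ α : ℕ → ℝ, (∀ p : KIdx t ν, (p.1 : ℕ) < h → α (k p.1 p.2) = γ p) ∧
      fA t ν k (Finset.Icc 1 N) h γ = wsum N (kmax t ν k) α := by
  set α : ℕ → ℝ := fun j => ∑ p : KIdx t ν, if k p.1 p.2 = j ∧ (p.1 : ℕ) < h then γ p else 0 with hα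
  refine ⟨α, fun p hp => ?_, ?_⟩
  · rw [hα]
    simp only
    rw [Finset.sum_eq_single p]
    · simp [hp]
    · intro p' _ hne
      rw [if_neg]
      rintro ⟨h1, -⟩
      exact hne (hinj h1)
    · simp
  · rw [fA, wsum]
    refine Finset.sum_congr rfl fun x _ => ?_
    congr 1
    simp_rw [hα, Finset.sum_mul]
    rw [Finset.sum_comm]
    refine Finset.sum_congr rfl fun p _ => ?_
    have hle : k p.1 p.2 ≤ kmax t ν k :=
      Finset.le_sup (f := fun p : KIdx t ν => k p.1 p.2) (Finset.mem_univ p)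
    rw [Finset.sum_eq_single (k p.1 p.2)]
    · split_ifs with h1 h2 h2 <;> simp_all
    · intro j _ hj
      rw [if_neg (fun h1 => hj h1.1.symm), zero_mul]
    · intro h1
      exact absurd (Finset.mem_range.2 (by omega)) h1

lemma JA_Icc_bound (hk : ∀ l n, 0 < k l n)
    (hinj : Function.Injective fun p : KIdx t ν => k p.1 p.2) (h : ℕ) :
    ∃ u : ℕ, ∃ C : ℝ, 0 ≤ C ∧ ∀ N : ℕ, 1 ≤ N →
      JA t ν k (Finset.Icc 1 N) u h ≤ C * N ^ (2 * u) / (N : ℝ) ^ Ksum t ν k h := by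
  obtain ⟨A, hA⟩ := weyl (kmax t ν k)
  set c := Fintype.card (KIdx t ν) with hc
  set B := A + (A + 2) * c with hB
  refine ⟨B + 1, 2 ^ (2 * (B + 1)) + 1, by positivity, fun N hN => ?_⟩
  have hN0 : (0 : ℝ) < N := by exact_mod_cast hN
  set d : KIdx t ν → ℕ := fun p => if (p.1 : ℕ) < h then k p.1 p.2 else 0 with hd
  have hK : Ksum t ν k h = ∑ p, d p := rfl
  refine integral_pow_le_of_levels (f := fA t ν k (Finset.Icc 1 N) h) (B := B) ?_ hN0
    (by positivity) ?_ (by omega) ?_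
  · simp_rw [funext (fA_eq (k := k) (Finset.Icc 1 N) h)]
    fun_prop
  · intro γ
    exact (norm_sum_eC_le _ _).trans (by simp)
  · intro i hi
    have h2i : (2 : ℝ) ≤ 2 ^ i := by
      calc (2 : ℝ) = 2 ^ 1 := by norm_num
        _ ≤ 2 ^ i := pow_le_pow_right₀ (by norm_num) hi
    have h1i : (1 : ℝ) ≤ 2 ^ i := by linarith
    have hE := measureReal_major_le N ⌊((2 : ℝ) ^ i) ^ A⌋₊ d (W := (2 ^ i) ^ A) (by positivity) hN
      {γ | (N : ℝ) ≤ 2 ^ i * ‖fA t ν k (Finset.Icc 1 N) h γ‖} (by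
        intro γ hγ _
        obtain ⟨α, hα1, hα2⟩ := fA_Icc_eq_wsum hinj N h γ
        simp only [Set.mem_ofPred_eq] at hγ
        rw [hα2] at hγ
        obtain ⟨q, hq1, hqK, hq⟩ := hA N (2 ^ i) α hN h2i hγ
        refine ⟨q, hq1, Nat.le_floor hqK, fun p hp => ?_⟩
        have hp' : (p.1 : ℕ) < h := by
          by_contra hcon
          exact hp (by rw [hd]; simp [hcon])
        have hdp : d p = k p.1 p.2 := by rw [hd]; simp [hp']
        rw [hdp, ← hα1 p hp']
        exact hq _ (hk _ _) (Finset.le_sup (f := fun p : KIdx t ν => k p.1 p.2) (Finset.mem_univ p)))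
      (by linarith [one_le_pow₀ h1i (n := A)])
    refine hE.trans ?_
    rw [← hK, ← mul_div_assoc]
    gcongr
    calc (⌊((2 : ℝ) ^ i) ^ A⌋₊ : ℝ) * (4 * (2 ^ i) ^ A) ^ c
        ≤ (2 ^ i) ^ A * ((2 ^ i) ^ 2 * (2 ^ i) ^ A) ^ c := by
          gcongr
          · exact Nat.floor_le (by positivity)
          · nlinarith
      _ = _ := by rw [hB]; ring

/-- The property defining `u0`. -/
def AdmU (k : (l : Fin t) → Fin (ν l) → ℕ) (h u : ℕ) : Prop :=
  ∃ η₀ : ℝ, 0 < η₀ ∧ ∀ η ∈ Set.Ioc (0 : ℝ) η₀, ∃ C : ℝ, ∃ P₀ : ℝ, ∀ P : ℝ, P₀ ≤ P →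
    JA t ν k (smoothFS P (P ^ η)) u h ≤ C * P ^ ((2 * u : ℝ) - (Ksum t ν k h : ℝ))

lemma smoothFS_subset (P R : ℝ) : smoothFS P R ⊆ Finset.Icc 1 ⌊P⌋₊ := Finset.filter_subset _ _

lemma AdmU.succ {h u : ℕ} (hu : AdmU k h u) : AdmU k h (u + 1) := by
  obtain ⟨η₀, h0, H⟩ := hu
  refine ⟨η₀, h0, fun η hη => ?_⟩
  obtain ⟨C, P₀, hC⟩ := H η hη
  refine ⟨C, max P₀ 1, fun P hP => ?_⟩
  have hP0 : 0 < P := lt_of_lt_of_le one_pos ((le_max_right _ _).trans hP)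
  refine (JA_succ_le _ _ _).trans ?_
  have hcard : ((smoothFS P (P ^ η)).card : ℝ) ≤ P := by
    have h1 := Finset.card_le_card (smoothFS_subset P (P ^ η))
    rw [Nat.card_Icc, Nat.add_sub_cancel] at h1
    exact le_trans (by exact_mod_cast h1) (Nat.floor_le hP0.le)
  have h2 := hC P ((le_max_left _ _).trans hP)
  calc _ ≤ P ^ 2 * (C * P ^ ((2 * u : ℝ) - (Ksum t ν k h : ℝ))) := by
        have := JA_nonneg (k := k) (smoothFS P (P ^ η)) u h
        gcongr
    _ = _ := by
        rw [← Real.rpow_natCast P 2, mul_left_comm, ← Real.rpow_add hP0]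
        congr 2; push_cast; ring

lemma exists_AdmU (hk : ∀ l n, 0 < k l n)
    (hinj : Function.Injective fun p : KIdx t ν => k p.1 p.2) (h : ℕ) : ∃ u, AdmU k h u := by
  obtain ⟨u, C, hC0, hC⟩ := JA_Icc_bound hk hinj h
  refine ⟨u, 1, one_pos, fun η _ => ⟨C * 2 ^ Ksum t ν k h, 2, fun P hP => ?_⟩⟩
  have hP0 : 0 < P := by linarith
  have hN : 1 ≤ ⌊P⌋₊ := (Nat.one_le_floor_iff _).2 (by linarith)
  refine (JA_mono (smoothFS_subset P (P ^ η)) u h).trans ((hC _ hN).trans ?_)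
  have h1 : (⌊P⌋₊ : ℝ) ≤ P := Nat.floor_le hP0.le
  have h2 : P / 2 ≤ ⌊P⌋₊ := by
    have := Nat.lt_floor_add_one P
    linarith
  rw [Real.rpow_sub hP0]
  have e1 : P ^ (2 * u : ℝ) = P ^ (2 * u) := by
    rw [← Real.rpow_natCast]; push_cast; rfl
  rw [e1, Real.rpow_natCast]
  calc _ ≤ C * P ^ (2 * u) / (P / 2) ^ Ksum t ν k h := by gcongr
    _ = _ := by rw [div_pow]; field_simp

lemma AdmU_max_u0 (hk : ∀ l n, 0 < k l n)
    (hinj : Function.Injective fun p : KIdx t ν => k p.1 p.2) (h : ℕ) :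
    AdmU k h (max (u0 t ν k h) 1) := by
  have h1 : AdmU k h (u0 t ν k h) := Nat.sInf_mem (s := {u | AdmU k h u}) (exists_AdmU hk hinj h)
  have h2 : ∀ m, AdmU k h (u0 t ν k h + m) := by
    intro m
    induction m with
    | zero => exact h1
    | succ m ih => exact ih.succ
  obtain ⟨m, hm⟩ := Nat.exists_eq_add_of_le (le_max_left (u0 t ν k h) 1)
  rw [hm]; exact h2 m

end u0

lemma card_le_prod_of_triangular (M : ℕ) : ∀ (Z V : Fin M → Type) (T : ∀ g, Finset (Z g))
    (φ : ∀ g, Z g → V g) (J : Fin M → ℕ) (S : Finset (∀ g, Z g)),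
    (∀ z ∈ S, ∀ g, z g ∈ T g) → (∀ g v, ((T g).filter fun z => φ g z = v).card ≤ J g) →
    (∀ z ∈ S, ∀ z' ∈ S, ∀ g, (∀ g', g < g' → z g' = z' g') → φ g (z g) = φ g (z' g)) →
    S.card ≤ ∏ g, J g := by
  induction M with
  | zero =>
    intro Z V T φ J S _ _ _
    simpa using Finset.card_le_one_of_subsingleton S
  | succ M ih =>
    intro Z V T φ J S hT hJ hφ
    rw [Fin.prod_univ_succ]
    have h1 := ih (fun g => Z g.succ) (fun g => V g.succ) (fun g => T g.succ) (fun g => φ g.succ)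
      (fun g => J g.succ) (S.image fun z g => z g.succ) (by
        intro z hz g
        obtain ⟨w, hw, rfl⟩ := Finset.mem_image.1 hz
        exact hT w hw _) (fun g v => hJ _ v) (by
        intro z hz z' hz' g hg
        obtain ⟨w, hw, rfl⟩ := Finset.mem_image.1 hz
        obtain ⟨w', hw', rfl⟩ := Finset.mem_image.1 hz'
        refine hφ w hw w' hw' _ fun g' hg' => ?_
        obtain ⟨g'', rfl⟩ := Fin.exists_succ_eq.2 (ne_of_gt (lt_of_le_of_lt (Fin.zero_le _) hg'))
        exact hg g'' (Fin.succ_lt_succ_iff.1 hg'))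
    refine (Finset.card_le_mul_card_image (f := fun (z : ∀ g, Z g) (g : Fin M) => z g.succ) S (J 0)
      ?_).trans (Nat.mul_le_mul_left _ h1)
    intro b hb
    obtain ⟨w, hw, rfl⟩ := Finset.mem_image.1 hb
    refine le_trans (Finset.card_le_card_of_injOn (fun z => z 0) ?_ ?_) (hJ 0 (φ 0 (w 0)))
    · intro z hz
      obtain ⟨hzS, hz2⟩ := Finset.mem_filter.1 hz
      refine Finset.mem_coe.2 (Finset.mem_filter.2 ⟨hT z hzS 0, hφ z hzS w hw 0 fun g' hg' => ?_⟩)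
      obtain ⟨g'', rfl⟩ := Fin.exists_succ_eq.2 (ne_of_gt hg')
      exact congr_fun hz2 g''
    · intro z hz z' hz' h0
      obtain ⟨-, hz2⟩ := Finset.mem_filter.1 hz
      obtain ⟨-, hz2'⟩ := Finset.mem_filter.1 hz'
      funext g
      refine Fin.cases h0 (fun i => ?_) g
      rw [congr_fun hz2 i, congr_fun hz2' i]

section system
variable {t : ℕ} {ν μ : Fin t → ℕ} {k : (l : Fin t) → Fin (ν l) → ℕ} {s : ℕ}
  {c : EqIdx t ν μ → Fin s → ℤ}

/-- The vector of values `c_{ij} x ^ d_i`. -/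
def cvec (k : (l : Fin t) → Fin (ν l) → ℕ) (c : EqIdx t ν μ → Fin s → ℤ) (j : Fin s) (x : ℕ)
    (i : EqIdx t ν μ) : ℤ := c i j * (x : ℤ) ^ deg t ν μ k i

lemma fj_eq (A : Finset ℕ) (α : EqIdx t ν μ → ℝ) (j : Fin s) :
    fj t ν μ k s c A α j = ∑ x ∈ A, eC (∑ i, (cvec k c j x i : ℝ) * α i) := by
  unfold fj
  refine Finset.sum_congr rfl fun x _ => ?_
  congr 1
  refine Finset.sum_congr rfl fun i _ => ?_
  rw [cvec]; push_cast; ring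

lemma continuous_fj (A : Finset ℕ) (j : Fin s) : Continuous fun α => fj t ν μ k s c A α j := by
  simp_rw [fj_eq]; fun_prop

lemma norm_fj_le (A : Finset ℕ) (α : EqIdx t ν μ → ℝ) (j : Fin s) :
    ‖fj t ν μ k s c A α j‖ ≤ A.card := by
  rw [fj_eq]; exact norm_sum_eC_le _ _

lemma integral_prod_normpow (A : Finset ℕ) {M : ℕ} (u : Fin M → ℕ) (j : Fin M → Fin s) :
    ∫ α in ubox (EqIdx t ν μ), ∏ g, ‖fj t ν μ k s c A α (j g)‖ ^ (2 * u g) =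
      (((Fintype.piFinset fun g => tuples A (u g)).filter fun z =>
        ∑ g, tdiff (cvec k c (j g)) (z g) = 0).card : ℝ) := by
  have h := integral_sum_eC (Fintype.piFinset fun g => tuples A (u g))
    (fun z => ∑ g, tdiff (cvec k c (j g)) (z g))
  have h2 : ∀ α : EqIdx t ν μ → ℝ, ∑ z ∈ Fintype.piFinset fun g => tuples A (u g),
      eC (∑ i, (((∑ g, tdiff (cvec k c (j g)) (z g)) i : ℤ) : ℝ) * α i) =
      ((∏ g, ‖fj t ν μ k s c A α (j g)‖ ^ (2 * u g) : ℝ) : ℂ) := by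
    intro α
    rw [Complex.ofReal_prod]
    simp_rw [fj_eq, normpow_expand]
    rw [Finset.prod_univ_sum]
    refine Finset.sum_congr rfl fun z _ => ?_
    rw [← eC_sum]
    congr 1
    simp_rw [tdiff_lin, Finset.sum_apply]
    push_cast
    simp_rw [Finset.sum_mul]
    rw [Finset.sum_comm]
  simp_rw [h2] at h
  rw [integral_complex_ofReal] at h
  exact_mod_cast h

lemma integral_prod_normpow_le (hns : HighlyNonSingular t ν μ s c) (A : Finset ℕ) {M : ℕ}
    (hM : ∀ l, μ l ≤ M) (u h : Fin M → ℕ) (hh : ∀ g (l : Fin t), (l : ℕ) < h g ↔ (g : ℕ) < μ l)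
    (j : Fin M → Fin s) (hj : Function.Injective j) :
    ∫ α in ubox (EqIdx t ν μ), ∏ g, ‖fj t ν μ k s c A α (j g)‖ ^ (2 * u g) ≤
      ∏ g, JA t ν k A (u g) (h g) := by
  rw [integral_prod_normpow]
  simp_rw [JA_eq]
  rw [← Nat.cast_prod, Nat.cast_le]
  refine card_le_prod_of_triangular M (fun g => (Fin (u g) → ℕ) × (Fin (u g) → ℕ)) (fun g => KIdx t ν → ℤ) (fun g => tuples A (u g))
    (fun g => tdiff (pvec k (h g))) _ _ ?_ (fun g v => ?_) ?_
  · intro z hz g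
    exact Fintype.mem_piFinset.1 (Finset.mem_filter.1 hz).1 g
  · convert card_tdiff_eq_le A (u g) (pvec k (h g)) v
  · intro z hz z' hz' g hg
    have e1 := (Finset.mem_filter.1 hz).2
    have e2 := (Finset.mem_filter.1 hz').2
    funext p
    rw [tdiff_apply, tdiff_apply]
    by_cases hp : (p.1 : ℕ) < h g
    swap
    · simp [tdiff, pvec, hp]
    have hgl := (hh g p.1).1 hp
    set X : ((g : Fin M) → (Fin (u g) → ℕ) × (Fin (u g) → ℕ)) → Fin M → ℤ := fun z g =>
      tdiff (fun x : ℕ => (x : ℤ) ^ k p.1 p.2) (z g) with hX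
    have hsys : ∀ z : (g : Fin M) → (Fin (u g) → ℕ) × (Fin (u g) → ℕ),
        ∑ g, tdiff (cvec k c (j g)) (z g) = 0 → ∀ m : Fin (μ p.1),
        ∑ g, c ⟨p.1, (p.2, m)⟩ (j g) * X z g = 0 := by
      intro z hz m
      have := congr_fun hz ⟨p.1, (p.2, m)⟩
      rw [Finset.sum_apply] at this
      simp_rw [tdiff_apply] at this
      rw [Pi.zero_apply] at this
      rw [← this]
      refine Finset.sum_congr rfl fun g _ => ?_
      simp only [hX, tdiff, cvec, deg]
      rw [mul_sub, Finset.mul_sum, Finset.mul_sum]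
    have hlow : ∀ m : Fin (μ p.1), ∑ m' : Fin (μ p.1),
        c ⟨p.1, (p.2, m)⟩ (j (Fin.castLE (hM p.1) m')) *
          (X z (Fin.castLE (hM p.1) m') - X z' (Fin.castLE (hM p.1) m')) = 0 := by
      intro m
      have h1 := hsys z e1 m
      have h2 := hsys z' e2 m
      have h3 : ∑ g, c ⟨p.1, (p.2, m)⟩ (j g) * (X z g - X z' g) = 0 := by
        simp_rw [mul_sub]; rw [Finset.sum_sub_distrib, h1, h2, sub_zero]
      rw [← h3]
      refine Finset.sum_of_injOn (Fin.castLE (hM p.1)) (Fin.castLE_injective _).injOn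
        (fun _ _ => Finset.mem_coe.2 (Finset.mem_univ _)) ?_ (fun _ _ => rfl)
      intro g' _ hg'
      have hlt : g < g' := by
        by_contra hcon
        refine hg' ⟨⟨g', ?_⟩, by simp, by ext; simp⟩
        have : (g' : ℕ) ≤ g := not_lt.1 hcon
        omega
      have : X z g' = X z' g' := by simp only [hX]; rw [hg g' hlt]
      rw [this, sub_self, mul_zero]
    have hdet := hns.2 p.1 p.2 (fun m' => j (Fin.castLE (hM p.1) m'))
      (hj.comp (Fin.castLE_injective _))
    have hzero := Matrix.eq_zero_of_mulVec_eq_zero hdet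
      (v := fun m' => X z (Fin.castLE (hM p.1) m') - X z' (Fin.castLE (hM p.1) m')) (by
        funext m
        simpa [Matrix.mulVec, dotProduct] using hlow m)
    have h4 := congr_fun hzero ⟨g, hgl⟩
    have h5 : Fin.castLE (hM p.1) ⟨g, hgl⟩ = g := by ext; simp
    simp only [h5, Pi.zero_apply] at h4
    have h6 : X z g = X z' g := sub_eq_zero.1 h4
    simpa [hX, tdiff, pvec, hp] using h6

lemma prod_le_sum_pow {n : ℕ} (hn : 0 < n) (x : Fin n → ℝ) (hx : ∀ a, 0 ≤ x a) :
    ∏ a, x a ≤ ∑ a, x a ^ n := by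
  obtain ⟨b, -, hb⟩ := Finset.exists_max_image Finset.univ x ⟨⟨0, hn⟩, Finset.mem_univ _⟩
  calc ∏ a, x a ≤ ∏ a : Fin n, x b :=
        Finset.prod_le_prod (fun a _ => hx a) fun a ha => hb a ha
    _ = x b ^ n := by simp
    _ ≤ _ := Finset.single_le_sum (f := fun a => x a ^ n) (fun a _ => pow_nonneg (hx a) n)
        (Finset.mem_univ b)

lemma integral_prod_le (hns : HighlyNonSingular t ν μ s c) (A : Finset ℕ) {M : ℕ}
    (hM : ∀ l, μ l ≤ M) (u h : Fin M → ℕ) (hu : ∀ g, 1 ≤ u g)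
    (hh : ∀ g (l : Fin t), (l : ℕ) < h g ↔ (g : ℕ) < μ l)
    (σ : (Σ g : Fin M, Fin (2 * u g)) → Fin s) (hσ : Function.Injective σ) :
    ∫ α in ubox (EqIdx t ν μ), ∏ a, ‖fj t ν μ k s c A α (σ a)‖ ≤
      (∏ g, (2 * u g : ℝ)) * ∏ g, JA t ν k A (u g) (h g) := by
  have hc : ∀ j, Continuous fun α => fj t ν μ k s c A α j := fun j => continuous_fj A j
  have hpt : ∀ α, ∏ a, ‖fj t ν μ k s c A α (σ a)‖ ≤
      ∑ τ ∈ Fintype.piFinset fun g : Fin M => (Finset.univ : Finset (Fin (2 * u g))),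
        ∏ g, ‖fj t ν μ k s c A α (σ ⟨g, τ g⟩)‖ ^ (2 * u g) := by
    intro α
    rw [← Finset.prod_univ_sum (fun g : Fin M => (Finset.univ : Finset (Fin (2 * u g))))
      (fun g a => ‖fj t ν μ k s c A α (σ ⟨g, a⟩)‖ ^ (2 * u g)), Fintype.prod_sigma]
    refine Finset.prod_le_prod (fun g _ => Finset.prod_nonneg fun _ _ => norm_nonneg _) fun g _ => ?_
    exact prod_le_sum_pow (by have := hu g; omega) _ fun _ => norm_nonneg _
  refine (integral_mono (μ := volume.restrict (ubox (EqIdx t ν μ))) (integrableOn_ubox (by fun_prop))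
    (integrableOn_ubox (by fun_prop)) hpt).trans ?_
  rw [integral_finsetSum _ fun τ _ => integrableOn_ubox (by fun_prop)]
  refine (Finset.sum_le_card_nsmul _ _ _ fun τ _ => integral_prod_normpow_le hns A hM u h hh
    (fun g => σ ⟨g, τ g⟩) fun g g' hgg => congr_arg Sigma.fst (hσ hgg)).trans ?_
  rw [nsmul_eq_mul, Fintype.card_piFinset]
  simp

end system

section setup
variable {t : ℕ} {ν μ : Fin t → ℕ} {k : (l : Fin t) → Fin (ν l) → ℕ} {s : ℕ}

lemma mu1_succ (l : Fin t) : mu1 t μ (l + 1) = μ l := by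
  rw [mu1, dif_pos ⟨by omega, by omega⟩]; rfl

lemma mu1_anti (hμ : StrictAnti μ) {a b : ℕ} (ha : 1 ≤ a) (hab : a ≤ b) :
    mu1 t μ b ≤ mu1 t μ a := by
  unfold mu1
  split_ifs with h1 h2 h2
  · exact hμ.antitone (by simp only [Fin.mk_le_mk]; omega)
  · omega
  · exact Nat.zero_le _
  · exact le_rfl

lemma le_mu1_one (hμ : StrictAnti μ) (l : Fin t) : μ l ≤ mu1 t μ 1 := by
  rw [← mu1_succ (μ := μ) l]; exact mu1_anti hμ le_rfl (by omega)

lemma exists_level (hμ : StrictAnti μ) (g : Fin (mu1 t μ 1)) :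
    ∃ h : ℕ, 1 ≤ h ∧ h ≤ t ∧ mu1 t μ (h + 1) ≤ g ∧ (g : ℕ) < mu1 t μ h ∧
      ∀ l : Fin t, (l : ℕ) < h ↔ (g : ℕ) < μ l := by
  have hzero : ∀ m, t < m → mu1 t μ m = 0 := fun m hm => by unfold mu1; exact dif_neg (by omega)
  have hex : ∃ h, mu1 t μ (h + 1) ≤ g := ⟨t, by rw [hzero _ (by omega)]; omega⟩
  set h := Nat.find hex with hh
  have h1 : mu1 t μ (h + 1) ≤ g := Nat.find_spec hex
  have hmin : ∀ m, m < h → (g : ℕ) < mu1 t μ (m + 1) := fun m hm => not_le.1 (Nat.find_min hex hm)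
  have hpos : 1 ≤ h := by
    by_contra hcon
    have h0 : h = 0 := by omega
    rw [h0] at h1
    have := g.2
    simp only [zero_add] at h1
    omega
  have hlast : (g : ℕ) < mu1 t μ h := by
    have := hmin (h - 1) (by omega)
    rwa [Nat.sub_add_cancel hpos] at this
  refine ⟨h, hpos, ?_, h1, hlast, fun l => ⟨fun hl => ?_, fun hl => ?_⟩⟩
  · by_contra hcon
    have h7 := hzero h (by omega)
    omega
  · rw [← mu1_succ (μ := μ) l]; exact hmin l hl
  · by_contra hcon
    rw [← mu1_succ (μ := μ) l] at hl
    have := mu1_anti hμ (a := h + 1) (b := l + 1) (by omega) (by omega)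
    omega

lemma card_filter_fin (n : ℕ) (p : ℕ → Prop) [DecidablePred p] :
    (Finset.univ.filter fun g : Fin n => p g).card = ((Finset.range n).filter p).card := by
  refine Finset.card_bij (fun g _ => (g : ℕ)) (fun g hg => ?_) (fun a _ b _ h => Fin.ext h)
    fun b hb => ?_
  · simp only [Finset.mem_filter, Finset.mem_univ, true_and] at hg
    simp [hg]
  · simp only [Finset.mem_filter, Finset.mem_range] at hb
    exact ⟨⟨b, hb.1⟩, by simp [hb.2], rfl⟩

lemma exists_levels (hgrp : GroupedDegrees t ν μ k)
    (hs : 2 * (∑ h ∈ Finset.Icc 1 t,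
        ((mu1 t μ h : ℝ) - (mu1 t μ (h + 1) : ℝ)) *
          max (u0 t ν k h : ℝ) ((kmax t ν k : ℝ) * (1 + (varpi t ν h : ℝ)) / 2))
      + (mu1 t μ 1 : ℝ) ≤ (s : ℝ)) :
    ∃ h : Fin (mu1 t μ 1) → ℕ, (∀ g (l : Fin t), (l : ℕ) < h g ↔ (g : ℕ) < μ l) ∧
      ∑ g, 2 * max (u0 t ν k (h g)) 1 + mu1 t μ 1 ≤ s := by
  obtain ⟨ht, hν, hμ0, hμ, hk, hinj⟩ := hgrp
  choose h hh1 hht hh2 hh3 hh using exists_level (μ := μ) hμ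
  refine ⟨h, hh, ?_⟩
  set F : ℕ → ℝ := fun h =>
    max (u0 t ν k h : ℝ) ((kmax t ν k : ℝ) * (1 + (varpi t ν h : ℝ)) / 2) with hF
  have hFle : ∀ m, 1 ≤ m → ((max (u0 t ν k m) 1 : ℕ) : ℝ) ≤ F m := by
    intro m hm
    rw [Nat.cast_max]
    refine max_le_max le_rfl ?_
    have h1 : 1 ≤ kmax t ν k := by
      have h0 := Finset.le_sup (f := fun p : KIdx t ν => k p.1 p.2)
        (Finset.mem_univ ⟨⟨0, ht⟩, ⟨0, hν _⟩⟩)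
      exact (hk _ _).trans_le h0
    have h2 : 1 ≤ varpi t ν m := by
      have h0 := Finset.single_le_sum (f := fun l : Fin t => if (l : ℕ) < m then ν l else 0)
        (fun _ _ => Nat.zero_le _) (Finset.mem_univ (⟨0, ht⟩ : Fin t))
      simp only [if_pos (show 0 < m by omega)] at h0
      exact (hν _).trans_le h0
    have h1' : (1 : ℝ) ≤ kmax t ν k := by exact_mod_cast h1
    have h2' : (1 : ℝ) ≤ varpi t ν m := by exact_mod_cast h2
    push_cast
    nlinarith
  have hsum : ∑ g, F (h g) = ∑ m ∈ Finset.Icc 1 t,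
      ((mu1 t μ m : ℝ) - (mu1 t μ (m + 1) : ℝ)) * F m := by
    rw [← Finset.sum_fiberwise_of_maps_to (s := Finset.univ) (t := Finset.Icc 1 t) (g := h)
      (fun g _ => Finset.mem_Icc.2 ⟨hh1 g, hht g⟩)]
    refine Finset.sum_congr rfl fun m hm => ?_
    have hm' := Finset.mem_Icc.1 hm
    have hc : ∀ g : Fin (mu1 t μ 1), h g = m ↔ mu1 t μ (m + 1) ≤ g ∧ (g : ℕ) < mu1 t μ m := by
      intro g
      constructor
      · rintro rfl; exact ⟨hh2 g, hh3 g⟩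
      · rintro ⟨h1, h2⟩
        rcases lt_trichotomy (h g) m with h3 | h3 | h3
        · have := mu1_anti hμ (a := h g + 1) (b := m) (by omega) (by omega)
          have := hh2 g
          omega
        · exact h3
        · have := mu1_anti hμ (a := m + 1) (b := h g) (by omega) (by omega)
          have := hh3 g
          omega
    rw [Finset.sum_congr rfl (g := fun _ => F m) (fun g hg => by rw [(Finset.mem_filter.1 hg).2]),
      Finset.sum_const, nsmul_eq_mul]
    congr 1
    have hcard : (Finset.univ.filter fun g : Fin (mu1 t μ 1) => h g = m).card =
        mu1 t μ m - mu1 t μ (m + 1) := by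
      simp_rw [hc]
      have h5 := card_filter_fin (mu1 t μ 1)
        (fun g => mu1 t μ (m + 1) ≤ g ∧ g < mu1 t μ m)
      rw [h5]
      have h6 : (Finset.range (mu1 t μ 1)).filter
          (fun g => mu1 t μ (m + 1) ≤ g ∧ g < mu1 t μ m) =
          Finset.Ico (mu1 t μ (m + 1)) (mu1 t μ m) := by
        ext g
        have := mu1_anti hμ (a := 1) (b := m) (by omega) hm'.1
        simp only [Finset.mem_filter, Finset.mem_range, Finset.mem_Ico]
        omega
      rw [h6, Nat.card_Ico]
    rw [hcard, Nat.cast_sub (mu1_anti hμ hm'.1 (by omega))]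
  rw [← hsum] at hs
  have h1 : ∑ g, ((max (u0 t ν k (h g)) 1 : ℕ) : ℝ) ≤ ∑ g, F (h g) :=
    Finset.sum_le_sum fun g _ => hFle _ (hh1 g)
  have h2 : ((∑ g, 2 * max (u0 t ν k (h g)) 1 + mu1 t μ 1 : ℕ) : ℝ) ≤ s := by
    rw [← Finset.mul_sum]
    push_cast at h1 ⊢
    linarith
  exact_mod_cast h2

lemma sum_Ksum_eq (h : Fin (mu1 t μ 1) → ℕ) (hμ : StrictAnti μ)
    (hh : ∀ g (l : Fin t), (l : ℕ) < h g ↔ (g : ℕ) < μ l) :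
    ∑ g, Ksum t ν k (h g) = Ktot t ν μ k := by
  unfold Ksum Ktot
  rw [Finset.sum_comm, Fintype.sum_sigma, Fintype.sum_sigma]
  refine Finset.sum_congr rfl fun l _ => ?_
  rw [Fintype.sum_prod_type]
  refine Finset.sum_congr rfl fun n _ => ?_
  simp_rw [hh, deg]
  rw [← Finset.sum_filter, Finset.sum_const, Finset.sum_const]
  congr 1
  have h5 := card_filter_fin (mu1 t μ 1) (fun g => g < μ l)
  rw [h5]
  have h6 : (Finset.range (mu1 t μ 1)).filter (fun g => g < μ l) = Finset.range (μ l) := by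
    ext g
    have := le_mu1_one hμ l
    simp only [Finset.mem_filter, Finset.mem_range]
    omega
  rw [h6]; simp

theorem smooth_mean_value (hgrp : GroupedDegrees t ν μ k)
    (hs : 2 * (∑ h ∈ Finset.Icc 1 t,
        ((mu1 t μ h : ℝ) - (mu1 t μ (h + 1) : ℝ)) *
          max (u0 t ν k h : ℝ) ((kmax t ν k : ℝ) * (1 + (varpi t ν h : ℝ)) / 2))
      + (mu1 t μ 1 : ℝ) ≤ (s : ℝ))
    {c : EqIdx t ν μ → Fin s → ℤ} (hns : HighlyNonSingular t ν μ s c) :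
    ∃ η : ℝ, 0 < η ∧ η ≤ 1 ∧ ∃ J : Finset (Fin s), mu1 t μ 1 ≤ Jᶜ.card ∧
      ∃ C : ℝ, 0 ≤ C ∧ ∃ P₀ : ℝ, 1 ≤ P₀ ∧ ∀ P : ℝ, P₀ ≤ P →
        ∫ α in ubox (EqIdx t ν μ), ∏ j ∈ J, ‖fj t ν μ k s c (smoothFS P (P ^ η)) α j‖ ≤
          C * P ^ J.card / P ^ Ktot t ν μ k := by
  obtain ⟨h, hh, hsum⟩ := exists_levels hgrp hs
  obtain ⟨ht, hν, hμ0, hμ, hk, hinj⟩ := hgrp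
  have hsum' : ∀ u : Fin (mu1 t μ 1) → ℕ, u = (fun g => max (u0 t ν k (h g)) 1) →
      ∑ g, 2 * u g + mu1 t μ 1 ≤ s := by rintro u rfl; exact hsum
  obtain ⟨u, hu⟩ : ∃ u : Fin (mu1 t μ 1) → ℕ, u = fun g => max (u0 t ν k (h g)) 1 := ⟨_, rfl⟩
  have hsum := hsum' u hu
  have hu1 : ∀ g, 1 ≤ u g := fun g => by rw [hu]; exact le_max_right _ _
  have hadm : ∀ g, AdmU k (h g) (u g) := fun g => by
    rw [hu]; exact AdmU_max_u0 hk hinj (h g)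
  choose η₀ hη₀ hη using hadm
  obtain ⟨η, hηpos, hη1, hηle⟩ : ∃ η : ℝ, 0 < η ∧ η ≤ 1 ∧ ∀ g, η ≤ η₀ g := by
    have hne : (insert 1 (Finset.univ.image η₀)).Nonempty := ⟨1, by simp⟩
    refine ⟨(insert 1 (Finset.univ.image η₀)).min' hne, ?_, Finset.min'_le _ _ (by simp),
      fun g => Finset.min'_le _ _ (by simp)⟩
    rw [Finset.lt_min'_iff]
    intro y hy
    simp only [Finset.mem_insert, Finset.mem_image, Finset.mem_univ, true_and] at hy
    rcases hy with rfl | ⟨g, rfl⟩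
    · exact one_pos
    · exact hη₀ g
  choose C P₀ hC using fun g => hη g η ⟨hηpos, hηle g⟩
  have hcard : Fintype.card (Σ g, Fin (2 * u g)) = ∑ g, 2 * u g := by simp
  obtain ⟨σ⟩ : Nonempty ((Σ g, Fin (2 * u g)) ↪ Fin s) :=
    Function.Embedding.nonempty_of_card_le (by rw [hcard, Fintype.card_fin]; omega)
  refine ⟨η, hηpos, hη1, Finset.univ.map σ, ?_, (∏ g, (2 * u g : ℝ)) * ∏ g, |C g|, by positivity,
    1 + ∑ g, |P₀ g|, by linarith [Finset.sum_nonneg fun g (_ : g ∈ Finset.univ) => abs_nonneg (P₀ g)],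
    fun P hP => ?_⟩
  · rw [Finset.card_compl, Finset.card_map, Finset.card_univ, hcard, Fintype.card_fin]
    omega
  have hsn := Finset.sum_nonneg fun g (_ : g ∈ Finset.univ) => abs_nonneg (P₀ g)
  have hP0 : 0 < P := by linarith
  have hPg : ∀ g, P₀ g ≤ P := fun g => by
    have := Finset.single_le_sum (f := fun g => |P₀ g|) (fun g _ => abs_nonneg (P₀ g))
      (Finset.mem_univ g)
    have h2 := le_abs_self (P₀ g)
    linarith
  simp_rw [Finset.prod_map]
  refine (integral_prod_le hns _ (le_mu1_one hμ) u h hu1 hh σ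
    σ.injective).trans ?_
  rw [Finset.card_map, Finset.card_univ, hcard]
  calc _ ≤ (∏ g, (2 * u g : ℝ)) * ∏ g, (|C g| * (P ^ (2 * u g) / P ^ Ksum t ν k (h g))) := by
        refine mul_le_mul_of_nonneg_left (Finset.prod_le_prod (fun g _ => JA_nonneg _ _ _)
          fun g _ => ?_) (by positivity)
        refine (hC g P (hPg g)).trans ?_
        rw [Real.rpow_sub hP0]
        have e1 : P ^ (2 * u g : ℝ) = P ^ (2 * u g) := by
          rw [← Real.rpow_natCast]; push_cast; rfl
        rw [e1, Real.rpow_natCast]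
        gcongr
        exact le_abs_self _
    _ = _ := by
        have e : ∏ g, (|C g| * (P ^ (2 * u g) / P ^ Ksum t ν k (h g))) =
            (∏ g, |C g|) * (P ^ (∑ g, 2 * u g) / P ^ Ktot t ν μ k) := by
          rw [Finset.prod_mul_distrib, Finset.prod_div_distrib, Finset.prod_pow_eq_pow_sum,
            Finset.prod_pow_eq_pow_sum, sum_Ksum_eq h hμ hh]
        rw [e]
        ring

end setup

lemma exists_totient_le {ε : ℝ} (hε : 0 < ε) : ∃ z : ℕ, ((primorial z).totient : ℝ) ≤
    ε * primorial z := by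
  have h1 := (not_summable_iff_tendsto_nat_atTop_of_nonneg (fun n => Set.indicator_nonneg
    (fun n _ => by positivity) n)).1 not_summable_one_div_on_primes
  obtain ⟨z, hz⟩ := (h1.eventually_ge_atTop (-Real.log ε)).exists
  refine ⟨z, ?_⟩
  have h2 := Nat.totient_eq_mul_prod_factors (primorial z)
  have h3 : ((primorial z).totient : ℝ) =
      primorial z * ∏ p ∈ (primorial z).primeFactors, (1 - (p : ℝ)⁻¹) := by
    have := congrArg (Rat.cast : ℚ → ℝ) h2
    push_cast at this
    exact this
  rw [h3, mul_comm]
  refine mul_le_mul_of_nonneg_right ?_ (Nat.cast_nonneg _)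
  have h4 : ∏ p ∈ (primorial z).primeFactors, (1 - (p : ℝ)⁻¹) ≤
      ∏ p ∈ (primorial z).primeFactors, Real.exp (-(p : ℝ)⁻¹) := by
    refine Finset.prod_le_prod (fun p hp => ?_) fun p hp => ?_
    · have : (1 : ℝ) ≤ p := by exact_mod_cast (Nat.prime_of_mem_primeFactors hp).one_le
      have := inv_le_one_of_one_le₀ this
      linarith
    · have := Real.add_one_le_exp (-(p : ℝ)⁻¹)
      linarith
  refine h4.trans ?_
  rw [← Real.exp_sum, ← Real.le_log_iff_exp_le hε, Finset.sum_neg_distrib]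
  have h5 : ∑ i ∈ Finset.range z, {p | Nat.Prime p}.indicator (fun n : ℕ => 1 / (n : ℝ)) i ≤
      ∑ p ∈ (primorial z).primeFactors, (p : ℝ)⁻¹ := by
    simp_rw [Set.indicator_apply]
    rw [← Finset.sum_filter]
    simp_rw [one_div]
    refine Finset.sum_le_sum_of_subset_of_nonneg (fun p hp => ?_) fun _ _ _ => by positivity
    simp only [Finset.mem_filter, Finset.mem_range, Set.mem_ofPred_eq] at hp
    exact Nat.mem_primeFactors.2 ⟨hp.2, (hp.2.dvd_primorial_iff).2 hp.1.le,
      primorial_ne_zero z⟩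
  linarith

/-- Integers in `[1, P]` with no prime factor up to `R`. -/
def roughFS (P : ℕ) (R : ℝ) : Finset ℕ :=
  (Finset.Icc 1 P).filter fun d => ∀ p : ℕ, p.Prime → p ∣ d → R < p

lemma card_roughFS_le {η : ℝ} (hη : 0 < η) {ε : ℝ} (hε : 0 < ε) :
    ∀ᶠ P : ℕ in atTop, ((roughFS P ((P : ℝ) ^ η)).card : ℝ) ≤ ε * P := by
  obtain ⟨z, hz⟩ := exists_totient_le (half_pos hε)
  have h1 : Tendsto (fun P : ℕ => (P : ℝ) ^ η) atTop atTop :=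
    (tendsto_rpow_atTop hη).comp tendsto_natCast_atTop_atTop
  have h2 : ∀ᶠ P : ℕ in atTop, ((primorial z).totient : ℝ) ≤ ε / 2 * P :=
    (tendsto_natCast_atTop_atTop.const_mul_atTop (half_pos hε)).eventually_ge_atTop _
  filter_upwards [h1.eventually_ge_atTop (z : ℝ), h2] with P hP1 hP2
  have hm := primorial_pos z
  have h3 : roughFS P ((P : ℝ) ^ η) ⊆
      (Finset.Ico 1 (1 + P)).filter fun x => (primorial z).Coprime x := by
    intro d hd
    simp only [roughFS, Finset.mem_filter, Finset.mem_Icc] at hd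
    rw [Finset.mem_filter, Finset.mem_Ico]
    refine ⟨by omega, Nat.Coprime.symm (Nat.Coprime.symm (Nat.coprime_of_dvd ?_))⟩
    intro p hp h4 h5
    have h6 := hd.2 p hp h5
    have h7 : p ≤ z := (hp.dvd_primorial_iff).1 h4
    have h8 : (p : ℝ) ≤ z := by exact_mod_cast h7
    linarith
  have h4 := (Finset.card_le_card h3).trans
    (by convert Nat.Ico_filter_coprime_le 1 P hm.ne')
  have h5 : ((roughFS P ((P : ℝ) ^ η)).card : ℝ) ≤
      (primorial z).totient * ((P / primorial z : ℕ) + 1) := by exact_mod_cast h4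
  have h6 : ((P / primorial z : ℕ) : ℝ) ≤ P / primorial z := Nat.cast_div_le
  have hm' : (0 : ℝ) < primorial z := by exact_mod_cast hm
  calc _ ≤ _ := h5
    _ ≤ (primorial z).totient * ((P : ℝ) / primorial z) + (primorial z).totient := by
        rw [mul_add, mul_one]; gcongr
    _ ≤ (ε / 2 * primorial z) * ((P : ℝ) / primorial z) + ε / 2 * P := by gcongr
    _ = ε * P := by field_simp; ring

/-- The product of the primes in `(R, P]`. -/
def roughProd (P : ℕ) (R : ℝ) : ℕ :=
  ∏ p ∈ (Finset.Icc 1 P).filter (fun p : ℕ => p.Prime ∧ R < p), p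

lemma roughProd_ne_zero (P : ℕ) (R : ℝ) : roughProd P R ≠ 0 :=
  Finset.prod_ne_zero_iff.2 fun _ hp => (Finset.mem_filter.1 hp).2.1.ne_zero

lemma prime_dvd_roughProd {P : ℕ} {R : ℝ} {p : ℕ} (hp : p.Prime) :
    p ∣ roughProd P R ↔ p ≤ P ∧ R < p := by
  rw [roughProd, hp.prime.dvd_finsetProd_iff]
  constructor
  · rintro ⟨q, hq, h⟩
    simp only [Finset.mem_filter, Finset.mem_Icc] at hq
    rw [(Nat.prime_dvd_prime_iff_eq hp hq.2.1).1 h]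
    exact ⟨hq.1.2, hq.2.2⟩
  · rintro ⟨h1, h2⟩
    exact ⟨p, by simp [hp, h1, h2, hp.one_le], dvd_rfl⟩

lemma mem_smoothFS_iff_coprime {P : ℕ} {R : ℝ} {n : ℕ} (hn : n ∈ Finset.Icc 1 P) :
    n ∈ smoothFS P R ↔ n.gcd (roughProd P R) = 1 := by
  rw [smoothFS, Nat.floor_natCast, Finset.mem_filter]
  simp only [hn, true_and]
  rw [← Nat.coprime_iff_gcd_eq_one] at *
  have hn' := Finset.mem_Icc.1 hn
  constructor
  · intro h
    refine Nat.coprime_of_dvd fun p hp h1 h2 => ?_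
    have := h p hp h1
    have := ((prime_dvd_roughProd hp).1 h2).2
    linarith
  · intro h p hp h1
    by_contra! hcon
    have h2 : p ∣ roughProd P R :=
      (prime_dvd_roughProd hp).2 ⟨(Nat.le_of_dvd (by omega) h1).trans hn'.2, hcon⟩
    exact hp.one_lt.ne' (Nat.dvd_one.1 (h ▸ Nat.dvd_gcd h1 h2))

lemma indicator_smooth {P : ℕ} {R : ℝ} {n : ℕ} (hn : n ∈ Finset.Icc 1 P) :
    (if n ∈ smoothFS P R then (1 : ℝ) else 0) =
      ∑ d ∈ (roughProd P R).divisors.filter (fun d => d ≤ P),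
        if d ∣ n then (ArithmeticFunction.moebius d : ℝ) else 0 := by
  have hn' := Finset.mem_Icc.1 hn
  have h1 := congrFun (congrArg DFunLike.coe ArithmeticFunction.moebius_mul_coe_zeta)
    (n.gcd (roughProd P R))
  rw [ArithmeticFunction.coe_mul_zeta_apply, ArithmeticFunction.one_apply] at h1
  rw [← Finset.sum_filter]
  have h2 : ((roughProd P R).divisors.filter (fun d => d ≤ P)).filter (fun d => d ∣ n) =
      (n.gcd (roughProd P R)).divisors := by
    ext d
    simp only [Finset.mem_filter, Nat.mem_divisors, Nat.dvd_gcd_iff]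
    constructor
    · rintro ⟨⟨⟨h3, h4⟩, h5⟩, h6⟩
      exact ⟨⟨h6, h3⟩, Nat.gcd_ne_zero_left (by omega)⟩
    · rintro ⟨⟨h3, h4⟩, h5⟩
      exact ⟨⟨⟨h4, roughProd_ne_zero _ _⟩, (Nat.le_of_dvd (by omega) h3).trans hn'.2⟩, h3⟩
  rw [h2]
  have h3 : ∑ d ∈ (n.gcd (roughProd P R)).divisors, (ArithmeticFunction.moebius d : ℝ) =
      ((∑ d ∈ (n.gcd (roughProd P R)).divisors, ArithmeticFunction.moebius d : ℤ) : ℝ) := by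
    push_cast; rfl
  rw [h3, h1]
  simp only [mem_smoothFS_iff_coprime hn]
  split_ifs <;> simp

lemma abs_card_modEq_sub_le {r : ℕ} (hr : 0 < r) (x v : ℕ) :
    |(((Finset.Icc 1 x).filter fun n => n ≡ v [MOD r]).card : ℝ) - x / r| ≤ 1 := by
  have h := Nat.Ioc_filter_modEq_card 0 x hr v
  have e : Finset.Ioc 0 x = Finset.Icc 1 x := rfl
  rw [e] at h
  have h' : (((Finset.Icc 1 x).filter fun n => n ≡ v [MOD r]).card : ℤ) =
    max (⌊((x : ℚ) - v) / r⌋ - ⌊(((0 : ℕ) : ℚ) - v) / r⌋) 0 := by convert h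
  have hrq : (0 : ℚ) < r := by exact_mod_cast hr
  have h1 := Int.floor_le (((x : ℚ) - v) / r)
  have h2 := Int.lt_floor_add_one (((x : ℚ) - v) / r)
  have h3 := Int.floor_le ((((0 : ℕ) : ℚ) - v) / r)
  have h4 := Int.lt_floor_add_one ((((0 : ℕ) : ℚ) - v) / r)
  have h5 : ((x : ℚ) - v) / r - (((0 : ℕ) : ℚ) - v) / r = x / r := by
    field_simp; push_cast; ring
  have h6 : (0 : ℚ) ≤ x / r := by positivity
  have hc : ((((Finset.Icc 1 x).filter fun n => n ≡ v [MOD r]).card : ℤ) : ℚ) =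
      max ((⌊((x : ℚ) - v) / r⌋ : ℚ) - ⌊(((0 : ℕ) : ℚ) - v) / r⌋) 0 := by
    rw [h']; push_cast; rfl
  have key : |((((Finset.Icc 1 x).filter fun n => n ≡ v [MOD r]).card : ℤ) : ℚ) - x / r| ≤ 1 := by
    rw [hc, abs_le]
    have := le_max_left ((⌊((x : ℚ) - v) / r⌋ : ℚ) - ⌊(((0 : ℕ) : ℚ) - v) / r⌋) 0
    refine ⟨by linarith, ?_⟩
    rw [sub_le_iff_le_add]
    exact max_le (by linarith) (by linarith)
  have : |((((Finset.Icc 1 x).filter fun n => n ≡ v [MOD r]).card : ℕ) : ℚ) - x / r| ≤ 1 := by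
    exact_mod_cast key
  have h7 := (Rat.cast_le (K := ℝ)).2 this
  push_cast at h7
  exact h7

lemma abs_card_dvd_modEq_sub_le {d q : ℕ} (hd : 0 < d) (hq : 0 < q) (h : d.Coprime q) (x b : ℕ) :
    |(((Finset.Icc 1 x).filter fun n => d ∣ n ∧ n ≡ b [MOD q]).card : ℝ) - x / (d * q)| ≤ 1 := by
  obtain ⟨v, hv1, hv2⟩ := Nat.chineseRemainder h 0 b
  have h1 := abs_card_modEq_sub_le (Nat.mul_pos hd hq) x v
  push_cast at h1
  have h2 : ((Finset.Icc 1 x).filter fun n => d ∣ n ∧ n ≡ b [MOD q]) =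
      ((Finset.Icc 1 x).filter fun n => n ≡ v [MOD d * q]) := by
    refine Finset.filter_congr fun n _ => ?_
    rw [← Nat.modEq_and_modEq_iff_modEq_mul h, ← Nat.modEq_zero_iff_dvd]
    exact and_congr ⟨fun h => h.trans hv1.symm, fun h => h.trans hv1⟩
      ⟨fun h => h.trans hv2.symm, fun h => h.trans hv2⟩
  rw [h2]; exact h1

/-- The (approximate) density of the smooth numbers. -/
def smoothDensity (P : ℕ) (R : ℝ) : ℝ :=
  ∑ d ∈ (roughProd P R).divisors.filter (fun d => d ≤ P),
    (ArithmeticFunction.moebius d : ℝ) / d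

lemma smooth_equidistribution {η : ℝ} (hη : 0 < η) {ε : ℝ} (hε : 0 < ε) {q : ℕ} (hq : 0 < q) :
    ∀ᶠ P : ℕ in atTop, ∀ x ≤ P, ∀ b : ℕ,
      |(((smoothFS P ((P : ℝ) ^ η)).filter fun n => n ≤ x ∧ n ≡ b [MOD q]).card : ℝ) -
        smoothDensity P ((P : ℝ) ^ η) * x / q| ≤ ε * P := by
  have h1 : Tendsto (fun P : ℕ => (P : ℝ) ^ η) atTop atTop :=
    (tendsto_rpow_atTop hη).comp tendsto_natCast_atTop_atTop
  filter_upwards [h1.eventually_ge_atTop (q : ℝ), card_roughFS_le hη hε] with P hP1 hP2 x hx b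
  refine le_trans ?_ hP2
  set R := (P : ℝ) ^ η with hR
  set S := (roughProd P R).divisors.filter (fun d => d ≤ P) with hS
  have hSr : S ⊆ roughFS P R := by
    intro d hd
    simp only [hS, Finset.mem_filter, Nat.mem_divisors] at hd
    simp only [roughFS, Finset.mem_filter, Finset.mem_Icc]
    refine ⟨⟨Nat.pos_of_dvd_of_pos hd.1.1 (Nat.pos_of_ne_zero hd.1.2), hd.2⟩, fun p hp h => ?_⟩
    exact ((prime_dvd_roughProd hp).1 (h.trans hd.1.1)).2
  have hcount : (((smoothFS P R).filter fun n => n ≤ x ∧ n ≡ b [MOD q]).card : ℝ) =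
      ∑ d ∈ S, (ArithmeticFunction.moebius d : ℝ) *
        ((Finset.Icc 1 x).filter fun n => d ∣ n ∧ n ≡ b [MOD q]).card := by
    have e1 : ((smoothFS P R).filter fun n => n ≤ x ∧ n ≡ b [MOD q]) =
        ((Finset.Icc 1 x).filter fun n => n ≡ b [MOD q]).filter (fun n => n ∈ smoothFS P R) := by
      ext n
      simp only [smoothFS, Nat.floor_natCast, Finset.mem_filter, Finset.mem_Icc]
      constructor
      · rintro ⟨⟨⟨h1, h2⟩, h3⟩, h4, h5⟩; exact ⟨⟨⟨h1, h4⟩, h5⟩, ⟨h1, h2⟩, h3⟩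
      · rintro ⟨⟨⟨h1, h4⟩, h5⟩, ⟨_, h2⟩, h3⟩; exact ⟨⟨⟨h1, h2⟩, h3⟩, h4, h5⟩
    rw [e1, Finset.card_filter]
    push_cast
    have e2 : ∀ n ∈ (Finset.Icc 1 x).filter (fun n => n ≡ b [MOD q]),
        (if n ∈ smoothFS P R then (1 : ℝ) else 0) = ∑ d ∈ S,
        if d ∣ n then (ArithmeticFunction.moebius d : ℝ) else 0 := fun n hn =>
      indicator_smooth (Finset.Icc_subset_Icc_right hx (Finset.mem_filter.1 hn).1)
    rw [Finset.sum_congr rfl e2, Finset.sum_comm]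
    refine Finset.sum_congr rfl fun d _ => ?_
    rw [← Finset.sum_filter, Finset.sum_const, nsmul_eq_mul, mul_comm, Finset.filter_filter]
    congr 3
    ext n
    simp only [Finset.mem_filter]
    tauto
  rw [hcount]
  have e3 : smoothDensity P R * x / q =
      ∑ d ∈ S, (ArithmeticFunction.moebius d : ℝ) * ((x : ℝ) / (d * q)) := by
    rw [smoothDensity, mul_div_assoc, Finset.sum_mul]
    refine Finset.sum_congr rfl fun d _ => ?_
    rw [div_mul_div_comm, mul_div_assoc]
  rw [e3, ← Finset.sum_sub_distrib]
  calc _ ≤ ∑ d ∈ S, (1 : ℝ) := by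
        refine (Finset.abs_sum_le_sum_abs _ _).trans (Finset.sum_le_sum fun d hd => ?_)
        have hd' := hSr hd
        simp only [roughFS, Finset.mem_filter, Finset.mem_Icc] at hd'
        rw [← mul_sub, abs_mul]
        have hm : |(ArithmeticFunction.moebius d : ℝ)| ≤ 1 := by
          exact_mod_cast ArithmeticFunction.abs_moebius_le_one (n := d)
        refine mul_le_one₀ hm (abs_nonneg _) ?_
        refine abs_card_dvd_modEq_sub_le (by omega) hq (Nat.coprime_of_dvd fun p hp h1 h2 => ?_) x b
        have h3 := hd'.2 p hp h1
        have h4 : (p : ℝ) ≤ q := by exact_mod_cast Nat.le_of_dvd hq h2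
        linarith
    _ = S.card := by simp
    _ ≤ _ := by exact_mod_cast Finset.card_le_card hSr

/-- The primes in `(a, b]`. -/
def primesIoc (a b : ℝ) : Finset ℕ := (Finset.Ioc ⌊a⌋₊ ⌊b⌋₊).filter Nat.Prime

lemma mem_primesIoc {a b : ℝ} (ha : 0 ≤ a) (hb : 0 ≤ b) {p : ℕ} :
    p ∈ primesIoc a b ↔ p.Prime ∧ a < p ∧ (p : ℝ) ≤ b := by
  rw [primesIoc, Finset.mem_filter, Finset.mem_Ioc, Nat.floor_lt ha, Nat.le_floor_iff hb]
  tauto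

lemma sum_primesIoc_add {a b d : ℝ} (hab : a ≤ b) (hbd : b ≤ d) (f : ℕ → ℝ) :
    ∑ p ∈ primesIoc a b, f p + ∑ p ∈ primesIoc b d, f p = ∑ p ∈ primesIoc a d, f p := by
  have h1 := Nat.floor_mono hab
  have h2 := Nat.floor_mono hbd
  rw [← Finset.sum_union]
  · congr 1
    rw [primesIoc, primesIoc, primesIoc, ← Finset.filter_union,
      Finset.Ioc_union_Ioc_eq_Ioc h1 h2]
  · rw [Finset.disjoint_left]
    intro p hp hp'
    simp only [primesIoc, Finset.mem_filter, Finset.mem_Ioc] at hp hp'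
    omega

lemma eventually_log_sum_ge : ∀ᶠ x : ℝ in atTop, x ≤ ∑ p ∈ primesIoc x (4 * x), Real.log p := by
  have h1 : Tendsto (fun x : ℝ => Real.log x / √x) atTop (nhds 0) := by
    have := (isLittleO_log_rpow_atTop (show (0 : ℝ) < 1 / 2 by norm_num)).tendsto_div_nhds_zero
    simpa only [Real.sqrt_eq_rpow] using this
  filter_upwards [h1.eventually_lt_const (show (0 : ℝ) < 1 / 1000 by norm_num),
    eventually_ge_atTop 10000] with x h2 h3
  have hx : 0 < √x := Real.sqrt_pos.2 (by linarith)
  rw [div_lt_iff₀ hx] at h2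
  have h4 := Chebyshev.theta_ge' (x := 4 * x) (by linarith)
  have h5 := Chebyshev.theta_le_log4_mul_x (x := x) (by linarith)
  have h6 : ∑ p ∈ primesIoc x (4 * x), Real.log p = Chebyshev.theta (4 * x) - Chebyshev.theta x := by
    have := sum_primesIoc_add (show (0 : ℝ) ≤ x by linarith) (show x ≤ 4 * x by linarith)
      (fun p => Real.log p)
    have e : ∀ y : ℝ, Chebyshev.theta y = ∑ p ∈ primesIoc 0 y, Real.log p := by
      intro y
      rw [Chebyshev.theta, primesIoc, Nat.floor_zero]
    rw [e, e, ← this]; ring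
  rw [h6]
  have hl4 : Real.log 4 = 2 * Real.log 2 := by
    rw [show (4 : ℝ) = 2 ^ 2 by norm_num, Real.log_pow]; norm_num
  have hl2 := Real.log_two_gt_d9
  have hl2' := Real.log_two_lt_d9
  have hs4 : √(4 * x) = 2 * √x := by
    rw [Real.sqrt_mul (by norm_num), show (4 : ℝ) = 2 ^ 2 by norm_num, Real.sqrt_sq (by norm_num)]
  have hlx : Real.log (4 * x) = 2 * Real.log 2 + Real.log x := by
    rw [Real.log_mul (by norm_num) (by linarith), hl4]
  have hlx2 : Real.log (4 * x + 2) ≤ 2 * Real.log 2 + Real.log x + 1 := by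
    have h7 : Real.log (4 * x + 2) ≤ Real.log (4 * x * Real.exp 1) := by
      refine Real.log_le_log (by linarith) ?_
      have := Real.add_one_le_exp 1
      nlinarith
    rw [Real.log_mul (by linarith) (Real.exp_pos 1).ne', hlx, Real.log_exp] at h7
    exact h7
  have hsx : √x * √x = x := Real.mul_self_sqrt (by linarith)
  have hsx2 : 100 ≤ √x := Real.le_sqrt_of_sq_le (by linarith)
  rw [hs4, hlx] at h4
  have h8 : √x * Real.log x ≤ √x * (1 / 1000 * √x) := by gcongr
  rw [hl4] at h5
  nlinarith

lemma prime_reciprocals_ge {ε : ℝ} (hε : 0 < ε) (hε1 : ε < 1) : ∀ᶠ y : ℝ in atTop,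
    ε / 8 ≤ ∑ p ∈ primesIoc (y ^ (1 - ε)) y, (1 : ℝ) / p := by
  obtain ⟨x₀, hx₀⟩ := eventually_atTop.1 eventually_log_sum_ge
  have h1 : Tendsto (fun y : ℝ => y ^ (1 - ε)) atTop atTop := tendsto_rpow_atTop (by linarith)
  filter_upwards [h1.eventually_ge_atTop x₀, eventually_ge_atTop 4,
    Real.tendsto_log_atTop.eventually_ge_atTop (8 / ε)] with y h2 h3 h4
  have hL : 0 < Real.log y := by have : 0 < 8 / ε := by positivity
                                 linarith
  have hy0 : 0 < y := by linarith
  set a := y ^ (1 - ε) with ha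
  have ha0 : 0 < a := by positivity
  have key : ∀ N : ℕ, 4 ^ N * a ≤ y →
      N / (4 * Real.log y) ≤ ∑ p ∈ primesIoc a (4 ^ N * a), (1 : ℝ) / p := by
    intro N
    induction N with
    | zero => intro _; simpa using Finset.sum_nonneg fun p _ => by positivity
    | succ N ih =>
      intro hN
      have h5 : (1 : ℝ) ≤ 4 ^ N := one_le_pow₀ (by norm_num)
      set x := 4 ^ N * a with hx
      have e : 4 ^ (N + 1) * a = 4 * x := by rw [hx, pow_succ]; ring
      rw [e] at hN ⊢
      have hxa : a ≤ x := by nlinarith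
      have hxp : 0 < x := by linarith
      have h6 := ih (by linarith)
      rw [← sum_primesIoc_add hxa (show x ≤ 4 * x by linarith)]
      have h7 := hx₀ x (by linarith)
      have h8 : (1 : ℝ) / (4 * Real.log y) ≤ ∑ p ∈ primesIoc x (4 * x), (1 : ℝ) / p := by
        calc (1 : ℝ) / (4 * Real.log y) = x * (1 / (4 * x * Real.log y)) := by field_simp
          _ ≤ (∑ p ∈ primesIoc x (4 * x), Real.log p) * (1 / (4 * x * Real.log y)) := by
              gcongr
          _ = ∑ p ∈ primesIoc x (4 * x), Real.log p * (1 / (4 * x * Real.log y)) := by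
              rw [Finset.sum_mul]
          _ ≤ _ := by
              refine Finset.sum_le_sum fun p hp => ?_
              rw [mem_primesIoc hxp.le (by linarith)] at hp
              have hp0 : (1 : ℝ) < p := by exact_mod_cast hp.1.one_lt
              have hlp : 0 < Real.log p := Real.log_pos hp0
              have hlpy : Real.log p ≤ Real.log y := Real.log_le_log (by linarith) (by linarith)
              rw [mul_one_div, div_le_div_iff₀ (by positivity) (by linarith)]
              nlinarith [hp.2.2]
      push_cast
      rw [add_div]
      linarith
  set N := ⌊ε * Real.log y / Real.log 4⌋₊ with hN
  have hl4 : 0 < Real.log 4 := Real.log_pos (by norm_num)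
  have hl4' : Real.log 4 < 1.4 := by
    rw [show (4 : ℝ) = 2 ^ 2 by norm_num, Real.log_pow]
    have := Real.log_two_lt_d9
    push_cast; linarith
  have h9 : (N : ℝ) ≤ ε * Real.log y / Real.log 4 := Nat.floor_le (by positivity)
  have h10 : ε * Real.log y / Real.log 4 < N + 1 := Nat.lt_floor_add_one _
  have h11 : (4 : ℝ) ^ N * a ≤ y := by
    have : (4 : ℝ) ^ N ≤ y ^ ε := by
      rw [← Real.rpow_natCast, Real.rpow_def_of_pos (by norm_num), Real.rpow_def_of_pos hy0]
      refine Real.exp_le_exp.2 ?_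
      rw [le_div_iff₀ hl4] at h9
      linarith
    calc (4 : ℝ) ^ N * a ≤ y ^ ε * a := by gcongr
      _ = y := by rw [ha, ← Real.rpow_add hy0]; simp
  refine le_trans ?_ ((key N h11).trans ?_)
  · rw [le_div_iff₀ (by positivity)]
    rw [div_lt_iff₀ hl4] at h10
    have h12 : 8 ≤ ε * Real.log y := by rwa [div_le_iff₀' hε] at h4
    nlinarith
  · refine Finset.sum_le_sum_of_subset_of_nonneg (fun p hp => ?_) fun _ _ _ => by positivity
    rw [mem_primesIoc ha0.le (by positivity)] at hp
    rw [mem_primesIoc ha0.le hy0.le]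
    exact ⟨hp.1, hp.2.1, hp.2.2.trans h11⟩

lemma smoothFS_mono {P R R' : ℝ} (h : R ≤ R') : smoothFS P R ⊆ smoothFS P R' := by
  intro n hn
  rw [smoothFS, Finset.mem_filter] at hn ⊢
  exact ⟨hn.1, fun p hp hpn => (hn.2 p hp hpn).trans h⟩

lemma half_div_le_div {P d : ℕ} (hd : 0 < d) (h : d ≤ P) :
    (P : ℝ) / 2 * (1 / d) ≤ (P / d : ℕ) := by
  have h1 : 1 ≤ P / d := (Nat.one_le_div_iff hd).2 h
  have h2 : P < d * (P / d + 1) := Nat.lt_mul_div_succ P hd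
  have h3 : P ≤ 2 * d * (P / d) := by nlinarith
  have h4 : (P : ℝ) ≤ 2 * d * (P / d : ℕ) := by exact_mod_cast h3
  have hd' : (0 : ℝ) < d := by exact_mod_cast hd
  rw [div_mul_div_comm, mul_one, div_le_iff₀ (by positivity)]
  linarith

lemma smooth_card_ge_of_le_half {η : ℝ} (hη : 0 < η) (hη1 : η ≤ 1 / 2) : ∃ κ : ℝ, 0 < κ ∧
    ∀ᶠ P : ℕ in atTop, κ * P ≤ (smoothFS P ((P : ℝ) ^ η)).card := by
  set J := ⌈1 / η⌉₊ with hJ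
  have hJ1 : 1 ≤ J := Nat.one_le_ceil_iff.2 (by positivity)
  have hJ0 : (0 : ℝ) < J := by exact_mod_cast hJ1
  have hJη : 1 / (J : ℝ) ≤ η := by
    rw [div_le_iff₀ hJ0, ← div_le_iff₀' hη]
    exact Nat.le_ceil _
  have htend : Tendsto (fun P : ℕ => (P : ℝ) ^ (1 / (J : ℝ))) atTop atTop :=
    (tendsto_rpow_atTop (by positivity)).comp tendsto_natCast_atTop_atTop
  refine ⟨(η / 8) ^ J / 2 / (2 * J) ^ J, by positivity, ?_⟩
  filter_upwards [htend.eventually (prime_reciprocals_ge hη (by linarith)),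
    eventually_ge_atTop 2] with P hrec hP
  have hP1 : (1 : ℝ) < P := by exact_mod_cast hP
  have hP0 : (0 : ℝ) < P := by linarith
  set y := (P : ℝ) ^ (1 / (J : ℝ)) with hy
  have hy1 : 1 ≤ y := Real.one_le_rpow hP1.le (by positivity)
  have hyJ : y ^ J = P := by
    rw [hy, ← Real.rpow_natCast, ← Real.rpow_mul hP0.le]; field_simp; simp
  set a := y ^ (1 - η) with ha
  have ha0 : 0 < a := by positivity
  have hya : y = a * y ^ η := by rw [ha, ← Real.rpow_add (by linarith)]; simp
  have hyJη : (y ^ η) ^ J = (P : ℝ) ^ η := by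
    rw [hy, ← Real.rpow_natCast, ← Real.rpow_mul hP0.le, ← Real.rpow_mul hP0.le]
    congr 1; field_simp
  set Pr := primesIoc a y with hPr
  have hmem : ∀ p, p ∈ Pr ↔ p.Prime ∧ a < p ∧ (p : ℝ) ≤ y := fun p =>
    mem_primesIoc ha0.le (by linarith)
  set T := Fintype.piFinset (fun _ : Fin J => Pr) with hT
  have hTpos : ∀ p ∈ T, 0 < ∏ i, p i := fun p hp =>
    Finset.prod_pos fun i _ => ((hmem _).1 (Fintype.mem_piFinset.1 hp i)).1.pos
  have hTle : ∀ p ∈ T, ((∏ i, p i : ℕ) : ℝ) ≤ P := fun p hp => by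
    push_cast
    calc ∏ i, (p i : ℝ) ≤ ∏ _i : Fin J, y := Finset.prod_le_prod (fun _ _ => by positivity)
          fun i _ => ((hmem _).1 (Fintype.mem_piFinset.1 hp i)).2.2
      _ = P := by simp [hyJ]
  have hTge : ∀ p ∈ T, a ^ J ≤ ((∏ i, p i : ℕ) : ℝ) := fun p hp => by
    push_cast
    calc a ^ J = ∏ _i : Fin J, a := by simp
      _ ≤ _ := Finset.prod_le_prod (fun _ _ => ha0.le)
          fun i _ => ((hmem _).1 (Fintype.mem_piFinset.1 hp i)).2.1.le
  set Z := T.sigma (fun p => Finset.Icc 1 (P / ∏ i, p i)) with hZ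
  set f : (Σ _ : Fin J → ℕ, ℕ) → ℕ := fun z => z.2 * ∏ i, z.1 i with hf
  have hcardZ : (η / 8) ^ J / 2 * P ≤ Z.card := by
    rw [hZ, Finset.card_sigma]
    push_cast
    simp_rw [Nat.card_Icc, Nat.add_sub_cancel]
    calc (η / 8) ^ J / 2 * P = (P : ℝ) / 2 * (η / 8) ^ J := by ring
      _ ≤ (P : ℝ) / 2 * (∑ p ∈ Pr, (1 : ℝ) / p) ^ J := by gcongr
      _ = (P : ℝ) / 2 * ∏ _i : Fin J, ∑ p ∈ Pr, (1 : ℝ) / p := by simp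
      _ = (P : ℝ) / 2 * ∑ p ∈ T, ∏ i, (1 : ℝ) / p i := by
          rw [Finset.prod_univ_sum]
      _ = ∑ p ∈ T, (P : ℝ) / 2 * ∏ i, (1 : ℝ) / p i := Finset.mul_sum _ _ _
      _ ≤ _ := by
          refine Finset.sum_le_sum fun p hp => ?_
          have := half_div_le_div (hTpos p hp) (by exact_mod_cast hTle p hp)
          push_cast at this
          simpa [Finset.prod_div_distrib] using this
  have hmaps : ∀ z ∈ Z, f z ∈ smoothFS P ((P : ℝ) ^ η) := by
    rintro ⟨p, m⟩ hz
    rw [hZ, Finset.mem_sigma, Finset.mem_Icc] at hz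
    obtain ⟨hp, hm1, hm2⟩ := hz
    have hd := hTpos p hp
    have h1 : m * ∏ i, p i ≤ P := (Nat.le_div_iff_mul_le hd).1 hm2
    rw [smoothFS, Nat.floor_natCast, Finset.mem_filter, Finset.mem_Icc]
    refine ⟨⟨Nat.mul_pos hm1 hd, h1⟩, fun q hq hqd => ?_⟩
    rcases (Nat.Prime.dvd_mul hq).1 hqd with h2 | h2
    · have h3 : (q : ℝ) ≤ m := by exact_mod_cast Nat.le_of_dvd hm1 h2
      refine h3.trans ?_
      have h4 : (m : ℝ) * a ^ J ≤ (y ^ η) ^ J * a ^ J := by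
        calc (m : ℝ) * a ^ J ≤ m * ((∏ i, p i : ℕ) : ℝ) := by
              gcongr; exact hTge p hp
          _ ≤ P := by exact_mod_cast h1
          _ = (y ^ η) ^ J * a ^ J := by rw [← mul_pow, mul_comm, ← hya, hyJ]
      rw [← hyJη]
      exact le_of_mul_le_mul_right h4 (by positivity)
    · obtain ⟨i, _, h3⟩ := (hq.prime.dvd_finsetProd_iff _).1 h2
      have h4 := (hmem _).1 (Fintype.mem_piFinset.1 hp i)
      rw [(Nat.prime_dvd_prime_iff_eq hq h4.1).1 h3]
      exact h4.2.2.trans (Real.rpow_le_rpow_of_exponent_le hP1.le hJη)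
  have hfib : ∀ n ∈ smoothFS P ((P : ℝ) ^ η), (Z.filter fun z => f z = n).card ≤ (2 * J) ^ J := by
    intro n hn
    rw [smoothFS, Nat.floor_natCast, Finset.mem_filter, Finset.mem_Icc] at hn
    set Q := Pr.filter fun p => p ∣ n with hQ
    have hQcard : Q.card ≤ 2 * J := by
      have h1 : ∏ q ∈ Q, q ∣ n := Finset.prod_primes_dvd n
        (fun q hq => ((hmem q).1 (Finset.mem_filter.1 hq).1).1.prime)
        (fun q hq => (Finset.mem_filter.1 hq).2)
      have h2 : ((∏ q ∈ Q, q : ℕ) : ℝ) ≤ P := by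
        exact_mod_cast (Nat.le_of_dvd (by omega) h1).trans hn.1.2
      have h3 : a ^ Q.card ≤ P := by
        refine le_trans ?_ h2
        push_cast
        rw [← Finset.prod_const]
        exact Finset.prod_le_prod (fun _ _ => ha0.le)
          fun q hq => ((hmem q).1 (Finset.mem_filter.1 hq).1).2.1.le
      have h4 : (P : ℝ) ^ ((1 - η) / J * Q.card) ≤ (P : ℝ) ^ (1 : ℝ) := by
        rw [Real.rpow_one]
        refine le_trans (le_of_eq ?_) h3
        rw [ha, hy, ← Real.rpow_natCast, ← Real.rpow_mul hP0.le, ← Real.rpow_mul hP0.le]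
        congr 1; ring
      rw [Real.rpow_le_rpow_left_iff hP1, div_mul_eq_mul_div, div_le_one hJ0] at h4
      have h5 : (Q.card : ℝ) ≤ 2 * J := by nlinarith [Nat.cast_nonneg (α := ℝ) Q.card]
      exact_mod_cast h5
    have h6 : (Z.filter fun z => f z = n).card ≤
        (Fintype.piFinset (fun _ : Fin J => Q)).card := by
      refine Finset.card_le_card_of_injOn (fun z => z.1) (fun z hz => ?_) ?_
      · have hz' := Finset.mem_filter.1 (Finset.mem_coe.1 hz)
        have hp := (Finset.mem_sigma.1 hz'.1).1
        rw [Finset.mem_coe, Fintype.mem_piFinset]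
        intro i
        rw [hQ, Finset.mem_filter]
        refine ⟨Fintype.mem_piFinset.1 hp i, ?_⟩
        rw [← hz'.2, hf]
        exact Dvd.dvd.mul_left (Finset.dvd_prod_of_mem _ (Finset.mem_univ i)) _
      · rintro ⟨p, m⟩ hz ⟨p', m'⟩ hz' h
        have h1 := Finset.mem_filter.1 (Finset.mem_coe.1 hz)
        have h2 := Finset.mem_filter.1 (Finset.mem_coe.1 hz')
        simp only at h
        subst h
        have h3 := h1.2.trans h2.2.symm
        have hp := (Finset.mem_sigma.1 h1.1).1
        rw [hf] at h3
        simp only at h3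
        rw [Nat.eq_of_mul_eq_mul_right (hTpos p hp) h3]
    refine h6.trans ?_
    rw [Fintype.card_piFinset]
    simp only [Finset.prod_const, Finset.card_univ, Fintype.card_fin]
    exact Nat.pow_le_pow_left hQcard J
  have h7 := Finset.card_le_mul_card_image_of_maps_to hmaps ((2 * J) ^ J) hfib
  have h8 : (Z.card : ℝ) ≤ (2 * J) ^ J * (smoothFS P ((P : ℝ) ^ η)).card := by exact_mod_cast h7
  rw [div_mul_eq_mul_div, div_le_iff₀ (by positivity)]
  linarith

/-- The sets `A P ⊆ [1, P]` are asymptotically equidistributed in intervals and residue classes,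
with densities bounded below. -/
def Equi (A : ℕ → Finset ℕ) : Prop :=
  (∀ P, A P ⊆ Finset.Icc 1 P) ∧ ∃ D : ℕ → ℝ, ∃ κ : ℝ, 0 < κ ∧ (∀ᶠ P in atTop, κ ≤ D P) ∧
    ∀ ε : ℝ, 0 < ε → ∀ q : ℕ, 0 < q → ∀ᶠ P : ℕ in atTop, ∀ x ≤ P, ∀ b : ℕ,
      |(((A P).filter fun n => n ≤ x ∧ n ≡ b [MOD q]).card : ℝ) - D P * x / q| ≤ ε * P

lemma equi_smooth {η : ℝ} (hη : 0 < η) : Equi fun P => smoothFS P ((P : ℝ) ^ η) := by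
  refine ⟨fun P => by
      change smoothFS P ((P : ℝ) ^ η) ⊆ _
      rw [smoothFS, Nat.floor_natCast]; exact Finset.filter_subset _ _,
    fun P => smoothDensity P ((P : ℝ) ^ η), ?_⟩
  obtain ⟨κ, hκ, h⟩ := smooth_card_ge_of_le_half (lt_min hη (show (0 : ℝ) < 1 / 2 by norm_num))
    (min_le_right _ _)
  refine ⟨κ / 2, half_pos hκ, ?_, fun ε hε q hq => smooth_equidistribution hη hε hq⟩
  filter_upwards [h, smooth_equidistribution hη (half_pos hκ) one_pos, eventually_ge_atTop 1] with
    P h1 h2 h3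
  have h4 := h2 P le_rfl 0
  have h5 : ((smoothFS P ((P : ℝ) ^ η)).filter fun n => n ≤ P ∧ n ≡ 0 [MOD 1]) =
      smoothFS P ((P : ℝ) ^ η) := by
    refine Finset.filter_true_of_mem fun n hn => ⟨?_, Nat.modEq_one⟩
    rw [smoothFS, Nat.floor_natCast, Finset.mem_filter, Finset.mem_Icc] at hn
    exact hn.1.2
  rw [h5] at h4
  have hP : (1 : ℝ) ≤ P := by exact_mod_cast h3
  have h6 : ((smoothFS P ((P : ℝ) ^ (min η (1 / 2)))).card : ℝ) ≤
      (smoothFS P ((P : ℝ) ^ η)).card := by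
    exact_mod_cast Finset.card_le_card
      (smoothFS_mono (Real.rpow_le_rpow_of_exponent_le hP (min_le_left _ _)))
  have h7 := (abs_le.1 h4).2
  rw [Nat.cast_one, div_one] at h7
  refine le_of_mul_le_mul_right (a := (P : ℝ)) ?_ (by linarith)
  linarith

lemma equi_complete : Equi fun P => Finset.Icc 1 P := by
  refine ⟨fun P => subset_rfl, fun _ => 1, 1, one_pos, Eventually.of_forall fun _ => le_rfl, ?_⟩
  intro ε hε q hq
  filter_upwards [(tendsto_natCast_atTop_atTop.const_mul_atTop hε).eventually_ge_atTop 1] with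
    P hP x hx b
  refine le_trans ?_ hP
  have h1 := abs_card_modEq_sub_le hq x b
  have h2 : ((Finset.Icc 1 P).filter fun n => n ≤ x ∧ n ≡ b [MOD q]) =
      ((Finset.Icc 1 x).filter fun n => n ≡ b [MOD q]) := by
    ext n
    simp only [Finset.mem_filter, Finset.mem_Icc]
    constructor
    · rintro ⟨⟨h1, h2⟩, h3, h4⟩; exact ⟨⟨h1, h3⟩, h4⟩
    · rintro ⟨⟨h1, h3⟩, h4⟩; exact ⟨⟨h1, h3.trans hx⟩, h3, h4⟩
  rw [h2, one_mul]
  exact h1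

lemma card_le_card_ker_mul {G H : Type*} [AddGroup G] [AddGroup H] [Finite G] [Finite H]
    (f : G →+ H) : Nat.card G ≤ Nat.card f.ker * Nat.card H := by
  rw [← AddSubgroup.card_mul_index f.ker, AddSubgroup.index_ker]
  exact Nat.mul_le_mul_left _ (Nat.card_le_card_of_injective _ f.range.subtype_injective)

lemma card_ker_mul_natCast_le {Q : ℕ} [NeZero Q] (m : ℕ) (hm : 0 < m) (s : ℕ) (v : Fin s → ZMod Q) :
    Nat.card {z : Fin s → ZMod Q // (fun j => (m : ZMod Q) * z j) = v} ≤ m ^ s := by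
  have h1 : Nat.card {z : ZMod Q // (m : ZMod Q) * z = 0} ≤ m := by
    have := ZMod.card Q
    let φ : {z : ZMod Q // (m : ZMod Q) * z = 0} → Fin m := fun z =>
      ⟨m * z.1.val / Q, by
        have h2 := ZMod.val_lt z.1
        rw [Nat.div_lt_iff_lt_mul (NeZero.pos Q)]
        exact Nat.mul_lt_mul_of_pos_left h2 hm⟩
    have hφ : Function.Injective φ := by
      rintro ⟨z, hz⟩ ⟨w, hw⟩ h
      have h3 : m * z.val / Q = m * w.val / Q := congrArg Fin.val h
      have hd : ∀ z : ZMod Q, (m : ZMod Q) * z = 0 → Q ∣ m * z.val := by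
        intro z hz
        rw [← ZMod.natCast_eq_zero_iff]
        push_cast
        rw [ZMod.natCast_zmod_val, hz]
      have h4 : m * z.val = m * w.val := by
        rw [← Nat.div_mul_cancel (hd z hz), h3, Nat.div_mul_cancel (hd w hw)]
      have h5 : z.val = w.val := Nat.eq_of_mul_eq_mul_left hm h4
      exact Subtype.ext (ZMod.val_injective Q h5)
    have := Nat.card_le_card_of_injective φ hφ
    simpa using this
  by_cases hne : Nonempty {z : Fin s → ZMod Q // (fun j => (m : ZMod Q) * z j) = v}
  · obtain ⟨z₀, hz₀⟩ := hne
    let φ : {z : Fin s → ZMod Q // (fun j => (m : ZMod Q) * z j) = v} →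
        (Fin s → {z : ZMod Q // (m : ZMod Q) * z = 0}) := fun z j =>
      ⟨z.1 j - z₀ j, by
        rw [mul_sub, sub_eq_zero]
        exact (congrFun z.2 j).trans (congrFun hz₀ j).symm⟩
    have hφ : Function.Injective φ := by
      rintro ⟨z, hz⟩ ⟨w, hw⟩ h
      apply Subtype.ext
      funext j
      have := congrArg Subtype.val (congrFun h j)
      exact sub_left_injective this
    refine (Nat.card_le_card_of_injective φ hφ).trans ?_
    rw [Nat.card_fun, Nat.card_fin]
    exact Nat.pow_le_pow_left h1 s
  · rw [not_nonempty_iff] at hne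
    rw [Nat.card_eq_zero.2 (Or.inl hne)]
    exact Nat.zero_le _

section density
variable {t : ℕ} {ν μ : Fin t → ℕ} {k : (l : Fin t) → Fin (ν l) → ℕ} {s : ℕ}
  {c : EqIdx t ν μ → Fin s → ℤ}

variable (k c) in
/-- Number of solutions of the system modulo `Q`. -/
def zsol (Q : ℕ) : ℕ := Nat.card {x : Fin s → ZMod Q // IsSol t ν μ k s c x}

variable (k c) in
/-- The Jacobian matrix of the system. -/
def jac {A : Type*} [CommRing A] (x : Fin s → A) : Matrix (EqIdx t ν μ) (Fin s) A :=
  Matrix.of fun i j => (deg t ν μ k i : A) * (c i j : A) * x j ^ (deg t ν μ k i - 1)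

lemma exists_right_inverse {A : Type*} [Field A] {x : Fin s → A}
    (h : JacFullRank t ν μ k s c x) : ∃ T : Matrix (Fin s) (EqIdx t ν μ) A, jac k c x * T = 1 := by
  rw [← Matrix.mulVec_surjective_iff_exists_right_inverse]
  have h1 : (jac k c x).rank = Fintype.card (EqIdx t ν μ) := h
  rw [Matrix.rank] at h1
  have h2 : (jac k c x).mulVecLin.range = ⊤ :=
    Submodule.eq_top_of_finrank_eq (by rw [h1, Module.finrank_fintype_fun_eq_card])
  exact LinearMap.range_eq_top.1 h2

/-- A solution scaled by a unit `u` is a solution whose Jacobian still has a right inverse. -/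
lemma scale_solution {A : Type*} [Field A] {x : Fin s → A} (hx : IsSol t ν μ k s c x)
    {T : Matrix (Fin s) (EqIdx t ν μ) A} (hT : jac k c x * T = 1) {u : A} (hu : u ≠ 0) :
    IsSol t ν μ k s c (fun j => u * x j) ∧
      ∃ T' : Matrix (Fin s) (EqIdx t ν μ) A, jac k c (fun j => u * x j) * T' = 1 := by
  constructor
  · intro i
    have := hx i
    simp_rw [mul_pow]
    calc _ = u ^ deg t ν μ k i * ∑ j, (c i j : A) * x j ^ deg t ν μ k i := by
          rw [Finset.mul_sum]; exact Finset.sum_congr rfl fun j _ => by ring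
      _ = 0 := by rw [this, mul_zero]
  · refine ⟨Matrix.of fun j i => T j i * (u ^ (deg t ν μ k i - 1))⁻¹, ?_⟩
    ext i i'
    have h1 := congrFun (congrFun hT i) i'
    rw [Matrix.mul_apply] at h1 ⊢
    simp only [jac, Matrix.of_apply, mul_pow] at h1 ⊢
    calc _ = u ^ (deg t ν μ k i - 1) * (u ^ (deg t ν μ k i' - 1))⁻¹ *
          ∑ j, (deg t ν μ k i : A) * (c i j : A) * x j ^ (deg t ν μ k i - 1) * T j i' := by
          rw [Finset.mul_sum]; exact Finset.sum_congr rfl fun j _ => by ring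
      _ = _ := by
          rw [h1]
          by_cases h : i = i'
          · subst h; simp [pow_ne_zero _ hu]
          · simp [h]

lemma local_count {p : ℕ} [hp : Fact p.Prime] {y : Fin s → ℤ_[p]} (hy : IsSol t ν μ k s c y)
    {a : ℕ} {T : Matrix (Fin s) (EqIdx t ν μ) ℤ_[p]}
    (hT : jac k c y * T = (p : ℤ_[p]) ^ a • 1) (e : ℕ) :
    (p ^ e) ^ s ≤ (p ^ (a + 1)) ^ s * ((p ^ e) ^ Fintype.card (EqIdx t ν μ) * zsol k c (p ^ e)) := by
  set φ := PadicInt.toZModPow (p := p) e with hφ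
  have : NeZero (p ^ e) := ⟨pow_ne_zero _ hp.1.ne_zero⟩
  have hex : ∀ (i : EqIdx t ν μ) (j : Fin s), ∃ q : Polynomial ℤ_[p],
      (Polynomial.C (y j) + Polynomial.C ((p : ℤ_[p]) ^ (a + 1)) * Polynomial.X) ^ deg t ν μ k i =
        Polynomial.C (y j) ^ deg t ν μ k i + ((deg t ν μ k i : ℕ) : Polynomial ℤ_[p]) *
          Polynomial.C (y j) ^ (deg t ν μ k i - 1) * (Polynomial.C ((p : ℤ_[p]) ^ (a + 1)) * Polynomial.X) +
            q * (Polynomial.C ((p : ℤ_[p]) ^ (a + 1)) * Polynomial.X) ^ 2 :=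
    fun i j => ⟨_, (Polynomial.powAddExpansion _ _ _).2⟩
  choose g hg using hex
  set G : EqIdx t ν μ → (Fin s → ZMod (p ^ e)) → ZMod (p ^ e) := fun i z =>
    ∑ j, (c i j : ZMod (p ^ e)) * (((g i j * Polynomial.X ^ 2).map φ).eval (z j)) with hG
  set Φ : (Fin s → ZMod (p ^ e)) → (Fin s → ZMod (p ^ e)) := fun z j =>
    z j + p * ∑ i, φ (T j i) * G i z with hΦ
  have hpe : (p : ZMod (p ^ e)) ^ e = 0 := by exact_mod_cast ZMod.natCast_self (p ^ e)
  have hinj : Function.Injective Φ := by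
    intro z z' h
    have key : ∀ n, ∀ j, (p : ZMod (p ^ e)) ^ n ∣ z j - z' j := by
      intro n
      induction n with
      | zero => simp
      | succ n ih =>
        have hGd : ∀ i, (p : ZMod (p ^ e)) ^ n ∣ G i z' - G i z := by
          intro i
          rw [hG]
          simp only
          rw [← Finset.sum_sub_distrib]
          refine Finset.dvd_sum fun j _ => ?_
          rw [← mul_sub]
          refine Dvd.dvd.mul_left (dvd_trans ?_ (Polynomial.sub_dvd_eval_sub _ _ _)) _
          rw [← neg_sub, dvd_neg]
          exact ih j
        intro j
        have h1 := congrFun h j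
        simp only [hΦ] at h1
        have h2 : z j - z' j = p * ∑ i, φ (T j i) * (G i z' - G i z) := by
          simp_rw [mul_sub, Finset.sum_sub_distrib]
          linear_combination h1
        rw [h2, pow_succ']
        exact mul_dvd_mul_left _ (Finset.dvd_sum fun i _ => Dvd.dvd.mul_left (hGd i) _)
    funext j
    have := key e j
    rw [hpe, zero_dvd_iff] at this
    exact sub_eq_zero.1 this
  have hbij : Function.Bijective Φ := Finite.injective_iff_bijective.1 hinj
  -- the linear map given by the Jacobian
  let L : (Fin s → ZMod (p ^ e)) →+ (EqIdx t ν μ → ZMod (p ^ e)) :=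
    ((jac k c y).map φ).mulVecLin.toAddMonoidHom
  have hLa : ∀ w i, L w i = ∑ j, φ (jac k c y i j) * w j := fun w i => rfl
  have hF : ∀ z : Fin s → ZMod (p ^ e), ∀ i,
      ∑ j, (c i j : ZMod (p ^ e)) * (φ (y j) + (p ^ (a + 1) : ℕ) * z j) ^ deg t ν μ k i =
        p ^ (a + 1) * L (Φ z) i := by
    intro z i
    have h1 : ∀ j, (φ (y j) + (p ^ (a + 1) : ℕ) * z j) ^ deg t ν μ k i =
        φ (y j) ^ deg t ν μ k i + deg t ν μ k i * φ (y j) ^ (deg t ν μ k i - 1) *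
          (p ^ (a + 1) * z j) + p ^ (a + 1) * p ^ (a + 1) *
            ((g i j * Polynomial.X ^ 2).map φ).eval (z j) := by
      intro j
      have h2 := congrArg (fun q : Polynomial ℤ_[p] => (q.map φ).eval (z j)) (hg i j)
      simp only [Polynomial.map_natCast, Polynomial.map_add, Polynomial.map_pow,
        Polynomial.map_mul, Polynomial.map_C,
        Polynomial.map_X, Polynomial.eval_add, Polynomial.eval_pow, Polynomial.eval_mul,
        Polynomial.eval_C, Polynomial.eval_X, map_pow, map_natCast,
        Polynomial.eval_natCast] at h2 ⊢
      push_cast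
      rw [h2]
      ring
    have h0 : ∑ j, (c i j : ZMod (p ^ e)) * φ (y j) ^ deg t ν μ k i = 0 := by
      have := congrArg φ (hy i)
      simpa using this
    have hT' : ∀ i', ∑ j, φ (jac k c y i j) * φ (T j i') =
        if i = i' then (p : ZMod (p ^ e)) ^ a else 0 := by
      intro i'
      have h3 := congrArg φ (congrFun (congrFun hT i) i')
      rw [Matrix.mul_apply, map_sum] at h3
      simp only [map_mul] at h3
      rw [h3, Matrix.smul_apply, Matrix.one_apply]
      split_ifs <;> simp
    have h4 : L (Φ z) i = ∑ j, φ (jac k c y i j) * z j + p * (p ^ a * G i z) := by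
      rw [hLa]
      simp only [hΦ, mul_add, Finset.sum_add_distrib]
      congr 1
      calc _ = p * ∑ i', (∑ j, φ (jac k c y i j) * φ (T j i')) * G i' z := by
            simp_rw [Finset.mul_sum, Finset.sum_mul, Finset.mul_sum]
            rw [Finset.sum_comm]
            exact Finset.sum_congr rfl fun _ _ => Finset.sum_congr rfl fun _ _ => by ring
        _ = _ := by simp_rw [hT']; simp
    rw [h4]
    simp_rw [h1, mul_add, Finset.sum_add_distrib]
    rw [h0, zero_add, hG]
    simp only [Finset.mul_sum]
    congr 1
    · refine Finset.sum_congr rfl fun j _ => ?_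
      simp only [jac, Matrix.of_apply, map_mul, map_natCast, map_intCast, map_pow]
      ring
    · refine Finset.sum_congr rfl fun j _ => ?_
      ring
  have h1 : (p ^ e) ^ s ≤ Nat.card L.ker * (p ^ e) ^ Fintype.card (EqIdx t ν μ) := by
    have := card_le_card_ker_mul L
    rwa [Nat.card_fun, Nat.card_fun, Nat.card_zmod, Nat.card_fin,
      Nat.card_eq_fintype_card (α := EqIdx t ν μ)] at this
  let ψ : L.ker → {x : Fin s → ZMod (p ^ e) // IsSol t ν μ k s c x} := fun w =>
    ⟨fun j => φ (y j) + (p ^ (a + 1) : ℕ) * ((Equiv.ofBijective Φ hbij).symm w.1) j, fun i => by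
      rw [hF]
      have h2 : Φ ((Equiv.ofBijective Φ hbij).symm w.1) = w.1 :=
        (Equiv.ofBijective Φ hbij).apply_symm_apply w.1
      rw [h2, (AddMonoidHom.mem_ker).1 w.2]; simp⟩
  have h2 : Nat.card L.ker ≤ (p ^ (a + 1)) ^ s * zsol k c (p ^ e) := by
    have := Fintype.ofFinite L.ker
    have := Fintype.ofFinite {x : Fin s → ZMod (p ^ e) // IsSol t ν μ k s c x}
    rw [zsol, Nat.card_eq_fintype_card, Nat.card_eq_fintype_card]
    refine Finset.card_le_mul_card_image_of_maps_to (f := ψ) (fun _ _ => Finset.mem_univ _) _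
      fun b _ => ?_
    have h3 := card_ker_mul_natCast_le (Q := p ^ e) (p ^ (a + 1)) (pow_pos hp.1.pos _) s
      (fun j => b.1 j - φ (y j))
    refine le_trans ?_ h3
    rw [← Fintype.card_subtype, ← Nat.card_eq_fintype_card]
    refine Nat.card_le_card_of_injective
      (fun w => ⟨(Equiv.ofBijective Φ hbij).symm w.1.1, ?_⟩) ?_
    · funext j
      have := congrFun (congrArg Subtype.val w.2) j
      simp only [ψ] at this
      rw [← this]; ring
    · intro w w' h
      have := congrArg Subtype.val h
      exact Subtype.ext (Subtype.ext ((Equiv.ofBijective Φ hbij).symm.injective this))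
  calc _ ≤ _ := h1
    _ ≤ ((p ^ (a + 1)) ^ s * zsol k c (p ^ e)) * (p ^ e) ^ Fintype.card (EqIdx t ν μ) := by gcongr
    _ = _ := by ring

end density

section density
variable {t : ℕ} {ν μ : Fin t → ℕ} {k : (l : Fin t) → Fin (ν l) → ℕ} {s : ℕ}
  {c : EqIdx t ν μ → Fin s → ℤ}

lemma exists_pow_mul_integral {p : ℕ} [Fact p.Prime] {ι : Type*} [Finite ι] (x : ι → ℚ_[p]) :
    ∃ n : ℕ, ∃ y : ι → ℤ_[p], ∀ i, (y i : ℚ_[p]) = (p : ℚ_[p]) ^ n * x i := by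
  have := Fintype.ofFinite ι
  have h1 : ∀ i, ∃ n : ℕ, ‖(p : ℚ_[p]) ^ n * x i‖ ≤ 1 := by
    intro i
    have hp1 : ‖(p : ℚ_[p])‖ < 1 := Padic.norm_p_lt_one
    have h := (tendsto_pow_atTop_nhds_zero_of_lt_one (norm_nonneg _) hp1).mul_const ‖x i‖
    rw [zero_mul] at h
    obtain ⟨n, hn⟩ := (h.eventually (gt_mem_nhds one_pos)).exists
    exact ⟨n, by rw [norm_mul, norm_pow]; exact hn.le⟩
  choose n hn using h1
  have h2 : ∀ i, ‖(p : ℚ_[p]) ^ (∑ i, n i) * x i‖ ≤ 1 := by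
    intro i
    rw [← Finset.sum_erase_add _ _ (Finset.mem_univ i), pow_add, mul_assoc, norm_mul, norm_pow]
    exact mul_le_one₀ (pow_le_one₀ (norm_nonneg _) Padic.norm_p_lt_one.le) (norm_nonneg _)
      (hn i)
  exact ⟨∑ i, n i, fun i => ⟨_, h2 i⟩, fun i => rfl⟩

lemma local_density {p : ℕ} [hp : Fact p.Prime] {x : Fin s → ℚ_[p]} (hx : IsSol t ν μ k s c x)
    (hJ : JacFullRank t ν μ k s c x) : ∃ κ : ℝ, 0 < κ ∧ ∀ e : ℕ,
      κ * ((p : ℝ) ^ e) ^ s ≤ ((p : ℝ) ^ e) ^ Fintype.card (EqIdx t ν μ) * zsol k c (p ^ e) := by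
  have hp0 : (p : ℚ_[p]) ≠ 0 := by exact_mod_cast hp.1.ne_zero
  obtain ⟨T, hT⟩ := exists_right_inverse hJ
  obtain ⟨n, y, hy⟩ := exists_pow_mul_integral x
  obtain ⟨hs, T', hT'⟩ := scale_solution hx hT (pow_ne_zero n hp0)
  simp_rw [← hy] at hs hT'
  obtain ⟨a, U, hU⟩ := exists_pow_mul_integral fun q : Fin s × EqIdx t ν μ => T' q.1 q.2
  have hy' : IsSol t ν μ k s c y := by
    intro i
    have := hs i
    apply PadicInt.ext
    rw [PadicInt.coe_sum]
    push_cast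
    exact this
  have hU' : jac k c y * (Matrix.of fun j i => U (j, i)) = (p : ℤ_[p]) ^ a • 1 := by
    ext i i'
    have h1 := congrFun (congrFun hT' i) i'
    rw [Matrix.mul_apply] at h1 ⊢
    simp only [jac, Matrix.of_apply, Matrix.smul_apply, Matrix.one_apply, smul_eq_mul] at h1 ⊢
    apply PadicInt.ext
    rw [PadicInt.coe_sum]
    push_cast
    simp_rw [hU]
    have h2 := congrArg (fun z => (p : ℚ_[p]) ^ a * z) h1
    simp only [Finset.mul_sum] at h2
    simp_rw [mul_left_comm _ ((p : ℚ_[p]) ^ a)]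
    rw [h2]
    split_ifs <;> simp
  refine ⟨(((p : ℝ) ^ (a + 1)) ^ s)⁻¹, by have := hp.1.pos; positivity, fun e => ?_⟩
  have h3 := local_count hy' hU' e
  have h4 : (0 : ℝ) < ((p : ℝ) ^ (a + 1)) ^ s := by have := hp.1.pos; positivity
  rw [inv_mul_le_iff₀ h4]
  exact_mod_cast h3

lemma zsol_mul {m n : ℕ} (h : m.Coprime n) : zsol k c (m * n) = zsol k c m * zsol k c n := by
  rw [zsol, zsol, zsol, ← Nat.card_prod]
  set φ := ZMod.chineseRemainder h
  have key : ∀ x : Fin s → ZMod (m * n), IsSol t ν μ k s c x ↔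
      IsSol t ν μ k s c (fun j => (φ (x j)).1) ∧ IsSol t ν μ k s c (fun j => (φ (x j)).2) := by
    intro x
    simp only [IsSol, ← forall_and]
    refine forall_congr' fun i => ?_
    rw [← φ.injective.eq_iff, map_zero, Prod.ext_iff]
    simp only [map_sum, map_mul, map_pow, map_intCast, Prod.fst_sum, Prod.snd_sum, Prod.fst_mul,
      Prod.snd_mul, Prod.pow_fst, Prod.pow_snd, Prod.fst_intCast, Prod.snd_intCast, Prod.fst_zero,
      Prod.snd_zero]
  refine Nat.card_congr
    { toFun := fun x => (⟨_, ((key x.1).1 x.2).1⟩, ⟨_, ((key x.1).1 x.2).2⟩)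
      invFun := fun p => ⟨fun j => φ.symm (p.1.1 j, p.2.1 j), ?_⟩
      left_inv := ?_
      right_inv := ?_ }
  · rw [key]
    simp only [RingEquiv.apply_symm_apply]
    exact ⟨p.1.2, p.2.2⟩
  · intro x
    apply Subtype.ext
    funext j
    simp
  · rintro ⟨p, q⟩
    apply Prod.ext <;> apply Subtype.ext <;> funext j <;> simp

variable (k c) in
/-- The normalised number of solutions modulo `Q`. -/
def chi (Q : ℕ) : ℝ := (Q : ℝ) ^ Fintype.card (EqIdx t ν μ) * zsol k c Q / (Q : ℝ) ^ s

lemma chi_nonneg (Q : ℕ) : 0 ≤ chi k c Q := by unfold chi; positivity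

lemma chi_mul {m n : ℕ} (h : m.Coprime n) : chi k c (m * n) = chi k c m * chi k c n := by
  simp only [chi, zsol_mul h]
  push_cast
  rw [mul_pow, mul_pow]
  ring

lemma chi_one : chi k c 1 = 1 := by
  have : zsol k c 1 = 1 := by
    rw [zsol, Nat.card_eq_one_iff_unique]
    refine ⟨⟨fun a b => Subtype.ext (Subsingleton.elim _ _)⟩, ⟨⟨0, fun i => Subsingleton.elim _ _⟩⟩⟩
  simp [chi, this]

/-- The part of the local density supported on primes of a fixed set is bounded below. -/
lemma chi_primes_lower (hpadic : ∀ p : ℕ, ∀ _ : Fact p.Prime, ∃ x : Fin s → ℚ_[p],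
      IsSol t ν μ k s c x ∧ JacFullRank t ν μ k s c x) (S : Finset ℕ) :
    ∃ κ : ℝ, 0 < κ ∧ ∀ Q : ℕ, Q ≠ 0 → (∀ p, p.Prime → p ∣ Q → p ∈ S) → κ ≤ chi k c Q := by
  induction S using Finset.induction_on with
  | empty =>
    refine ⟨1, one_pos, fun Q hQ h => ?_⟩
    have : Q = 1 := by
      by_contra hne
      obtain ⟨p, hp, hpQ⟩ := Nat.exists_prime_and_dvd hne
      exact Finset.notMem_empty _ (h p hp hpQ)
    rw [this, chi_one]
  | insert p S hpS ih =>
    obtain ⟨κ, hκ, h⟩ := ih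
    by_cases hp : p.Prime
    · have hf : Fact p.Prime := ⟨hp⟩
      obtain ⟨x, hx, hJ⟩ := hpadic p hf
      obtain ⟨κ', hκ', h'⟩ := local_density hx hJ
      refine ⟨κ' * κ, by positivity, fun Q hQ hS => ?_⟩
      obtain ⟨e, m, hpm, rfl⟩ := Nat.exists_eq_pow_mul_and_not_dvd hQ p hp.ne_one
      have hcop : (p ^ e).Coprime m := Nat.Coprime.pow_left _ ((hp.coprime_iff_not_dvd).2 hpm)
      rw [chi_mul hcop]
      have h1 : κ' ≤ chi k c (p ^ e) := by
        have hpp : (0 : ℝ) < ((p : ℝ) ^ e) ^ s := by have := hp.pos; positivity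
        rw [chi, le_div_iff₀ (by exact_mod_cast hpp)]
        exact_mod_cast h' e
      have h2 : κ ≤ chi k c m := by
        refine h m (fun h0 => hpm (h0 ▸ dvd_zero p)) fun q hq hqm => ?_
        rcases Finset.mem_insert.1 (hS q hq (Dvd.dvd.mul_left hqm _)) with rfl | h3
        · exact absurd hqm hpm
        · exact h3
      exact mul_le_mul h1 h2 hκ.le (chi_nonneg _)
    · refine ⟨κ, hκ, fun Q hQ hS => h Q hQ fun q hq hqQ => ?_⟩
      rcases Finset.mem_insert.1 (hS q hq hqQ) with rfl | h3
      · exact absurd hq hp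
      · exact h3

end density

/-- Slowly varying weights are equidistributed over the residue classes. -/
lemma weighted_equidistribution {A : ℕ → Finset ℕ} (hA : Equi A) {q : ℕ} (hq : 0 < q) {Λ ε : ℝ}
    (hΛ : 0 ≤ Λ) (hε : 0 < ε) : ∀ᶠ P : ℕ in atTop, ∀ φ : ℕ → ℂ, (∀ x, ‖φ x‖ ≤ 1) →
      (∀ x < P, ‖φ (x + 1) - φ x‖ ≤ Λ / P) → ∀ b : ℕ,
        ‖∑ x ∈ (A P).filter (fun n => n ≡ b [MOD q]), φ x - (q : ℂ)⁻¹ * ∑ x ∈ A P, φ x‖ ≤ ε * P := by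
  obtain ⟨hsub, D, κ, hκ, hD, h⟩ := hA
  set δ := ε / (2 * (1 + Λ)) with hδ
  have hδ0 : 0 < δ := by positivity
  filter_upwards [h δ hδ0 q hq, h δ hδ0 1 one_pos, eventually_gt_atTop 0] with P h1 h2 hP φ hφ hφ' b
  have hP0 : (0 : ℝ) < P := by exact_mod_cast hP
  set g : ℕ → ℂ := fun n => (if n ∈ A P ∧ n ≡ b [MOD q] then 1 else 0) -
    (q : ℂ)⁻¹ * if n ∈ A P then 1 else 0 with hg
  have hmem : ∀ n ∈ A P, n ∈ range (P + 1) := fun n hn => by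
    have := Finset.mem_Icc.1 (hsub P hn)
    exact Finset.mem_range.2 (by omega)
  have hsum : ∑ x ∈ (A P).filter (fun n => n ≡ b [MOD q]), φ x - (q : ℂ)⁻¹ * ∑ x ∈ A P, φ x =
      ∑ x ∈ range (P + 1), φ x • g x := by
    simp only [hg, smul_eq_mul, mul_sub, Finset.sum_sub_distrib]
    congr 1
    · simp only [mul_ite, mul_one, mul_zero]
      rw [← Finset.sum_filter]
      refine Finset.sum_congr ?_ fun _ _ => rfl
      ext n
      simp only [Finset.mem_filter]
      exact ⟨fun hn => ⟨hmem n hn.1, hn⟩, fun hn => hn.2⟩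
    · rw [Finset.mul_sum]
      simp only [mul_ite, mul_one, mul_zero]
      rw [← Finset.sum_filter]
      refine Finset.sum_congr ?_ fun _ _ => mul_comm _ _
      ext n
      simp only [Finset.mem_filter]
      exact ⟨fun hn => ⟨hmem n hn, hn⟩, fun hn => hn.2⟩
  have hG : ∀ x ≤ P, ‖∑ n ∈ range (x + 1), g n‖ ≤ 2 * δ * P := by
    intro x hx
    have e1 : ∑ n ∈ range (x + 1), g n =
        (((#((A P).filter fun n => n ≤ x ∧ n ≡ b [MOD q]) : ℝ) - D P * x / q : ℝ) : ℂ) -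
          (q : ℂ)⁻¹ * (((#((A P).filter fun n => n ≤ x ∧ n ≡ 0 [MOD 1]) : ℝ) -
            D P * x / (1 : ℕ) : ℝ) : ℂ) := by
      have e2 : ∑ n ∈ range (x + 1), (if n ∈ A P ∧ n ≡ b [MOD q] then (1 : ℂ) else 0) =
          (#((A P).filter fun n => n ≤ x ∧ n ≡ b [MOD q]) : ℂ) := by
        rw [← Finset.sum_filter, Finset.sum_const, nsmul_eq_mul, mul_one]
        congr 2
        ext n
        simp only [Finset.mem_filter, Finset.mem_range, Nat.lt_succ_iff]
        tauto
      have e3 : ∑ n ∈ range (x + 1), (if n ∈ A P then (1 : ℂ) else 0) =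
          (#((A P).filter fun n => n ≤ x ∧ n ≡ 0 [MOD 1]) : ℂ) := by
        rw [← Finset.sum_filter, Finset.sum_const, nsmul_eq_mul, mul_one]
        congr 2
        ext n
        simp only [Finset.mem_filter, Finset.mem_range, Nat.lt_succ_iff, Nat.modEq_one, and_true]
        tauto
      simp only [hg, Finset.sum_sub_distrib, ← Finset.mul_sum]
      rw [e2, e3]
      push_cast
      ring
    rw [e1]
    have b1 := h1 x hx b
    have b2 := h2 x hx 0
    refine (norm_sub_le _ _).trans ?_
    rw [norm_mul, Complex.norm_real, Complex.norm_real, Real.norm_eq_abs, Real.norm_eq_abs, norm_inv,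
      Complex.norm_natCast]
    have hq1 : (q : ℝ)⁻¹ ≤ 1 := inv_le_one_of_one_le₀ (by exact_mod_cast hq)
    have := mul_le_mul hq1 b2 (abs_nonneg _) zero_le_one
    linarith
  rw [hsum, Finset.sum_range_by_parts]
  simp only [Nat.add_sub_cancel, smul_eq_mul]
  refine (norm_sub_le _ _).trans ?_
  have t1 : ‖φ P * ∑ i ∈ range (P + 1), g i‖ ≤ 1 * (2 * δ * P) := by
    rw [norm_mul]
    exact mul_le_mul (hφ P) (hG P le_rfl) (norm_nonneg _) zero_le_one
  have t2 : ‖∑ i ∈ range P, (φ (i + 1) - φ i) * ∑ j ∈ range (i + 1), g j‖ ≤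
      P * (Λ / P * (2 * δ * P)) := by
    refine (norm_sum_le _ _).trans ?_
    refine (Finset.sum_le_card_nsmul _ _ (Λ / P * (2 * δ * P)) fun i hi => ?_).trans ?_
    · rw [norm_mul]
      have hi' := Finset.mem_range.1 hi
      exact mul_le_mul (hφ' i hi') (hG i hi'.le) (norm_nonneg _) (by positivity)
    · simp
  calc _ ≤ 1 * (2 * δ * P) + P * (Λ / P * (2 * δ * P)) := add_le_add t1 t2
    _ = 2 * (1 + Λ) * δ * P := by field_simp
    _ = ε * P := by rw [hδ]; field_simp

section major
variable {t : ℕ} {ν μ : Fin t → ℕ} {k : (l : Fin t) → Fin (ν l) → ℕ} {s : ℕ}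
  {c : EqIdx t ν μ → Fin s → ℤ}

variable (k c) in
/-- The normalised complete exponential sum modulo `Q` at the fraction vector `v`. -/
def tq (Q : ℕ) (v : EqIdx t ν μ → ℝ) (j : Fin s) : ℂ := (Q : ℂ)⁻¹ * fj t ν μ k s c (range Q) v j

lemma norm_tq_le (Q : ℕ) (v : EqIdx t ν μ → ℝ) (j : Fin s) : ‖tq k c Q v j‖ ≤ 1 := by
  rw [tq, norm_mul, norm_inv, Complex.norm_natCast]
  have := norm_fj_le (t := t) (ν := ν) (μ := μ) (k := k) (s := s) (c := c) (range Q) v j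
  rw [Finset.card_range] at this
  exact inv_mul_le_one_of_le₀ this (Nat.cast_nonneg _)

lemma succ_pow_sub_le {x P d : ℕ} (hx : x < P) :
    ((x + 1 : ℕ) : ℝ) ^ d - (x : ℝ) ^ d ≤ d * (P : ℝ) ^ (d - 1) := by
  rcases Nat.eq_zero_or_pos d with rfl | hd
  · simp
  have h1 : ∀ n : ℕ, ((x + 1 : ℕ) : ℝ) ^ n - (x : ℝ) ^ n ≤ n * ((x + 1 : ℕ) : ℝ) ^ (n - 1) := by
    intro n
    induction n with
    | zero => simp
    | succ n ih =>
      rcases Nat.eq_zero_or_pos n with rfl | hn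
      · simp
      have e : ((x + 1 : ℕ) : ℝ) ^ n = ((x + 1 : ℕ) : ℝ) ^ (n - 1) * ((x + 1 : ℕ) : ℝ) := by
        rw [← pow_succ, Nat.sub_add_cancel hn]
      have hx0 : (0 : ℝ) ≤ x := Nat.cast_nonneg _
      have e2 : (x : ℝ) ^ n ≤ ((x + 1 : ℕ) : ℝ) ^ n := by gcongr; simp
      have : ((x + 1 : ℕ) : ℝ) * (((x + 1 : ℕ) : ℝ) ^ n - (x : ℝ) ^ n) ≤
          ((x + 1 : ℕ) : ℝ) * (n * ((x + 1 : ℕ) : ℝ) ^ (n - 1)) := by gcongr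
      rw [Nat.add_sub_cancel, pow_succ, pow_succ]
      push_cast at *
      nlinarith
  refine (h1 d).trans ?_
  gcongr
  exact_mod_cast hx

/-- On a major arc a weighted exponential sum factors approximately. -/
lemma fj_major {A : ℕ → Finset ℕ} (hA : Equi A) (hk : ∀ l n, 0 < k l n) {Q : ℕ} (hQ : 0 < Q)
    {ε : ℝ} (hε : 0 < ε) (j : Fin s) : ∀ᶠ P : ℕ in atTop, ∀ a : EqIdx t ν μ → ℕ,
      ∀ β : EqIdx t ν μ → ℝ, (∀ i, |β i| ≤ 1 / (P : ℝ) ^ deg t ν μ k i) →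
        ‖fj t ν μ k s c (A P) (fun i => (a i : ℝ) / Q + β i) j -
          tq k c Q (fun i => (a i : ℝ) / Q) j * fj t ν μ k s c (A P) β j‖ ≤ ε * P := by
  set Λ : ℝ := 2 * Real.pi * ∑ i : EqIdx t ν μ, |(c i j : ℝ)| * deg t ν μ k i with hΛ
  have hΛ0 : 0 ≤ Λ := by positivity
  have hQ0 : (0 : ℝ) < Q := by exact_mod_cast hQ
  have hQC : (Q : ℂ) ≠ 0 := by exact_mod_cast hQ.ne'
  filter_upwards [weighted_equidistribution hA hQ hΛ0 (ε := ε / Q) (by positivity),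
    eventually_gt_atTop 0] with P h hP a β hβ
  have hP0 : (0 : ℝ) < P := by exact_mod_cast hP
  set φ : ℕ → ℂ := fun x => eC (∑ i : EqIdx t ν μ, (c i j : ℝ) * β i * (x : ℝ) ^ deg t ν μ k i)
    with hφ
  set w : ℕ → ℂ := fun x =>
    eC (∑ i : EqIdx t ν μ, (c i j : ℝ) * ((a i : ℝ) / Q) * (x : ℝ) ^ deg t ν μ k i) with hw
  have hvar : ∀ x < P, ‖φ (x + 1) - φ x‖ ≤ Λ / P := by
    intro x hx
    refine (norm_eC_sub_eC_le _ _).trans ?_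
    rw [← Finset.sum_sub_distrib, hΛ, mul_div_assoc, Finset.sum_div]
    refine mul_le_mul_of_nonneg_left ((Finset.abs_sum_le_sum_abs _ _).trans
      (Finset.sum_le_sum fun i _ => ?_)) (by positivity)
    have hd : 0 < deg t ν μ k i := hk _ _
    have e1 := succ_pow_sub_le (d := deg t ν μ k i) hx
    have e0 : 0 ≤ ((x + 1 : ℕ) : ℝ) ^ deg t ν μ k i - (x : ℝ) ^ deg t ν μ k i := by
      rw [sub_nonneg]; gcongr; simp
    rw [← mul_sub, abs_mul, abs_mul, abs_of_nonneg e0, mul_assoc, mul_div_assoc]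
    refine mul_le_mul_of_nonneg_left ?_ (abs_nonneg _)
    calc _ ≤ 1 / (P : ℝ) ^ deg t ν μ k i * (deg t ν μ k i * (P : ℝ) ^ (deg t ν μ k i - 1)) :=
          mul_le_mul (hβ i) e1 e0 (by positivity)
      _ = _ := by
          rw [← mul_pow_sub_one hd.ne' (P : ℝ)]
          field_simp
  have hwper : ∀ x : ℕ, w x = w (x % Q) := by
    intro x
    obtain ⟨m, hm⟩ : ∃ m : ℤ, ∑ i : EqIdx t ν μ, (c i j : ℝ) * ((a i : ℝ) / Q) *
        (x : ℝ) ^ deg t ν μ k i = ∑ i : EqIdx t ν μ, (c i j : ℝ) * ((a i : ℝ) / Q) *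
          ((x % Q : ℕ) : ℝ) ^ deg t ν μ k i + m := by
      have hdvd : ∀ i : EqIdx t ν μ, ∃ m : ℤ, (x : ℤ) ^ deg t ν μ k i -
          ((x % Q : ℕ) : ℤ) ^ deg t ν μ k i = Q * m := by
        intro i
        have h1 : (Q : ℤ) ∣ (x : ℤ) - ((x % Q : ℕ) : ℤ) := by
          push_cast; exact Int.dvd_self_sub_emod
        exact h1.trans (sub_dvd_pow_sub_pow _ _ _)
      choose m hm using hdvd
      refine ⟨∑ i, c i j * a i * m i, ?_⟩
      push_cast
      rw [← Finset.sum_add_distrib]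
      refine Finset.sum_congr rfl fun i _ => ?_
      have h2 : (x : ℝ) ^ deg t ν μ k i - ((x % Q : ℕ) : ℝ) ^ deg t ν μ k i = Q * m i := by
        exact_mod_cast hm i
      have h3 : (x : ℝ) ^ deg t ν μ k i = ((x % Q : ℕ) : ℝ) ^ deg t ν μ k i + Q * m i := by
        linarith
      rw [h3]
      field_simp
    simp only [hw]
    rw [hm, eC_add_int]
  have e1 : fj t ν μ k s c (A P) (fun i => (a i : ℝ) / Q + β i) j =
      ∑ b ∈ range Q, w b * ∑ x ∈ (A P).filter (fun n => n ≡ b [MOD Q]), φ x := by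
    have e2 : fj t ν μ k s c (A P) (fun i => (a i : ℝ) / Q + β i) j = ∑ x ∈ A P, w x * φ x := by
      rw [fj]
      refine Finset.sum_congr rfl fun x _ => ?_
      rw [hw, hφ, ← eC_add, ← Finset.sum_add_distrib]
      congr 1
      exact Finset.sum_congr rfl fun i _ => by ring
    rw [e2, ← Finset.sum_fiberwise_of_maps_to (s := A P) (t := range Q) (g := fun x => x % Q)
      fun x _ => Finset.mem_range.2 (Nat.mod_lt x hQ)]
    refine Finset.sum_congr rfl fun b hb => ?_
    rw [Finset.mul_sum]
    have hb' := Nat.mod_eq_of_lt (Finset.mem_range.1 hb)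
    refine Finset.sum_congr ?_ fun x hx => ?_
    · ext x
      simp only [Finset.mem_filter, Nat.ModEq, hb']
    · have := (Finset.mem_filter.1 hx).2
      rw [hwper x, show x % Q = b from Eq.trans this hb']
  have e3 : tq k c Q (fun i => (a i : ℝ) / Q) j * fj t ν μ k s c (A P) β j =
      ∑ b ∈ range Q, w b * ((Q : ℂ)⁻¹ * ∑ x ∈ A P, φ x) := by
    rw [← Finset.sum_mul, tq, fj, fj]
    ring
  rw [e1, e3, ← Finset.sum_sub_distrib]
  refine (norm_sum_le _ _).trans ((Finset.sum_le_card_nsmul _ _ (ε / Q * P) fun b _ => ?_).trans ?_)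
  · rw [← mul_sub, norm_mul, hw, norm_eC, one_mul]
    exact h φ (fun x => (norm_eC _).le) hvar b
  · rw [Finset.card_range, nsmul_eq_mul]
    apply le_of_eq
    field_simp

lemma Equi.card_ge {A : ℕ → Finset ℕ} (hA : Equi A) :
    ∃ κ : ℝ, 0 < κ ∧ ∀ᶠ P : ℕ in atTop, κ * P ≤ #(A P) := by
  obtain ⟨hsub, D, κ, hκ, hD, h⟩ := hA
  refine ⟨κ / 2, by positivity, ?_⟩
  filter_upwards [h (κ / 2) (by positivity) 1 one_pos, hD] with P h1 h2
  have h3 := h1 P le_rfl 0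
  have h4 : #((A P).filter fun n => n ≤ P ∧ n ≡ 0 [MOD 1]) ≤ #(A P) :=
    Finset.card_filter_le _ _
  have h5 : (#((A P).filter fun n => n ≤ P ∧ n ≡ 0 [MOD 1]) : ℝ) ≤ #(A P) := by exact_mod_cast h4
  have h6 := (abs_le.1 h3).1
  have h7 : κ * P ≤ D P * P := by gcongr
  push_cast at h6
  linarith

/-- Near zero the exponential sum has no cancellation. -/
lemma norm_fj_near_zero {A : Finset ℕ} {P : ℕ} (hA : A ⊆ Icc 1 P) {ε₀ : ℝ} (j : Fin s)
    (hε₀ : 2 * Real.pi * (ε₀ * ∑ i : EqIdx t ν μ, |(c i j : ℝ)|) ≤ 1 / 2)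
    {β : EqIdx t ν μ → ℝ} (hβ : ∀ i, |β i| ≤ ε₀ / (P : ℝ) ^ deg t ν μ k i) :
    (#A : ℝ) / 2 ≤ ‖fj t ν μ k s c A β j‖ := by
  have h1 : ‖fj t ν μ k s c A β j - #A‖ ≤ #A / 2 := by
    have : fj t ν μ k s c A β j - #A = ∑ x ∈ A,
        (eC (∑ i : EqIdx t ν μ, (c i j : ℝ) * β i * (x : ℝ) ^ deg t ν μ k i) - 1) := by
      rw [Finset.sum_sub_distrib, fj]; simp
    rw [this]
    refine (norm_sum_le _ _).trans ((Finset.sum_le_card_nsmul _ _ (1 / 2) fun x hx => ?_).trans ?_)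
    · refine (norm_eC_sub_one_le _).trans (le_trans ?_ hε₀)
      refine mul_le_mul_of_nonneg_left ?_ (by positivity)
      rw [Finset.mul_sum]
      refine (Finset.abs_sum_le_sum_abs _ _).trans (Finset.sum_le_sum fun i _ => ?_)
      have hx' := Finset.mem_Icc.1 (hA hx)
      have hP0 : (0 : ℝ) < P := by exact_mod_cast (by omega : 0 < P)
      have hx1 : (x : ℝ) ≤ P := by exact_mod_cast hx'.2
      rw [abs_mul, abs_mul, abs_of_nonneg (by positivity : (0 : ℝ) ≤ (x : ℝ) ^ deg t ν μ k i)]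
      have : |β i| * (x : ℝ) ^ deg t ν μ k i ≤ ε₀ := by
        calc _ ≤ ε₀ / (P : ℝ) ^ deg t ν μ k i * (P : ℝ) ^ deg t ν μ k i :=
              mul_le_mul (hβ i) (by gcongr) (by positivity) ((abs_nonneg _).trans (hβ i))
          _ = ε₀ := by field_simp
      calc _ = |(c i j : ℝ)| * (|β i| * (x : ℝ) ^ deg t ν μ k i) := by ring
        _ ≤ |(c i j : ℝ)| * ε₀ := by gcongr
        _ = _ := mul_comm _ _
    · simp; linarith
  have h2 : ‖(#A : ℂ)‖ = #A := Complex.norm_natCast _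
  have h3 := norm_sub_norm_le (#A : ℂ) (fj t ν μ k s c A β j)
  rw [norm_sub_rev] at h3
  linarith

end major

section bq
variable {t : ℕ} {ν μ : Fin t → ℕ} {k : (l : Fin t) → Fin (ν l) → ℕ} {s : ℕ}
  {c : EqIdx t ν μ → Fin s → ℤ}

/-- Numerators of fraction vectors with denominator `Q`. -/
def numer (t : ℕ) (ν μ : Fin t → ℕ) (Q : ℕ) : Finset (EqIdx t ν μ → ℕ) :=
  Fintype.piFinset fun _ => range Q

/-- The fraction vector `a / Q`. -/
def fracv (Q : ℕ) (a : EqIdx t ν μ → ℕ) : EqIdx t ν μ → ℝ := fun i => (a i : ℝ) / Q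

variable (k c) in
/-- The absolute moment of the complete sums modulo `Q`. -/
def BQ (J : Finset (Fin s)) (Q : ℕ) : ℝ :=
  ∑ a ∈ numer t ν μ Q, ∏ j ∈ J, ‖tq k c Q (fracv Q a) j‖

/-- Sum over major arcs of a product of continuous functions is at most the whole integral. -/
lemma sum_boxes_le {ι : Type*} [Fintype ι] [DecidableEq ι] {Q : ℕ} (hQ : 0 < Q) {F : (ι → ℝ) → ℝ}
    (hF : Continuous F) (hF0 : ∀ α, 0 ≤ F α) {w : ι → ℝ} (hw0 : ∀ i, 0 ≤ w i)
    (hw : ∀ i, w i ≤ 1 / Q) (b : (ι → ℕ) → ℝ)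
    (hb : ∀ a ∈ Fintype.piFinset (fun _ : ι => range Q), ∀ β : ι → ℝ,
      (∀ i, 0 ≤ β i ∧ β i ≤ w i) → b a ≤ F (fun i => (a i : ℝ) / Q + β i)) :
    (∏ i, w i) * ∑ a ∈ Fintype.piFinset (fun _ : ι => range Q), b a ≤ ∫ α in ubox ι, F α := by
  have hQ0 : (0 : ℝ) < Q := by exact_mod_cast hQ
  set S := Fintype.piFinset (fun _ : ι => range Q)
  set B : (ι → ℕ) → Set (ι → ℝ) := fun a =>
    Set.univ.pi fun i => Set.Ico ((a i : ℝ) / Q) ((a i : ℝ) / Q + w i)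
  have hBm : ∀ a, MeasurableSet (B a) := fun a =>
    MeasurableSet.univ_pi fun i => measurableSet_Ico
  have hBsub : ∀ a ∈ S, B a ⊆ ubox ι := by
    intro a ha α hα i _
    have h1 := hα i (Set.mem_univ _)
    have h2 := Finset.mem_range.1 (Fintype.mem_piFinset.1 ha i)
    have h3 : ((a i : ℝ) + 1) / Q ≤ 1 := by
      rw [div_le_one hQ0]; exact_mod_cast h2
    have h4 : (0 : ℝ) ≤ (a i : ℝ) / Q := by positivity
    rw [add_div] at h3
    exact ⟨h4.trans h1.1, lt_of_lt_of_le h1.2 (by linarith [hw i])⟩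
  have hdisj : (S : Set (ι → ℕ)).PairwiseDisjoint B := by
    intro a _ a' _ hne
    rw [Function.onFun, Set.disjoint_left]
    intro α h1 h2
    apply hne
    funext i
    have e1 := h1 i (Set.mem_univ _)
    have e2 := h2 i (Set.mem_univ _)
    have key : ∀ m n : ℕ, (m : ℝ) / Q ≤ α i → α i < (n : ℝ) / Q + w i → m ≤ n := by
      intro m n hm hn
      have : (m : ℝ) / Q < ((n : ℝ) + 1) / Q := by rw [add_div]; linarith [hw i]
      rw [div_lt_div_iff_of_pos_right hQ0] at this
      have : m < n + 1 := by exact_mod_cast this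
      omega
    exact le_antisymm (key _ _ e1.1 e2.2) (key _ _ e2.1 e1.2)
  have hInt : IntegrableOn F (ubox ι) := integrableOn_ubox hF
  have hvol : ∀ a, (volume (B a)).toReal = ∏ i, w i := by
    intro a
    rw [Real.volume_pi_Ico_toReal]
    · exact Finset.prod_congr rfl fun i _ => by ring
    · intro i; simp [hw0 i]
  have hfin : ∀ a, volume (B a) ≠ ⊤ := by
    intro a
    rw [Real.volume_pi_Ico]
    exact (ENNReal.prod_lt_top fun i _ => ENNReal.ofReal_lt_top).ne
  calc (∏ i, w i) * ∑ a ∈ S, b a = ∑ a ∈ S, ∫ α in B a, b a := by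
        rw [Finset.mul_sum]
        refine Finset.sum_congr rfl fun a _ => ?_
        rw [setIntegral_const, measureReal_def, hvol, smul_eq_mul]
    _ ≤ ∑ a ∈ S, ∫ α in B a, F α := by
        refine Finset.sum_le_sum fun a ha => ?_
        refine setIntegral_mono_on (integrableOn_const (hfin a)) (hInt.mono_set (hBsub a ha))
          (hBm a) fun α hα => ?_
        have := hb a ha (fun i => α i - (a i : ℝ) / Q) fun i => by
          have := hα i (Set.mem_univ _)
          exact ⟨by linarith [this.1], by linarith [this.2]⟩
        simpa using this
    _ = ∫ α in ⋃ a ∈ S, B a, F α :=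
        (integral_biUnion_finset _ (fun a _ => hBm a) hdisj
          fun a ha => hInt.mono_set (hBsub a ha)).symm
    _ ≤ _ := setIntegral_mono_set hInt (ae_of_all _ hF0)
        (LE.le.eventuallyLE (Set.iUnion₂_subset hBsub))

/-- A bound for the mean value of the exponential sums bounds the complete sums. -/
lemma BQ_le {A : ℕ → Finset ℕ} (hA : Equi A) (hk : ∀ l n, 0 < k l n) (J : Finset (Fin s)) {C : ℝ}
    (hC : ∀ᶠ P : ℕ in atTop, ∫ α in ubox (EqIdx t ν μ), ∏ j ∈ J, ‖fj t ν μ k s c (A P) α j‖ ≤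
      C * (P : ℝ) ^ J.card / (P : ℝ) ^ Ktot t ν μ k) :
    ∃ C' : ℝ, ∀ Q : ℕ, 0 < Q → BQ k c J Q ≤ C' := by
  obtain ⟨κ, hκ, hκA⟩ := hA.card_ge
  obtain ⟨ε₀, hε₀, hε₀1, hε₀c⟩ : ∃ ε₀ : ℝ, 0 < ε₀ ∧ ε₀ ≤ 1 ∧ ∀ j : Fin s,
      2 * Real.pi * (ε₀ * ∑ i : EqIdx t ν μ, |(c i j : ℝ)|) ≤ 1 / 2 := by
    set N : ℝ := 1 + ∑ j : Fin s, ∑ i : EqIdx t ν μ, |(c i j : ℝ)| with hN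
    have h1 : 1 ≤ N := by rw [hN, le_add_iff_nonneg_right]; positivity
    have hpi := Real.pi_gt_three
    refine ⟨1 / (4 * Real.pi * N), by positivity, ?_, fun j => ?_⟩
    · rw [div_le_one (by positivity)]; nlinarith
    · have h2 : ∑ i : EqIdx t ν μ, |(c i j : ℝ)| ≤ N := by
        have := Finset.single_le_sum (f := fun j : Fin s => ∑ i : EqIdx t ν μ, |(c i j : ℝ)|)
          (fun j _ => by positivity) (Finset.mem_univ j)
        linarith
      calc _ = (∑ i : EqIdx t ν μ, |(c i j : ℝ)|) / N / 2 := by field_simp; norm_num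
        _ ≤ 1 / 2 := by
          have : (∑ i : EqIdx t ν μ, |(c i j : ℝ)|) / N ≤ 1 := by
            rw [div_le_one (by positivity)]; exact h2
          linarith
  set r := Fintype.card (EqIdx t ν μ)
  refine ⟨C / ε₀ ^ r * (2 / κ) ^ J.card, fun Q hQ => ?_⟩
  have hQ0 : (0 : ℝ) < Q := by exact_mod_cast hQ
  have hmain : ∀ ε > 0, ∑ a ∈ numer t ν μ Q,
      ∏ j ∈ J, max 0 (κ / 2 * ‖tq k c Q (fracv Q a) j‖ - ε) ≤ C / ε₀ ^ r := by
    intro ε hε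
    have hmaj : ∀ᶠ P : ℕ in atTop, ∀ j : Fin s, _ :=
      eventually_all.2 fun j => fj_major (c := c) hA hk hQ hε j
    obtain ⟨P, hP⟩ := (hmaj.and ((eventually_ge_atTop Q).and (hκA.and hC))).exists
    obtain ⟨h1, hPQ, h2, h3⟩ := hP
    have hP1 : 1 ≤ P := le_trans hQ hPQ
    have hP0 : (0 : ℝ) < P := by exact_mod_cast hP1
    have h4 := sum_boxes_le (ι := EqIdx t ν μ) hQ
      (F := fun α => ∏ j ∈ J, ‖fj t ν μ k s c (A P) α j‖)
      (by
        refine continuous_finsetProd _ fun j _ => ?_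
        exact (continuous_fj (A P) j).norm)
      (fun α => by positivity) (w := fun i => ε₀ / (P : ℝ) ^ deg t ν μ k i)
      (fun i => by positivity)
      (fun i => by
        have hd : deg t ν μ k i ≠ 0 := (hk _ _).ne'
        have : (P : ℝ) ≤ (P : ℝ) ^ deg t ν μ k i := le_self_pow₀ (by exact_mod_cast hP1) hd
        have hQP : (Q : ℝ) ≤ P := by exact_mod_cast hPQ
        exact div_le_div₀ zero_le_one hε₀1 hQ0 (hQP.trans this))
      (fun a => ∏ j ∈ J, (P * max 0 (κ / 2 * ‖tq k c Q (fracv Q a) j‖ - ε)))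
      (by
        intro a _ β hβ
        refine Finset.prod_le_prod (fun j _ => by positivity) fun j _ => ?_
        have hβ' : ∀ i, |β i| ≤ ε₀ / (P : ℝ) ^ deg t ν μ k i := fun i => by
          rw [abs_of_nonneg (hβ i).1]; exact (hβ i).2
        have e1 := h1 j a β fun i => (hβ' i).trans (by gcongr)
        have e2 := norm_fj_near_zero (k := k) (hA.1 P) j (hε₀c j) hβ'
        rw [mul_max_of_nonneg _ _ hP0.le, mul_zero]
        refine max_le (norm_nonneg _) ?_
        have e3 := norm_sub_norm_le (tq k c Q (fun i => (a i : ℝ) / Q) j *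
          fj t ν μ k s c (A P) β j) (fj t ν μ k s c (A P) (fun i => (a i : ℝ) / Q + β i) j)
        rw [norm_sub_rev, norm_mul] at e3
        have e4 : ‖tq k c Q (fracv Q a) j‖ * (κ * P / 2) ≤
            ‖tq k c Q (fracv Q a) j‖ * ‖fj t ν μ k s c (A P) β j‖ :=
          mul_le_mul_of_nonneg_left (by linarith) (norm_nonneg _)
        change P * (κ / 2 * ‖tq k c Q (fracv Q a) j‖ - ε) ≤ _
        change ‖tq k c Q (fracv Q a) j‖ * _ - _ ≤ _ at e3
        nlinarith)
    have h5 := h4.trans h3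
    have h6 : ∏ i : EqIdx t ν μ, ε₀ / (P : ℝ) ^ deg t ν μ k i =
        ε₀ ^ r / (P : ℝ) ^ Ktot t ν μ k := by
      rw [Finset.prod_div_distrib, Finset.prod_const, Finset.card_univ, Finset.prod_pow_eq_pow_sum]
      rfl
    simp_rw [Finset.prod_mul_distrib, Finset.prod_const] at h5
    rw [h6, ← Finset.mul_sum] at h5
    rw [le_div_iff₀ (by positivity)]
    have hPK : (0 : ℝ) < (P : ℝ) ^ Ktot t ν μ k := by positivity
    have hPJ : (0 : ℝ) < (P : ℝ) ^ J.card := by positivity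
    rw [div_mul_eq_mul_div, div_le_div_iff_of_pos_right hPK] at h5
    refine le_of_mul_le_mul_left ?_ hPJ
    calc _ = _ := ?_
      _ ≤ _ := h5
      _ = _ := mul_comm _ _
    rw [numer]; ring
  have hlim : Tendsto (fun ε : ℝ => ∑ a ∈ numer t ν μ Q,
      ∏ j ∈ J, max 0 (κ / 2 * ‖tq k c Q (fracv Q a) j‖ - ε)) (nhdsWithin 0 (Set.Ioi 0))
      (nhds (∑ a ∈ numer t ν μ Q, ∏ j ∈ J, max 0 (κ / 2 * ‖tq k c Q (fracv Q a) j‖ - 0))) := by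
    refine tendsto_nhdsWithin_of_tendsto_nhds (Continuous.tendsto ?_ 0)
    fun_prop
  have h7 := le_of_tendsto hlim (eventually_nhdsWithin_of_forall fun ε hε => hmain ε hε)
  have h8 : ∑ a ∈ numer t ν μ Q, ∏ j ∈ J, max 0 (κ / 2 * ‖tq k c Q (fracv Q a) j‖ - 0) =
      (κ / 2) ^ J.card * BQ k c J Q := by
    rw [BQ, Finset.mul_sum]
    refine Finset.sum_congr rfl fun a _ => ?_
    rw [← Finset.prod_const, ← Finset.prod_mul_distrib]
    refine Finset.prod_congr rfl fun j _ => ?_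
    rw [sub_zero, max_eq_right (by positivity)]
  rw [h8] at h7
  calc BQ k c J Q = ((κ / 2) ^ J.card * BQ k c J Q) * (2 / κ) ^ J.card := by
        rw [mul_right_comm, ← mul_pow]
        have : κ / 2 * (2 / κ) = 1 := by field_simp
        rw [this, one_pow, one_mul]
    _ ≤ _ := by gcongr

end bq

lemma eC_eq_one_iff (x : ℝ) : eC x = 1 ↔ ∃ m : ℤ, x = m := by
  constructor
  · intro h
    rw [eC, Complex.exp_eq_one_iff] at h
    obtain ⟨m, hm⟩ := h
    refine ⟨m, ?_⟩
    have h1 : (2 * Real.pi * Complex.I) ≠ 0 := by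
      simp [Real.pi_ne_zero]
    have h2 : (2 * Real.pi * Complex.I) * x = (2 * Real.pi * Complex.I) * m := by
      rw [hm]; ring
    exact_mod_cast mul_left_cancel₀ h1 h2
  · rintro ⟨m, rfl⟩
    exact eC_int m

lemma sum_range_eC_div {Q : ℕ} (hQ : 0 < Q) (m : ℤ) :
    ∑ a ∈ range Q, eC ((a : ℝ) * ((m : ℝ) / Q)) = if (Q : ℤ) ∣ m then (Q : ℂ) else 0 := by
  have hQ0 : (Q : ℝ) ≠ 0 := by exact_mod_cast hQ.ne'
  have hz : ∀ a : ℕ, eC ((a : ℝ) * ((m : ℝ) / Q)) = eC ((m : ℝ) / Q) ^ a := fun a => by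
    rw [eC_nat_mul]
  simp_rw [hz]
  split_ifs with h
  · obtain ⟨n, rfl⟩ := h
    have : eC (((Q * n : ℤ) : ℝ) / Q) = 1 := by
      rw [eC_eq_one_iff]; exact ⟨n, by push_cast; field_simp⟩
    rw [this]; simp
  · have hne : eC ((m : ℝ) / Q) ≠ 1 := by
      rw [Ne, eC_eq_one_iff]
      rintro ⟨n, hn⟩
      apply h
      refine ⟨n, ?_⟩
      rw [div_eq_iff hQ0] at hn
      have : m = n * Q := by exact_mod_cast hn
      rw [this, mul_comm]
    rw [geom_sum_eq hne, ← hz]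
    have : eC ((Q : ℝ) * ((m : ℝ) / Q)) = 1 := by
      rw [eC_eq_one_iff]; exact ⟨m, by field_simp⟩
    rw [this]; simp

/-- A positive integer factors into a part supported on the primes dividing `N` and a part coprime
to `N`. -/
lemma exists_mul_coprime_part (N : ℕ) {Q : ℕ} (hQ : Q ≠ 0) : ∃ Q₁ Q₂ : ℕ, Q₁ * Q₂ = Q ∧
    (∀ p, p.Prime → p ∣ Q₁ → p ∣ N) ∧ Q₂.Coprime N := by
  induction Q using induction_on_primes with
  | zero => exact absurd rfl hQ
  | one => exact ⟨1, 1, rfl, fun p hp h => absurd h hp.not_dvd_one, Nat.coprime_one_left N⟩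
  | prime_mul p n hp ih =>
    obtain ⟨Q₁, Q₂, rfl, h1, h2⟩ := ih (right_ne_zero_of_mul hQ)
    by_cases hpN : p ∣ N
    · refine ⟨p * Q₁, Q₂, mul_assoc _ _ _, fun q hq hqd => ?_, h2⟩
      rcases (Nat.Prime.dvd_mul hq).1 hqd with h | h
      · rwa [(Nat.prime_dvd_prime_iff_eq hq hp).1 h]
      · exact h1 q hq h
    · exact ⟨Q₁, p * Q₂, mul_left_comm _ _ _, h1,
        Nat.Coprime.mul_left ((hp.coprime_iff_not_dvd).2 hpN) h2⟩

section chi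
variable {t : ℕ} {ν μ : Fin t → ℕ} {k : (l : Fin t) → Fin (ν l) → ℕ} {s : ℕ}
  {c : EqIdx t ν μ → Fin s → ℤ}

variable (k c) in
/-- The values of the forms at an integral point. -/
def Fval (x : Fin s → ℕ) (i : EqIdx t ν μ) : ℤ := ∑ j, c i j * (x j : ℤ) ^ deg t ν μ k i

lemma zsol_eq {Q : ℕ} (hQ : 0 < Q) : zsol k c Q =
    #((Fintype.piFinset fun _ : Fin s => range Q).filter fun x => ∀ i, (Q : ℤ) ∣ Fval k c x i) := by
  have : NeZero Q := ⟨hQ.ne'⟩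
  have key : ∀ y : Fin s → ℕ, IsSol t ν μ k s c (fun j => (y j : ZMod Q)) ↔
      ∀ i, (Q : ℤ) ∣ Fval k c y i := by
    intro y
    refine forall_congr' fun i => ?_
    rw [← ZMod.intCast_zmod_eq_zero_iff_dvd, Fval]
    push_cast
    rfl
  have hval : ∀ x : Fin s → ZMod Q, (fun j => ((x j).val : ZMod Q)) = x := fun x => by
    funext j; simp
  rw [zsol, ← Fintype.card_coe, ← Nat.card_eq_fintype_card]
  refine Nat.card_congr
    { toFun := fun x => ⟨fun j => (x.1 j).val, ?_⟩
      invFun := fun y => ⟨fun j => (y.1 j : ZMod Q), (key _).2 (Finset.mem_filter.1 y.2).2⟩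
      left_inv := fun x => Subtype.ext (hval x.1)
      right_inv := ?_ }
  · rw [Finset.mem_filter, Fintype.mem_piFinset]
    exact ⟨fun j => Finset.mem_range.2 (ZMod.val_lt _), (key _).1 (by rw [hval]; exact x.2)⟩
  · rintro ⟨y, hy⟩
    apply Subtype.ext
    funext j
    have := Fintype.mem_piFinset.1 (Finset.mem_filter.1 hy).1 j
    exact ZMod.val_cast_of_lt (Finset.mem_range.1 this)

lemma chi_eq_sum {Q : ℕ} (hQ : 0 < Q) :
    (chi k c Q : ℂ) = ∑ a ∈ numer t ν μ Q, ∏ j, tq k c Q (fracv Q a) j := by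
  have hQ0 : (Q : ℂ) ≠ 0 := by exact_mod_cast hQ.ne'
  have h1 : ∀ a : EqIdx t ν μ → ℕ, ∏ j, tq k c Q (fracv Q a) j = ((Q : ℂ) ^ s)⁻¹ *
      ∑ x ∈ Fintype.piFinset fun _ : Fin s => range Q,
        ∏ i, eC ((a i : ℝ) * ((Fval k c x i : ℝ) / Q)) := by
    intro a
    simp only [tq, fj]
    rw [Finset.prod_mul_distrib, Finset.prod_const, Finset.card_univ, Fintype.card_fin, inv_pow,
      Finset.prod_univ_sum]
    congr 1
    refine Finset.sum_congr rfl fun x _ => ?_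
    rw [← eC_sum, ← eC_sum, Finset.sum_comm]
    congr 1
    refine Finset.sum_congr rfl fun i _ => ?_
    simp only [Fval, fracv]
    push_cast
    rw [Finset.sum_div, Finset.mul_sum]
    exact Finset.sum_congr rfl fun j _ => by ring
  simp_rw [h1]
  rw [← Finset.mul_sum, Finset.sum_comm]
  have h2 : ∀ x : Fin s → ℕ, ∑ a ∈ numer t ν μ Q, ∏ i, eC ((a i : ℝ) * ((Fval k c x i : ℝ) / Q)) =
      if ∀ i, (Q : ℤ) ∣ Fval k c x i then (Q : ℂ) ^ Fintype.card (EqIdx t ν μ) else 0 := by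
    intro x
    rw [numer, ← Finset.prod_univ_sum (fun _ => range Q)
      (fun i (a : ℕ) => eC ((a : ℝ) * ((Fval k c x i : ℝ) / Q)))]
    simp_rw [sum_range_eC_div hQ]
    split_ifs with h
    · rw [Finset.prod_congr rfl fun i _ => if_pos (h i)]
      simp
    · push Not at h
      obtain ⟨i, hi⟩ := h
      exact Finset.prod_eq_zero (Finset.mem_univ i) (if_neg hi)
  simp_rw [h2]
  rw [← Finset.sum_filter, Finset.sum_const, ← zsol_eq hQ, nsmul_eq_mul, chi]
  push_cast
  field_simp

lemma eC_frac_periodic {Q : ℕ} (hQ : 0 < Q) (a : EqIdx t ν μ → ℕ) (j : Fin s) (m x : ℕ) :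
    eC (∑ i : EqIdx t ν μ, (c i j : ℝ) * fracv Q a i * ((Q * m + x : ℕ) : ℝ) ^ deg t ν μ k i) =
      eC (∑ i : EqIdx t ν μ, (c i j : ℝ) * fracv Q a i * (x : ℝ) ^ deg t ν μ k i) := by
  have hQ0 : (Q : ℝ) ≠ 0 := by exact_mod_cast hQ.ne'
  have hdvd : ∀ i : EqIdx t ν μ, ∃ n : ℤ, ((Q * m + x : ℕ) : ℤ) ^ deg t ν μ k i -
      (x : ℤ) ^ deg t ν μ k i = Q * n := by
    intro i
    have h1 : (Q : ℤ) ∣ ((Q * m + x : ℕ) : ℤ) - (x : ℤ) := ⟨m, by push_cast; ring⟩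
    exact h1.trans (sub_dvd_pow_sub_pow _ _ _)
  choose n hn using hdvd
  rw [← eC_add_int (∑ i : EqIdx t ν μ, (c i j : ℝ) * fracv Q a i * (x : ℝ) ^ deg t ν μ k i)
    (∑ i, c i j * a i * n i)]
  congr 1
  push_cast
  rw [← Finset.sum_add_distrib]
  refine Finset.sum_congr rfl fun i _ => ?_
  have h2 : ((Q * m + x : ℕ) : ℝ) ^ deg t ν μ k i - (x : ℝ) ^ deg t ν μ k i = Q * n i := by
    exact_mod_cast hn i
  have h3 : ((Q : ℝ) * m + x) ^ deg t ν μ k i = (x : ℝ) ^ deg t ν μ k i + Q * n i := by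
    push_cast at h2; linarith
  rw [h3, fracv]
  field_simp

lemma tq_mul {Q m : ℕ} (hQ : 0 < Q) (hm : 0 < m) (a : EqIdx t ν μ → ℕ) (j : Fin s) :
    tq k c (Q * m) (fracv (Q * m) fun i => m * a i) j = tq k c Q (fracv Q a) j := by
  have hm0 : (m : ℝ) ≠ 0 := by exact_mod_cast hm.ne'
  have hmC : (m : ℂ) ≠ 0 := by exact_mod_cast hm.ne'
  have hQC : (Q : ℂ) ≠ 0 := by exact_mod_cast hQ.ne'
  have h1 : (fracv (Q * m) fun i => m * a i) = fracv Q a := by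
    funext i
    simp only [fracv]
    push_cast
    rw [mul_comm (Q : ℝ), mul_div_mul_left _ _ hm0]
  have h2 : ∀ n : ℕ, fj t ν μ k s c (range (Q * n)) (fracv Q a) j =
      n * fj t ν μ k s c (range Q) (fracv Q a) j := by
    intro n
    induction n with
    | zero => simp [fj]
    | succ n ih =>
      rw [fj] at ih ⊢
      rw [mul_add, mul_one, Finset.sum_range_add, ih]
      simp_rw [eC_frac_periodic hQ a j n]
      rw [← fj]
      push_cast
      ring
  rw [h1, tq, h2, tq]
  push_cast
  field_simp

lemma tq_zero {Q : ℕ} (hQ : 0 < Q) (j : Fin s) :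
    tq k c Q (fracv Q (0 : EqIdx t ν μ → ℕ)) j = 1 := by
  have hQC : (Q : ℂ) ≠ 0 := by exact_mod_cast hQ.ne'
  simp [tq, fj, fracv, eC_zero, hQC]

lemma BQ_mul_ge (J : Finset (Fin s)) {Q₁ Q₂ : ℕ} (h1 : 0 < Q₁) (h2 : 0 < Q₂)
    (hco : Q₁.Coprime Q₂) : BQ k c J Q₁ + BQ k c J Q₂ ≤ BQ k c J (Q₁ * Q₂) + 1 := by
  have key : ∀ Q m : ℕ, 0 < Q → 0 < m → (BQ k c J Q = ∑ a ∈ (numer t ν μ Q).image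
      (fun a i => m * a i), ∏ j ∈ J, ‖tq k c (Q * m) (fracv (Q * m) a) j‖) ∧
        (numer t ν μ Q).image (fun a i => m * a i) ⊆ numer t ν μ (Q * m) := by
    intro Q m hQ hm
    constructor
    · rw [Finset.sum_image, BQ]
      · simp_rw [tq_mul hQ hm]
      · intro a _ b _ h
        funext i
        exact Nat.eq_of_mul_eq_mul_left hm (congrFun h i)
    · intro a ha
      obtain ⟨b, hb, rfl⟩ := Finset.mem_image.1 ha
      simp only [numer, Fintype.mem_piFinset, Finset.mem_range] at hb ⊢
      intro i
      rw [mul_comm Q]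
      exact Nat.mul_lt_mul_of_pos_left (hb i) hm
  obtain ⟨e1, s1⟩ := key Q₁ Q₂ h1 h2
  obtain ⟨e2, s2⟩ := key Q₂ Q₁ h2 h1
  rw [mul_comm Q₂ Q₁] at e2 s2
  rw [e1, e2, ← Finset.sum_union_inter]
  refine add_le_add (Finset.sum_le_sum_of_subset_of_nonneg (Finset.union_subset s1 s2)
    fun a _ _ => by positivity) ?_
  have h3 : (numer t ν μ Q₁).image (fun a i => Q₂ * a i) ∩
      (numer t ν μ Q₂).image (fun a i => Q₁ * a i) ⊆ {0} := by
    intro a ha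
    obtain ⟨ha1, ha2⟩ := Finset.mem_inter.1 ha
    obtain ⟨b, hb, rfl⟩ := Finset.mem_image.1 ha1
    obtain ⟨b', hb', he⟩ := Finset.mem_image.1 ha2
    rw [Finset.mem_singleton]
    funext i
    have h4 := congrFun he i
    have h5 : Q₁ ∣ b i := hco.dvd_of_dvd_mul_left ⟨_, h4.symm⟩
    have h6 := Finset.mem_range.1 (Fintype.mem_piFinset.1 hb i)
    simp [Nat.eq_zero_of_dvd_of_lt h5 h6]
  refine (Finset.sum_le_sum_of_subset_of_nonneg h3 fun a _ _ => by positivity).trans ?_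
  rw [Finset.sum_singleton]
  exact Finset.prod_le_one (fun _ _ => norm_nonneg _) fun _ _ => norm_tq_le _ _ _

lemma chi_ge_of_BQ (J : Finset (Fin s)) {Q : ℕ} (hQ : 0 < Q) : 2 - BQ k c J Q ≤ chi k c Q := by
  have h0 : (0 : EqIdx t ν μ → ℕ) ∈ numer t ν μ Q := by simp [numer, hQ]
  have h1 := chi_eq_sum (k := k) (c := c) hQ
  rw [← Finset.add_sum_erase _ _ h0, Finset.prod_congr rfl fun j _ => tq_zero hQ j,
    Finset.prod_const_one] at h1
  have h2 : BQ k c J Q = 1 + ∑ a ∈ (numer t ν μ Q).erase 0, ∏ j ∈ J, ‖tq k c Q (fracv Q a) j‖ := by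
    rw [BQ, ← Finset.add_sum_erase _ _ h0]
    congr 1
    rw [Finset.prod_congr rfl fun j _ => by rw [tq_zero hQ j, norm_one], Finset.prod_const_one]
  have h3 : ‖∑ a ∈ (numer t ν μ Q).erase 0, ∏ j, tq k c Q (fracv Q a) j‖ ≤
      ∑ a ∈ (numer t ν μ Q).erase 0, ∏ j ∈ J, ‖tq k c Q (fracv Q a) j‖ := by
    refine (norm_sum_le _ _).trans (Finset.sum_le_sum fun a _ => ?_)
    rw [norm_prod]
    exact Finset.prod_le_prod_of_subset_of_le_one (Finset.subset_univ J)
      (fun _ _ => norm_nonneg _) fun _ _ _ => norm_tq_le _ _ _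
  have h4 := congrArg Complex.re h1
  rw [Complex.ofReal_re, Complex.add_re, Complex.one_re] at h4
  have h5 := (abs_le.1 (Complex.abs_re_le_norm
    (∑ a ∈ (numer t ν μ Q).erase 0, ∏ j, tq k c Q (fracv Q a) j))).1
  linarith

/-- The local densities are bounded below uniformly in the modulus. -/
lemma chi_lower (J : Finset (Fin s)) {C : ℝ} (hB : ∀ Q : ℕ, 0 < Q → BQ k c J Q ≤ C)
    (hpadic : ∀ p : ℕ, ∀ _ : Fact p.Prime, ∃ x : Fin s → ℚ_[p],
      IsSol t ν μ k s c x ∧ JacFullRank t ν μ k s c x) :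
    ∃ χ₀ : ℝ, 0 < χ₀ ∧ ∀ Q : ℕ, 0 < Q → χ₀ ≤ chi k c Q := by
  set S : Set ℝ := {b | ∃ Q : ℕ, 0 < Q ∧ b = BQ k c J Q}
  have hSne : S.Nonempty := ⟨_, 1, one_pos, rfl⟩
  have hSbd : BddAbove S := ⟨C, by rintro b ⟨Q, hQ, rfl⟩; exact hB Q hQ⟩
  obtain ⟨b, ⟨Q₀, hQ₀, rfl⟩, hb⟩ := exists_lt_of_lt_csSup hSne
    (by linarith : sSup S - 1 / 2 < sSup S)
  obtain ⟨κ, hκ, hκ'⟩ := chi_primes_lower hpadic Q₀.primeFactors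
  refine ⟨κ * (1 / 2), by positivity, fun Q hQ => ?_⟩
  obtain ⟨Q₁, Q₂, rfl, hQ1, hQ2⟩ := exists_mul_coprime_part Q₀ hQ.ne'
  have hQ1pos : 0 < Q₁ := Nat.pos_of_mul_pos_right hQ
  have hQ2pos : 0 < Q₂ := Nat.pos_of_mul_pos_left hQ
  have hco : Q₁.Coprime Q₂ := Nat.coprime_of_dvd fun p hp h1 h2 =>
    hp.one_lt.ne' (Nat.dvd_one.1 (hQ2 ▸ Nat.dvd_gcd h2 (hQ1 p hp h1)))
  rw [chi_mul hco]
  have e1 : κ ≤ chi k c Q₁ := hκ' Q₁ hQ1pos.ne' fun p hp h =>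
    Nat.mem_primeFactors.2 ⟨hp, hQ1 p hp h, hQ₀.ne'⟩
  have e2 := BQ_mul_ge (k := k) (c := c) J hQ₀ hQ2pos hQ2.symm
  have e3 : BQ k c J (Q₀ * Q₂) ≤ sSup S := le_csSup hSbd ⟨_, by positivity, rfl⟩
  have e4 := chi_ge_of_BQ (k := k) (c := c) J hQ2pos
  exact mul_le_mul e1 (by linarith) (by norm_num) (chi_nonneg _)

end chi

/-- The slab `‖A w‖ ≤ τ` inside a ball has volume at least a constant times `τ ^ r`. -/
lemma slab_volume_ge {m n : Type*} [Fintype m] [Fintype n] [DecidableEq m] [DecidableEq n]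
    (A : Matrix m n ℝ) (T : Matrix n m ℝ) (hAT : A * T = 1) {ρ : ℝ} (hρ : 0 < ρ) :
    ∃ κ : ℝ, 0 < κ ∧ ∀ τ : ℝ, 0 < τ → τ ≤ 1 →
      ENNReal.ofReal (κ * τ ^ Fintype.card m) ≤
        volume {w : n → ℝ | ‖w‖ ≤ ρ ∧ ‖A.mulVec w‖ ≤ τ} := by
  set a : ℝ := ‖A.mulVecLin.toContinuousLinearMap‖ with ha
  set b : ℝ := ‖(T * A).mulVecLin.toContinuousLinearMap‖ with hb
  have hA : ∀ w, ‖A.mulVec w‖ ≤ a * ‖w‖ := fun w =>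
    A.mulVecLin.toContinuousLinearMap.le_opNorm w
  have hTA : ∀ w, ‖(T * A).mulVec w‖ ≤ b * ‖w‖ := fun w =>
    (T * A).mulVecLin.toContinuousLinearMap.le_opNorm w
  have ha0 : 0 ≤ a := norm_nonneg _
  have hb0 : 0 ≤ b := norm_nonneg _
  set σ : ℝ := min (1 / (1 + a)) (ρ / (1 + b)) with hσ
  have hσ0 : 0 < σ := by positivity
  have hσa : a * σ ≤ 1 := by
    have : σ ≤ 1 / (1 + a) := min_le_left _ _
    rw [le_div_iff₀ (by positivity)] at this
    nlinarith
  have hσb : (1 + b) * σ ≤ ρ := by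
    have : σ ≤ ρ / (1 + b) := min_le_right _ _
    rw [le_div_iff₀ (by positivity)] at this
    linarith
  refine ⟨(2 * σ) ^ Fintype.card n, by positivity, fun τ hτ hτ1 => ?_⟩
  set M : Matrix n n ℝ := 1 - ((1 - τ) • T) * A with hM
  have hdet : M.det = τ ^ Fintype.card m := by
    rw [hM, Matrix.det_one_sub_mul_comm, Matrix.mul_smul, hAT]
    have : (1 : Matrix m m ℝ) - (1 - τ) • 1 = τ • 1 := by
      rw [sub_smul, one_smul, sub_sub_cancel]
    rw [this, Matrix.det_smul, Matrix.det_one, mul_one]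
  have hMw : ∀ w, M.mulVec w = w - (1 - τ) • (T * A).mulVec w := fun w => by
    rw [hM, Matrix.sub_mulVec, Matrix.one_mulVec, Matrix.smul_mul, Matrix.smul_mulVec]
  have hsub : M.mulVecLin '' Metric.closedBall 0 σ ⊆
      {w : n → ℝ | ‖w‖ ≤ ρ ∧ ‖A.mulVec w‖ ≤ τ} := by
    rintro _ ⟨w, hw, rfl⟩
    rw [mem_closedBall_zero_iff] at hw
    rw [Matrix.mulVecLin_apply]
    constructor
    · rw [hMw]
      refine (norm_sub_le _ _).trans ?_
      rw [norm_smul, Real.norm_eq_abs, abs_of_nonneg (by linarith)]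
      have h1 := hTA w
      have h2 : b * ‖w‖ ≤ b * σ := by gcongr
      have h3 : (1 - τ) * ‖(T * A).mulVec w‖ ≤ 1 * ‖(T * A).mulVec w‖ := by gcongr; linarith
      linarith
    · have : A.mulVec (M.mulVec w) = τ • A.mulVec w := by
        rw [hMw, Matrix.mulVec_sub, Matrix.mulVec_smul, Matrix.mulVec_mulVec, ← Matrix.mul_assoc,
          hAT, Matrix.one_mul, sub_smul, one_smul, sub_sub_cancel]
      rw [this, norm_smul, Real.norm_eq_abs, abs_of_pos hτ]
      have h1 : ‖A.mulVec w‖ ≤ 1 := (hA w).trans (le_trans (by gcongr) hσa)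
      nlinarith
  refine le_trans (le_of_eq ?_) (measure_mono hsub)
  rw [Measure.addHaar_image_linearMap, ← Matrix.toLin'_apply', LinearMap.det_toLin', hdet,
    Real.volume_pi_closedBall _ hσ0.le, abs_of_pos (by positivity),
    ← ENNReal.ofReal_mul (by positivity), mul_comm]

section realdensity
variable {t : ℕ} {ν μ : Fin t → ℕ} {k : (l : Fin t) → Fin (ν l) → ℕ} {s : ℕ}
  {c : EqIdx t ν μ → Fin s → ℤ}

variable (k c) in
/-- The forms over the reals. -/
def Freal (y : Fin s → ℝ) (i : EqIdx t ν μ) : ℝ := ∑ j, (c i j : ℝ) * y j ^ deg t ν μ k i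

lemma continuous_Freal : Continuous (Freal k c) := by
  unfold Freal; fun_prop

lemma hasStrictFDerivAt_Freal (y : Fin s → ℝ) :
    HasStrictFDerivAt (Freal k c) (jac k c y).mulVecLin.toContinuousLinearMap y := by
  rw [hasStrictFDerivAt_pi']
  intro i
  have h := HasStrictFDerivAt.fun_sum (u := Finset.univ) fun (j : Fin s) _ =>
    (((hasStrictFDerivAt_apply (𝕜 := ℝ) j y).pow (deg t ν μ k i)).const_mul (c i j : ℝ))
  refine h.congr_fderiv ?_
  ext w
  simp [jac, Matrix.mulVec, dotProduct]
  exact Finset.sum_congr rfl fun j _ => by ring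

/-- A non-singular real zero gives many cells on which all forms are small. -/
lemma good_cells (hreal : ∃ x : Fin s → ℝ, (∀ j, 0 < x j) ∧ IsSol t ν μ k s c x ∧
      JacFullRank t ν μ k s c x) :
    ∃ κ : ℝ, 0 < κ ∧ ∀ τ : ℝ, 0 < τ → τ ≤ 1 → ∃ L₀ : ℕ, ∀ L : ℕ, L₀ ≤ L → 0 < L →
      κ * (L : ℝ) ^ s * τ ^ Fintype.card (EqIdx t ν μ) ≤
        #((Fintype.piFinset fun _ : Fin s => range L).filter fun m => ∀ y : Fin s → ℝ,
          (∀ j, (m j : ℝ) / L ≤ y j ∧ y j ≤ ((m j : ℝ) + 1) / L) →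
            ∀ i, |Freal k c y i| ≤ τ) := by
  obtain ⟨x, hx0, hx, hJ⟩ := hreal
  obtain ⟨T₀, hT₀⟩ := exists_right_inverse hJ
  set N : ℝ := 1 + ∑ j, x j with hN
  have hsum : 0 ≤ ∑ j, x j := Finset.sum_nonneg fun j _ => (hx0 j).le
  have hN0 : 0 < N := by linarith
  obtain ⟨hy, T, hT⟩ := scale_solution hx hT₀ (inv_ne_zero hN0.ne')
  set y₀ : Fin s → ℝ := fun j => N⁻¹ * x j with hy₀
  have hy01 : ∀ j, 0 < y₀ j ∧ y₀ j < 1 := by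
    intro j
    have h1 : x j ≤ ∑ j, x j := Finset.single_le_sum (fun j _ => (hx0 j).le) (Finset.mem_univ j)
    refine ⟨mul_pos (inv_pos.2 hN0) (hx0 j), ?_⟩
    rw [hy₀]
    simp only
    rw [inv_mul_lt_iff₀ hN0]
    linarith
  set A := jac k c y₀ with hA
  set Φ : (Fin s → ℝ) → (Fin s → ℝ) := fun y => y + T.mulVec (Freal k c y - A.mulVec (y - y₀))
    with hΦ
  have hF0 : Freal k c y₀ = 0 := funext hy
  have hΦ0 : Φ y₀ = y₀ := by simp [hΦ, hF0]
  have hAΦ : ∀ y, A.mulVec (Φ y - y₀) = Freal k c y := by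
    intro y
    rw [hΦ]
    simp only
    rw [add_sub_right_comm, Matrix.mulVec_add, Matrix.mulVec_mulVec, hT, Matrix.one_mulVec]
    abel
  have hder : HasStrictFDerivAt Φ (ContinuousLinearEquiv.refl ℝ (Fin s → ℝ) :
      (Fin s → ℝ) →L[ℝ] (Fin s → ℝ)) y₀ := by
    have h1 := hasStrictFDerivAt_Freal (k := k) (c := c) y₀
    have h2 : HasStrictFDerivAt (fun y => A.mulVec (y - y₀)) A.mulVecLin.toContinuousLinearMap y₀ :=
      (A.mulVecLin.toContinuousLinearMap.hasStrictFDerivAt).comp y₀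
        ((hasStrictFDerivAt_id y₀).sub_const y₀)
    have h3 := (T.mulVecLin.toContinuousLinearMap.hasStrictFDerivAt).comp y₀ (h1.sub h2)
    refine ((hasStrictFDerivAt_id y₀).add h3).congr_fderiv ?_
    rw [hA, sub_self]
    ext; simp
  have hmap := hder.map_nhds_eq_of_equiv
  rw [hΦ0] at hmap
  obtain ⟨Λ, U, hU, hLip⟩ := hder.exists_lipschitzOnWith
  have hcube : {y : Fin s → ℝ | ∀ j, 0 < y j ∧ y j < 1} ∈ nhds y₀ := by
    have : IsOpen {y : Fin s → ℝ | ∀ j, 0 < y j ∧ y j < 1} := by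
      simp only [Set.ofPred_forall]
      exact isOpen_iInter_of_finite fun j =>
        (isOpen_lt continuous_const (continuous_apply j)).inter
          (isOpen_lt (continuous_apply j) continuous_const)
    exact this.mem_nhds hy01
  set V := U ∩ {y : Fin s → ℝ | ∀ j, 0 < y j ∧ y j < 1} with hV
  have hVn : V ∈ nhds y₀ := Filter.inter_mem hU hcube
  have hΦV : Φ '' V ∈ nhds y₀ := by rw [← hmap]; exact Filter.image_mem_map hVn
  obtain ⟨ρ, hρ, hball⟩ := Metric.nhds_basis_closedBall.mem_iff.1 hΦV
  obtain ⟨κ, hκ, hslab⟩ := slab_volume_ge A T hT hρ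
  set Λ' : ℝ := Λ + 1 with hΛ'
  have hΛ0 : 0 < Λ' := by positivity
  refine ⟨κ / (2 * Λ') ^ s / 2 ^ Fintype.card (EqIdx t ν μ), by positivity, fun τ hτ hτ1 => ?_⟩
  have huc : UniformContinuousOn (Freal k c) (Set.Icc 0 1) :=
    isCompact_Icc.uniformContinuousOn_of_continuous continuous_Freal.continuousOn
  obtain ⟨δ, hδ, huc⟩ := Metric.uniformContinuousOn_iff.1 huc (τ / 2) (by positivity)
  obtain ⟨L₀, hL₀⟩ := exists_nat_gt (1 / δ)
  refine ⟨L₀, fun L hL hLpos => ?_⟩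
  have hL0 : (0 : ℝ) < L := by exact_mod_cast hLpos
  have hLδ : 1 / (L : ℝ) < δ := by
    rw [div_lt_comm₀ hL0 hδ]
    exact hL₀.trans_le (by exact_mod_cast hL)
  set cell : (Fin s → ℕ) → Set (Fin s → ℝ) := fun m =>
    {y | ∀ j, (m j : ℝ) / L ≤ y j ∧ y j ≤ ((m j : ℝ) + 1) / L} with hcell
  set G := (Fintype.piFinset fun _ : Fin s => range L).filter fun m => ∀ y : Fin s → ℝ,
    (∀ j, (m j : ℝ) / L ≤ y j ∧ y j ≤ ((m j : ℝ) + 1) / L) → ∀ i, |Freal k c y i| ≤ τ with hG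
  have hdist : ∀ m, ∀ y ∈ cell m, ∀ z ∈ cell m, dist y z ≤ 1 / L := by
    intro m y hy z hz
    rw [dist_pi_le_iff (by positivity)]
    intro j
    rw [Real.dist_eq, abs_le]
    have h1 := hy j
    have h2 := hz j
    have h3 : ((m j : ℝ) + 1) / L = (m j : ℝ) / L + 1 / L := add_div _ _ _
    constructor <;> linarith [h1.1, h1.2, h2.1, h2.2]
  have hcell01 : ∀ m ∈ Fintype.piFinset (fun _ : Fin s => range L), cell m ⊆ Set.Icc 0 1 := by
    intro m hm y hy
    have h0 : ∀ j, 0 ≤ (m j : ℝ) / L := fun j => by positivity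
    have h1 : ∀ j, ((m j : ℝ) + 1) / L ≤ 1 := fun j => by
      rw [div_le_one hL0]
      exact_mod_cast Finset.mem_range.1 (Fintype.mem_piFinset.1 hm j)
    exact ⟨fun j => (h0 j).trans (hy j).1, fun j => (hy j).2.trans (h1 j)⟩
  set W := {w : Fin s → ℝ | ‖w‖ ≤ ρ ∧ ‖A.mulVec w‖ ≤ τ / 2} with hW
  have hcov : W ⊆ ⋃ m ∈ G, (fun z => z - y₀) '' (Φ '' (V ∩ cell m)) := by
    intro w hw
    have h1 : w + y₀ ∈ Metric.closedBall y₀ ρ := by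
      rw [mem_closedBall_iff_norm, add_sub_cancel_right]; exact hw.1
    obtain ⟨y, hyV, hyw⟩ := hball h1
    have hFy : ‖Freal k c y‖ ≤ τ / 2 := by
      rw [← hAΦ, hyw, add_sub_cancel_right]; exact hw.2
    have hy1 := hyV.2
    have hyc : y ∈ cell fun j => ⌊L * y j⌋₊ := by
      intro j
      have h2 := Nat.floor_le (mul_nonneg hL0.le (hy1 j).1.le)
      have h3 := (Nat.lt_floor_add_one (L * y j)).le
      constructor
      · rw [div_le_iff₀ hL0]; linarith
      · rw [le_div_iff₀ hL0]; linarith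
    have hmem : (fun j => ⌊L * y j⌋₊) ∈ Fintype.piFinset (fun _ : Fin s => range L) := by
      rw [Fintype.mem_piFinset]
      intro j
      rw [Finset.mem_range, Nat.floor_lt (mul_nonneg hL0.le (hy1 j).1.le)]
      have := mul_lt_mul_of_pos_left (hy1 j).2 hL0
      linarith
    have hgood : (fun j => ⌊L * y j⌋₊) ∈ G := by
      rw [hG, Finset.mem_filter]
      refine ⟨hmem, fun z hz i => ?_⟩
      have h4 := huc y (hcell01 _ hmem hyc) z (hcell01 _ hmem hz)
        ((hdist _ y hyc z hz).trans_lt hLδ)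
      have h5 := (dist_le_pi_dist (Freal k c y) (Freal k c z) i).trans h4.le
      have h6 := (norm_le_pi_norm (Freal k c y) i).trans hFy
      rw [Real.dist_eq] at h5
      rw [Real.norm_eq_abs] at h6
      have h7 := abs_sub_abs_le_abs_sub (Freal k c z i) (Freal k c y i)
      rw [abs_sub_comm] at h7
      linarith
    exact Set.mem_iUnion₂.2 ⟨_, hgood, w + y₀, ⟨y, ⟨hyV, hyc⟩, hyw⟩, add_sub_cancel_right _ _⟩
  have hpiece : ∀ m, volume ((fun z => z - y₀) '' (Φ '' (V ∩ cell m))) ≤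
      ENNReal.ofReal ((2 * (Λ' / L)) ^ s) := by
    intro m
    rcases (V ∩ cell m).eq_empty_or_nonempty with h | ⟨y, hyV, hyc⟩
    · rw [h]; simp
    · have : (fun z => z - y₀) '' (Φ '' (V ∩ cell m)) ⊆
          Metric.closedBall (Φ y - y₀) (Λ' / L) := by
        rintro _ ⟨_, ⟨z, ⟨hzV, hzc⟩, rfl⟩, rfl⟩
        rw [Metric.mem_closedBall, dist_sub_right]
        refine (hLip.dist_le_mul z hzV.1 y hyV.1).trans ?_
        have h1 := hdist m z hzc y hyc
        calc (Λ : ℝ) * dist z y ≤ Λ * (1 / L) := by gcongr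
          _ ≤ Λ' / L := by rw [mul_one_div]; gcongr; linarith
      refine (measure_mono this).trans ?_
      rw [Real.volume_pi_closedBall _ (by positivity), Fintype.card_fin]
  have hvol := (hslab (τ / 2) (by positivity) (by linarith)).trans (measure_mono hcov)
  have h8 := hvol.trans ((measure_biUnion_finset_le _ _).trans
    (Finset.sum_le_card_nsmul _ _ _ fun m _ => hpiece m))
  rw [nsmul_eq_mul, ← ENNReal.ofReal_natCast, ← ENNReal.ofReal_mul (by positivity),
    ENNReal.ofReal_le_ofReal_iff (by positivity)] at h8
  rw [div_pow, mul_pow, div_pow] at h8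
  rw [div_mul_eq_mul_div, div_mul_eq_mul_div, div_mul_eq_mul_div, div_mul_eq_mul_div, div_div,
    div_le_iff₀ (by positivity)]
  have h9 : κ * (τ ^ Fintype.card (EqIdx t ν μ) / 2 ^ Fintype.card (EqIdx t ν μ)) * (L : ℝ) ^ s *
      2 ^ Fintype.card (EqIdx t ν μ) ≤ #G * (2 ^ s * (Λ' ^ s / (L : ℝ) ^ s)) * (L : ℝ) ^ s *
        2 ^ Fintype.card (EqIdx t ν μ) := by gcongr
  calc _ = _ := ?_
    _ ≤ _ := h9
    _ = _ := ?_
  · field_simp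
  · field_simp
    rw [mul_pow]
    ring

end realdensity

lemma Equi.cell_count {A : ℕ → Finset ℕ} (hA : Equi A) : ∃ κ : ℝ, 0 < κ ∧ ∀ L Q : ℕ, 0 < L → 0 < Q →
    ∀ᶠ P : ℕ in atTop, ∀ m < L, ∀ b : ℕ, κ * P / (L * Q) ≤
      #((A P).filter fun n : ℕ => ((m : ℝ) / L * P ≤ n ∧ (n : ℝ) ≤ ((m : ℝ) + 1) / L * P ∧
        ⌊(m * P / L : ℝ)⌋₊ < n ∧ n ≤ ⌊((m + 1) * P / L : ℝ)⌋₊) ∧ n ≡ b [MOD Q]) := by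
  obtain ⟨-, D, κ, hκ, hD, h⟩ := hA
  refine ⟨κ / 2, by positivity, fun L Q hL hQ => ?_⟩
  have hL0 : (0 : ℝ) < L := by exact_mod_cast hL
  have hQ0 : (0 : ℝ) < Q := by exact_mod_cast hQ
  filter_upwards [hD, h (κ / (8 * (L * Q))) (by positivity) Q hQ, eventually_ge_atTop (4 * L)]
    with P h1 h2 h3 m hm b
  have hP4 : (4 * L : ℝ) ≤ P := by exact_mod_cast h3
  have hP0 : (0 : ℝ) < P := by linarith
  set x₁ := ⌊(m * P / L : ℝ)⌋₊ with hx₁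
  set x₂ := ⌊((m + 1) * P / L : ℝ)⌋₊ with hx₂
  have hm1 : (m : ℝ) + 1 ≤ L := by exact_mod_cast hm
  have hx₂P : x₂ ≤ P := by
    refine Nat.floor_le_of_le ?_
    rw [div_le_iff₀ hL0, mul_comm]
    gcongr
  have hx12 : x₁ ≤ x₂ := Nat.floor_le_floor (by gcongr; linarith)
  have e1 := abs_le.1 (h2 x₁ (hx12.trans hx₂P) b)
  have e2 := abs_le.1 (h2 x₂ hx₂P b)
  have hf1 : (x₁ : ℝ) ≤ m * P / L := Nat.floor_le (by positivity)
  have hf1' := Nat.lt_floor_add_one (m * P / L : ℝ)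
  have hf2 : (x₂ : ℝ) ≤ (m + 1) * P / L := Nat.floor_le (by positivity)
  have hf2' := Nat.lt_floor_add_one ((m + 1) * P / L : ℝ)
  rw [← hx₁] at hf1'
  rw [← hx₂] at hf2'
  have hcard : (#((A P).filter fun n => n ≤ x₂ ∧ n ≡ b [MOD Q]) : ℝ) ≤
      #((A P).filter fun n => n ≤ x₁ ∧ n ≡ b [MOD Q]) +
      #((A P).filter fun n : ℕ => ((m : ℝ) / L * P ≤ n ∧ (n : ℝ) ≤ ((m : ℝ) + 1) / L * P ∧
        x₁ < n ∧ n ≤ x₂) ∧ n ≡ b [MOD Q]) := by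
    rw [← Nat.cast_add, Nat.cast_le]
    refine le_trans (Finset.card_le_card ?_) (Finset.card_union_le _ _)
    intro n hn
    rw [Finset.mem_filter] at hn
    rw [Finset.mem_union, Finset.mem_filter, Finset.mem_filter]
    rcases le_or_gt n x₁ with h4 | h4
    · exact Or.inl ⟨hn.1, h4, hn.2.2⟩
    · refine Or.inr ⟨hn.1, ⟨?_, ?_, h4, hn.2.1⟩, hn.2.2⟩
      · have : (x₁ : ℝ) + 1 ≤ n := by exact_mod_cast h4
        rw [div_mul_eq_mul_div]
        linarith
      · have : (n : ℝ) ≤ x₂ := by exact_mod_cast hn.2.1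
        rw [div_mul_eq_mul_div]
        linarith
  have hlen : (P : ℝ) / L - 1 ≤ (x₂ : ℝ) - x₁ := by
    have : ((m : ℝ) + 1) * P / L = m * P / L + P / L := by ring
    linarith
  have hPL : 4 ≤ (P : ℝ) / L := by rw [le_div_iff₀ hL0]; exact hP4
  have hD0 : 0 ≤ D P := hκ.le.trans h1
  have h5 : κ * (3 / 4 * (P / L)) / Q ≤ D P * ((x₂ : ℝ) - x₁) / Q := by
    gcongr
    linarith only [hlen, hPL]
  have h6 : κ * (3 / 4 * (P / L)) / Q = 3 / 4 * (κ * P / (L * Q)) := by field_simp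
  have h7 : κ / (8 * (L * Q)) * P = 1 / 8 * (κ * P / (L * Q)) := by field_simp
  have h8 : κ / 2 * P / (L * Q) = 1 / 2 * (κ * P / (L * Q)) := by field_simp
  have h9 : D P * ((x₂ : ℝ) - x₁) / Q = D P * x₂ / Q - D P * x₁ / Q := by ring
  rw [h7] at e1 e2
  rw [h8]
  linarith [e1.2, e2.1]

section counting
variable {t : ℕ} {ν μ : Fin t → ℕ} {k : (l : Fin t) → Fin (ν l) → ℕ} {s : ℕ}
  {c : EqIdx t ν μ → Fin s → ℤ}

lemma dvd_Fval_congr {Q : ℕ} {x y : Fin s → ℕ} (h : ∀ j, x j ≡ y j [MOD Q]) (i : EqIdx t ν μ) :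
    (Q : ℤ) ∣ Fval k c x i ↔ (Q : ℤ) ∣ Fval k c y i := by
  refine Int.ModEq.dvd_iff (n := Q) ?_
  unfold Fval
  exact Int.ModEq.sum fun j _ => ((Int.natCast_modEq_iff.2 (h j)).pow _).mul_left _

lemma Freal_div (x : Fin s → ℕ) {P : ℕ} (hP : 0 < P) (i : EqIdx t ν μ) :
    Freal k c (fun j => (x j : ℝ) / P) i * (P : ℝ) ^ deg t ν μ k i = Fval k c x i := by
  have hP0 : (P : ℝ) ≠ 0 := by exact_mod_cast hP.ne'
  unfold Freal Fval
  rw [Finset.sum_mul]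
  push_cast
  refine Finset.sum_congr rfl fun j _ => ?_
  rw [div_pow, mul_assoc, div_mul_cancel₀ _ (pow_ne_zero _ hP0)]

/-- Many points at which all forms are small and divisible by `Q`. -/
lemma many_small_values {A : Fin s → ℕ → Finset ℕ} (hA : ∀ j, Equi (A j))
    (hreal : ∃ x : Fin s → ℝ, (∀ j, 0 < x j) ∧ IsSol t ν μ k s c x ∧ JacFullRank t ν μ k s c x) :
    ∃ κ : ℝ, 0 < κ ∧ ∀ Q : ℕ, 0 < Q → ∀ τ : ℝ, 0 < τ → τ ≤ 1 → ∀ᶠ P : ℕ in atTop,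
      κ * (zsol k c Q / (Q : ℝ) ^ s) * τ ^ Fintype.card (EqIdx t ν μ) * (P : ℝ) ^ s ≤
        #((Fintype.piFinset fun j => A j P).filter fun x => ∀ i, (Q : ℤ) ∣ Fval k c x i ∧
          |(Fval k c x i : ℝ)| ≤ τ * (P : ℝ) ^ deg t ν μ k i) := by
  obtain ⟨κ₁, hκ₁, hgood⟩ := good_cells hreal
  choose κ₂ hκ₂ hcount using fun j => (hA j).cell_count
  refine ⟨κ₁ * ∏ j, κ₂ j, mul_pos hκ₁ (Finset.prod_pos fun j _ => hκ₂ j),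
    fun Q hQ τ hτ hτ1 => ?_⟩
  obtain ⟨L₀, hL₀⟩ := hgood τ hτ hτ1
  set L := L₀ + 1 with hL
  have hLpos : 0 < L := Nat.succ_pos _
  have hG := hL₀ L (Nat.le_succ _) hLpos
  set G := (Fintype.piFinset fun _ : Fin s => range L).filter fun m => ∀ y : Fin s → ℝ,
    (∀ j, (m j : ℝ) / L ≤ y j ∧ y j ≤ ((m j : ℝ) + 1) / L) → ∀ i, |Freal k c y i| ≤ τ
  set Z := (Fintype.piFinset fun _ : Fin s => range Q).filter fun x => ∀ i, (Q : ℤ) ∣ Fval k c x i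
    with hZ
  have hL0 : (0 : ℝ) < L := by exact_mod_cast hLpos
  have hQ0 : (0 : ℝ) < Q := by exact_mod_cast hQ
  filter_upwards [eventually_all.2 fun j => hcount j L Q hLpos hQ, eventually_gt_atTop 0]
    with P h1 hP
  have hP0 : (0 : ℝ) < P := by exact_mod_cast hP
  set cell : Fin s → ℕ → ℕ → Finset ℕ := fun j m b => (A j P).filter fun n =>
    ((m : ℝ) / L * P ≤ n ∧ (n : ℝ) ≤ ((m : ℝ) + 1) / L * P ∧
      ⌊(m * P / L : ℝ)⌋₊ < n ∧ n ≤ ⌊((m + 1) * P / L : ℝ)⌋₊) ∧ n ≡ b [MOD Q] with hcell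
  set B : (Fin s → ℕ) × (Fin s → ℕ) → Finset (Fin s → ℕ) := fun z =>
    Fintype.piFinset fun j => cell j (z.1 j) (z.2 j) with hB
  set X := (Fintype.piFinset fun j => A j P).filter fun x => ∀ i, (Q : ℤ) ∣ Fval k c x i ∧
    |(Fval k c x i : ℝ)| ≤ τ * (P : ℝ) ^ deg t ν μ k i with hX
  have hsub : (G ×ˢ Z).biUnion B ⊆ X := by
    intro x hx
    obtain ⟨z, hz, hxz⟩ := Finset.mem_biUnion.1 hx
    rw [Finset.mem_product, Finset.mem_filter, Finset.mem_filter] at hz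
    have hxz' : ∀ j, x j ∈ cell j (z.1 j) (z.2 j) := Fintype.mem_piFinset.1 hxz
    have hxc := fun j => Finset.mem_filter.1 (hxz' j)
    rw [hX, Finset.mem_filter, Fintype.mem_piFinset]
    refine ⟨fun j => (hxc j).1, fun i => ⟨?_, ?_⟩⟩
    · exact (dvd_Fval_congr (fun j => (hxc j).2.2) i).2 (hz.2.2 i)
    · rw [← Freal_div x hP, abs_mul, abs_of_pos (a := (P : ℝ) ^ _) (by positivity)]
      gcongr
      refine hz.1.2 _ (fun j => ⟨?_, ?_⟩) i
      · rw [le_div_iff₀ hP0]; exact (hxc j).2.1.1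
      · rw [div_le_iff₀ hP0]; exact (hxc j).2.1.2.1
  have hdisj : ((G ×ˢ Z : Finset _) : Set _).PairwiseDisjoint B := by
    intro z hz w hw hne
    rw [Function.onFun, Finset.disjoint_left]
    intro x hxz hxw
    refine hne ?_
    have hxz' := fun j => (Finset.mem_filter.1 (Fintype.mem_piFinset.1 hxz j)).2
    have hxw' := fun j => (Finset.mem_filter.1 (Fintype.mem_piFinset.1 hxw j)).2
    rw [Finset.mem_coe, Finset.mem_product, Finset.mem_filter, Finset.mem_filter] at hz hw
    have key : ∀ a b : ℕ, a < b → ⌊((a + 1) * P / L : ℝ)⌋₊ ≤ ⌊(b * P / L : ℝ)⌋₊ := by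
      intro a b hab
      refine Nat.floor_le_floor ?_
      have : (a : ℝ) + 1 ≤ b := by exact_mod_cast hab
      gcongr
    refine Prod.ext (funext fun j => ?_) (funext fun j => ?_)
    · rcases lt_trichotomy (z.1 j) (w.1 j) with h | h | h
      · have := key _ _ h
        have e1 := (hxz' j).1.2.2.2
        have e2 := (hxw' j).1.2.2.1
        omega
      · exact h
      · have := key _ _ h
        have e1 := (hxw' j).1.2.2.2
        have e2 := (hxz' j).1.2.2.1
        omega
    · have e1 := Finset.mem_range.1 (Fintype.mem_piFinset.1 hz.2.1 j)
      have e2 := Finset.mem_range.1 (Fintype.mem_piFinset.1 hw.2.1 j)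
      exact ((hxz' j).2.symm.trans (hxw' j).2).eq_of_lt_of_lt e1 e2
  have hBcard : ∀ z ∈ G ×ˢ Z, ∏ j, (κ₂ j * P / (L * Q)) ≤ (#(B z) : ℝ) := by
    intro z hz
    rw [Finset.mem_product, Finset.mem_filter] at hz
    rw [hB, Fintype.card_piFinset]
    push_cast
    refine Finset.prod_le_prod (fun j _ => by have := hκ₂ j; positivity) fun j _ => ?_
    exact h1 j _ (Finset.mem_range.1 (Fintype.mem_piFinset.1 hz.1.1 j)) _
  have h2 : (#(G ×ˢ Z) : ℝ) * ∏ j, (κ₂ j * P / (L * Q)) ≤ #X := by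
    calc _ = ∑ z ∈ G ×ˢ Z, ∏ j, (κ₂ j * P / (L * Q)) := by rw [Finset.sum_const, nsmul_eq_mul]
      _ ≤ ∑ z ∈ G ×ˢ Z, (#(B z) : ℝ) := Finset.sum_le_sum hBcard
      _ = #((G ×ˢ Z).biUnion B) := by rw [Finset.card_biUnion hdisj]; push_cast; rfl
      _ ≤ #X := by exact_mod_cast Finset.card_le_card hsub
  refine le_trans ?_ h2
  have h3 : ∏ j, (κ₂ j * P / (L * Q)) = (∏ j, κ₂ j) * (P : ℝ) ^ s / ((L : ℝ) ^ s * (Q : ℝ) ^ s) := by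
    rw [Finset.prod_div_distrib, Finset.prod_mul_distrib]
    simp [mul_pow]
  have h4 : 0 < ∏ j, κ₂ j := Finset.prod_pos fun j _ => hκ₂ j
  have h5 : zsol k c Q = #Z := by
    rw [zsol_eq hQ, hZ]
  rw [h3, Finset.card_product, h5]
  push_cast
  calc _ = (κ₁ * (L : ℝ) ^ s * τ ^ Fintype.card (EqIdx t ν μ)) * #Z *
        ((∏ j, κ₂ j) * (P : ℝ) ^ s / ((L : ℝ) ^ s * (Q : ℝ) ^ s)) := by field_simp
    _ ≤ _ := by gcongr

end counting

lemma one_sub_prod_le {ι : Type*} (S : Finset ι) (f : ι → ℝ) (h0 : ∀ i ∈ S, 0 ≤ f i)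
    (h1 : ∀ i ∈ S, f i ≤ 1) : 1 - ∏ i ∈ S, f i ≤ ∑ i ∈ S, (1 - f i) := by
  induction S using Finset.induction_on with
  | empty => simp
  | insert a S ha ih =>
    rw [Finset.prod_insert ha, Finset.sum_insert ha]
    have h2 := ih (fun i hi => h0 i (Finset.mem_insert_of_mem hi))
      fun i hi => h1 i (Finset.mem_insert_of_mem hi)
    have h3 : ∏ i ∈ S, f i ≤ 1 := Finset.prod_le_one
      (fun i hi => h0 i (Finset.mem_insert_of_mem hi)) fun i hi => h1 i (Finset.mem_insert_of_mem hi)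
    have h4 := h0 a (Finset.mem_insert_self _ _)
    have h5 := h1 a (Finset.mem_insert_self _ _)
    nlinarith

/-- The normalized Fejér kernel in the variable `Q * θ`. -/
def fejer (H Q : ℕ) (θ : ℝ) : ℝ := ‖∑ m ∈ range H, eC ((m * Q : ℝ) * θ)‖ ^ 2 / (H : ℝ) ^ 2

lemma continuous_fejer (H Q : ℕ) : Continuous (fejer H Q) := by
  unfold fejer; fun_prop

lemma fejer_nonneg (H Q : ℕ) (θ : ℝ) : 0 ≤ fejer H Q θ := by unfold fejer; positivity

lemma fejer_le_one (H Q : ℕ) (θ : ℝ) : fejer H Q θ ≤ 1 := by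
  unfold fejer
  refine div_le_one_of_le₀ ?_ (by positivity)
  have := norm_sum_eC_le (range H) fun m : ℕ => (m * Q : ℝ) * θ
  rw [Finset.card_range] at this
  gcongr

lemma one_sub_fejer_le {H Q : ℕ} (hH : 0 < H) (θ : ℝ) (z : ℤ) :
    1 - fejer H Q θ ≤ 4 * Real.pi * (H * |Q * θ - z|) := by
  have hH0 : (0 : ℝ) < H := by exact_mod_cast hH
  set e := |Q * θ - z| with he
  have h1 : ‖∑ m ∈ range H, eC ((m * Q : ℝ) * θ) - H‖ ≤ H * (2 * Real.pi * (H * e)) := by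
    have : ∑ m ∈ range H, eC ((m * Q : ℝ) * θ) - H =
        ∑ m ∈ range H, (eC (m * (Q * θ - z)) - 1) := by
      rw [Finset.sum_sub_distrib]
      simp only [Finset.sum_const, Finset.card_range, nsmul_eq_mul, mul_one]
      congr 1
      refine Finset.sum_congr rfl fun m _ => ?_
      rw [← eC_add_int (m * (Q * θ - z)) (m * z)]
      congr 1
      push_cast
      ring
    rw [this]
    refine (norm_sum_le _ _).trans ?_
    refine (Finset.sum_le_card_nsmul _ _ (2 * Real.pi * (H * e)) fun m hm => ?_).trans
      (by rw [Finset.card_range, nsmul_eq_mul])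
    refine (norm_eC_sub_one_le _).trans ?_
    rw [abs_mul, abs_of_nonneg (Nat.cast_nonneg m)]
    have : (m : ℝ) ≤ H := by exact_mod_cast (Finset.mem_range.1 hm).le
    gcongr
  have h2 : (H : ℝ) - H * (2 * Real.pi * (H * e)) ≤ ‖∑ m ∈ range H, eC ((m * Q : ℝ) * θ)‖ := by
    have := norm_sub_norm_le (H : ℂ) (∑ m ∈ range H, eC ((m * Q : ℝ) * θ))
    rw [norm_sub_rev, Complex.norm_natCast] at this
    linarith
  set y := ‖∑ m ∈ range H, eC ((m * Q : ℝ) * θ)‖ / H with hy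
  have h3 : 1 - 2 * Real.pi * (H * e) ≤ y := by
    rw [hy, le_div_iff₀ hH0]; linarith
  have h4 : fejer H Q θ = y ^ 2 := by rw [hy, div_pow]; rfl
  rw [h4]
  nlinarith [sq_nonneg (y - 1)]

section weighted
variable {t : ℕ} {ν μ : Fin t → ℕ} {k : (l : Fin t) → Fin (ν l) → ℕ} {s : ℕ}
  {c : EqIdx t ν μ → Fin s → ℤ}

lemma prod_fj_eq (A : Fin s → Finset ℕ) (α : EqIdx t ν μ → ℝ) :
    ∏ j, fj t ν μ k s c (A j) α j =
      ∑ x ∈ Fintype.piFinset A, eC (∑ i, (Fval k c x i : ℝ) * α i) := by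
  simp only [fj]
  rw [Finset.prod_univ_sum]
  refine Finset.sum_congr rfl fun x _ => ?_
  rw [← eC_sum, Finset.sum_comm]
  congr 1
  refine Finset.sum_congr rfl fun i _ => ?_
  simp only [Fval]
  push_cast
  rw [Finset.sum_mul]
  exact Finset.sum_congr rfl fun j _ => by ring

lemma integral_prod_fj (A : Fin s → Finset ℕ) :
    ∫ α in ubox (EqIdx t ν μ), ∏ j, fj t ν μ k s c (A j) α j =
      (#((Fintype.piFinset A).filter fun x => Fval k c x = 0) : ℂ) := by
  simp_rw [prod_fj_eq]
  exact integral_sum_eC _ _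

lemma prod_fejer_eq (H : EqIdx t ν μ → ℕ) (Q : ℕ) (α : EqIdx t ν μ → ℝ) :
    ((∏ i, fejer (H i) Q (α i) : ℝ) : ℂ) = (∏ i, (H i : ℂ) ^ 2)⁻¹ *
      ∑ z ∈ Fintype.piFinset fun i => range (H i) ×ˢ range (H i),
        eC (∑ i, (((Q : ℤ) * ((z i).1 - (z i).2) : ℤ) : ℝ) * α i) := by
  simp_rw [eC_sum]
  rw [← Finset.prod_univ_sum (fun i => range (H i) ×ˢ range (H i))
    (fun i (z : ℕ × ℕ) => eC ((((Q : ℤ) * (z.1 - z.2) : ℤ) : ℝ) * α i)), ← Finset.prod_inv_distrib,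
    ← Finset.prod_mul_distrib]
  push_cast
  refine Finset.prod_congr rfl fun i _ => ?_
  rw [fejer, Complex.ofReal_div, Complex.ofReal_pow, ← Complex.ofReal_pow,
    ← Complex.normSq_eq_norm_sq, ← Complex.mul_conj, map_sum, Finset.sum_mul_sum,
    Finset.sum_product, div_eq_inv_mul]
  push_cast
  congr 1
  refine Finset.sum_congr rfl fun m _ => Finset.sum_congr rfl fun m' _ => ?_
  rw [← eC_sub]
  congr 1
  ring

lemma card_shift_ge {H : ℕ} {a : ℤ} (ha : 2 * |a| ≤ H) :
    H ≤ 2 * #((range H ×ˢ range H).filter fun z => a + ((z.1 : ℤ) - z.2) = 0) := by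
  rw [Int.abs_eq_natAbs] at ha
  have h1 : (range (H - a.natAbs)).image (fun m => if 0 ≤ a then (m, m + a.natAbs)
      else (m + a.natAbs, m)) ⊆
      (range H ×ˢ range H).filter fun z => a + ((z.1 : ℤ) - z.2) = 0 := by
    intro z hz
    obtain ⟨m, hm, rfl⟩ := Finset.mem_image.1 hz
    rw [Finset.mem_range] at hm
    split_ifs with h <;> simp only [Finset.mem_filter, Finset.mem_product, Finset.mem_range] <;>
      omega
  have h2 := Finset.card_le_card h1
  rw [Finset.card_image_of_injective, Finset.card_range] at h2
  · omega
  · intro m m' h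
    dsimp only at h
    split_ifs at h <;> simp only [Prod.mk.injEq] at h <;> omega

/-- The weighted count of near solutions from below. -/
lemma weighted_integral_ge (A : Fin s → Finset ℕ) {H : EqIdx t ν μ → ℕ} (hH : ∀ i, 0 < H i)
    {Q : ℕ} (hQ : 0 < Q) : ∃ W : ℝ,
    ∫ α in ubox (EqIdx t ν μ), (∏ j, fj t ν μ k s c (A j) α j) *
      ((∏ i, fejer (H i) Q (α i) : ℝ) : ℂ) = (W : ℂ) ∧
    #((Fintype.piFinset A).filter fun x => ∀ i, (Q : ℤ) ∣ Fval k c x i ∧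
      2 * |Fval k c x i| ≤ Q * H i) / ∏ i, (2 * H i : ℝ) ≤ W := by
  set S := (Fintype.piFinset A) ×ˢ (Fintype.piFinset fun i => range (H i) ×ˢ range (H i))
  set φ : (Fin s → ℕ) × (EqIdx t ν μ → ℕ × ℕ) → EqIdx t ν μ → ℤ := fun w i =>
    Fval k c w.1 i + (Q : ℤ) * ((w.2 i).1 - (w.2 i).2) with hφ
  have hQ0 : (Q : ℤ) ≠ 0 := by exact_mod_cast hQ.ne'
  refine ⟨(∏ i, (H i : ℝ) ^ 2)⁻¹ * #(S.filter fun w => φ w = 0), ?_, ?_⟩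
  · have h1 : ∀ α : EqIdx t ν μ → ℝ, (∏ j, fj t ν μ k s c (A j) α j) *
        ((∏ i, fejer (H i) Q (α i) : ℝ) : ℂ) =
        (∏ i, (H i : ℂ) ^ 2)⁻¹ * ∑ w ∈ S, eC (∑ i, (φ w i : ℝ) * α i) := by
      intro α
      rw [prod_fj_eq, prod_fejer_eq, mul_left_comm, Finset.sum_mul_sum, ← Finset.sum_product']
      congr 1
      refine Finset.sum_congr rfl fun w _ => ?_
      rw [← eC_add, ← Finset.sum_add_distrib]
      congr 1
      refine Finset.sum_congr rfl fun i _ => ?_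
      rw [hφ]
      push_cast
      ring
    simp_rw [h1]
    rw [integral_const_mul, integral_sum_eC]
    push_cast
    rfl
  · set X := (Fintype.piFinset A).filter fun x => ∀ i, (Q : ℤ) ∣ Fval k c x i ∧
      2 * |Fval k c x i| ≤ Q * H i
    have h2 : ∑ x ∈ X, ∏ i, ((H i : ℝ) / 2) ≤ (#(S.filter fun w => φ w = 0) : ℝ) := by
      have h3 : ∀ x ∈ X, ∏ i, ((H i : ℝ) / 2) ≤
          #(Fintype.piFinset fun i => (range (H i) ×ˢ range (H i)).filter fun z =>
            Fval k c x i / Q + ((z.1 : ℤ) - z.2) = 0) := by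
        intro x hx
        rw [Fintype.card_piFinset]
        push_cast
        refine Finset.prod_le_prod (fun i _ => by positivity) fun i _ => ?_
        obtain ⟨hdvd, hle⟩ := (Finset.mem_filter.1 hx).2 i
        obtain ⟨a, ha⟩ := hdvd
        rw [ha, Int.mul_ediv_cancel_left _ hQ0]
        have h4 : 2 * |a| ≤ H i := by
          rw [ha, abs_mul, Nat.abs_cast, mul_left_comm] at hle
          exact le_of_mul_le_mul_left hle (by exact_mod_cast hQ)
        have h5 := card_shift_ge h4
        rw [div_le_iff₀ two_pos, mul_comm]
        exact_mod_cast h5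
      refine (Finset.sum_le_sum h3).trans ?_
      rw [← Nat.cast_sum, ← Finset.card_sigma]
      refine Nat.cast_le.2 (Finset.card_le_card_of_injOn (fun w => (w.1, w.2)) ?_ ?_)
      · intro w hw
        simp only [Finset.coe_sigma, Set.mem_sigma_iff, Finset.mem_coe, Fintype.mem_piFinset,
          Finset.mem_filter] at hw
        have hX := Finset.mem_filter.1 hw.1
        refine Finset.mem_filter.2 ⟨Finset.mem_product.2 ⟨hX.1, Fintype.mem_piFinset.2 fun i =>
          (hw.2 i).1⟩, ?_⟩
        funext i
        obtain ⟨a, ha⟩ := (hX.2 i).1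
        have h4 := (hw.2 i).2
        rw [ha, Int.mul_ediv_cancel_left _ hQ0] at h4
        rw [hφ]
        simp only [Pi.zero_apply]
        rw [ha, ← mul_add, h4, mul_zero]
      · rintro ⟨a, b⟩ _ ⟨a', b'⟩ _ h
        simp only [Prod.mk.injEq] at h
        obtain ⟨rfl, rfl⟩ := h
        rfl
    rw [Finset.sum_const, nsmul_eq_mul] at h2
    have hP : (0 : ℝ) < ∏ i, (H i : ℝ) := Finset.prod_pos fun i _ => by exact_mod_cast hH i
    rw [Finset.prod_div_distrib, Finset.prod_const] at h2
    rw [Finset.prod_mul_distrib, Finset.prod_const, Finset.prod_pow, inv_mul_eq_div,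
      div_le_div_iff₀ (by positivity) (by positivity)]
    rw [mul_div_assoc', div_le_iff₀ (by positivity)] at h2
    nlinarith

end weighted

section major
variable {t : ℕ} {ν μ : Fin t → ℕ} {k : (l : Fin t) → Fin (ν l) → ℕ} {s : ℕ}
  {c : EqIdx t ν μ → Fin s → ℤ}

lemma fj_eq_fA (A : Finset ℕ) (α : EqIdx t ν μ → ℝ) (j : Fin s) :
    fj t ν μ k s c A α j =
      fA t ν k A t fun p => ∑ m, (c ⟨p.1, (p.2, m)⟩ j : ℝ) * α ⟨p.1, (p.2, m)⟩ := by
  unfold fj fA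
  refine Finset.sum_congr rfl fun x _ => ?_
  congr 1
  rw [Fintype.sum_sigma, Fintype.sum_sigma]
  refine Finset.sum_congr rfl fun l _ => ?_
  rw [Fintype.sum_prod_type]
  refine Finset.sum_congr rfl fun n _ => ?_
  rw [if_pos l.2, Finset.sum_mul]
  rfl

/-- If all complete sums with indices in a large set are large, then the coordinates of `α` have
good rational approximations with a bounded common denominator. -/
lemma approx_of_large (hgrp : GroupedDegrees t ν μ k) (hns : HighlyNonSingular t ν μ s c)
    {T : Finset (Fin s)} (hT : ∀ l, μ l ≤ #T) {ε : ℝ} (hε : 0 < ε) :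
    ∃ Q : ℕ, 0 < Q ∧ ∃ W : ℝ, 0 ≤ W ∧ ∀ P : ℕ, 1 ≤ P → ∀ α : EqIdx t ν μ → ℝ,
      (∀ j ∈ T, ε * P ≤ ‖fj t ν μ k s c (Icc 1 P) α j‖) →
      ∀ i, ∃ z : ℤ, |Q * α i - z| * (P : ℝ) ^ deg t ν μ k i ≤ W := by
  obtain ⟨-, -, -, -, hk, hinj⟩ := hgrp
  obtain ⟨A, hA⟩ := weyl (kmax t ν k)
  set K : ℝ := max 2 (1 / ε) with hK
  have hK1 : 1 / ε ≤ K := le_max_right _ _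
  have hK0 : 0 < K := two_pos.trans_le (le_max_left _ _)
  set R : ℕ := (⌊K ^ A⌋₊).factorial with hR
  have hγ : ∀ P : ℕ, 1 ≤ P → ∀ α : EqIdx t ν μ → ℝ, ∀ j,
      ε * P ≤ ‖fj t ν μ k s c (Icc 1 P) α j‖ → ∀ p : KIdx t ν, ∃ z : ℤ,
      |R * (∑ m, (c ⟨p.1, (p.2, m)⟩ j : ℝ) * α ⟨p.1, (p.2, m)⟩) - z| * (P : ℝ) ^ k p.1 p.2 ≤
        R * K ^ A := by
    intro P hP α j hj p
    rw [fj_eq_fA] at hj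
    obtain ⟨β, hβ, hw⟩ := fA_Icc_eq_wsum hinj P t
      fun p => ∑ m, (c ⟨p.1, (p.2, m)⟩ j : ℝ) * α ⟨p.1, (p.2, m)⟩
    rw [hw] at hj
    have hPK : (P : ℝ) ≤ K * ‖wsum P (kmax t ν k) β‖ := by
      calc (P : ℝ) = 1 / ε * (ε * P) := by field_simp
        _ ≤ _ := by gcongr
    obtain ⟨q, hq1, hqK, hq⟩ := hA P K β hP (le_max_left _ _) hPK
    have hle : k p.1 p.2 ≤ kmax t ν k :=
      Finset.le_sup (f := fun p : KIdx t ν => k p.1 p.2) (Finset.mem_univ p)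
    obtain ⟨z, hz⟩ := hq (k p.1 p.2) (hk _ _) hle
    rw [hβ p p.1.2] at hz
    obtain ⟨d, hd⟩ : q ∣ R := Nat.dvd_factorial hq1 (Nat.le_floor hqK)
    have hdR : (d : ℝ) ≤ R := by
      rw [hd]; push_cast
      exact le_mul_of_one_le_left (Nat.cast_nonneg _) (by exact_mod_cast hq1)
    refine ⟨d * z, ?_⟩
    rw [hd] at hdR ⊢
    push_cast at hdR ⊢
    rw [mul_comm (q : ℝ) d, mul_assoc (d : ℝ) q, ← mul_sub, abs_mul, Nat.abs_cast, mul_assoc]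
    rw [mul_comm (q : ℝ) d] at hdR
    exact mul_le_mul hdR hz (by positivity) ((Nat.cast_nonneg _).trans hdR)
  have hi : ∀ i : EqIdx t ν μ, ∃ Q : ℕ, 0 < Q ∧ ∃ W : ℝ, 0 ≤ W ∧ ∀ P : ℕ, 1 ≤ P →
      ∀ α : EqIdx t ν μ → ℝ, (∀ j ∈ T, ε * P ≤ ‖fj t ν μ k s c (Icc 1 P) α j‖) →
      ∃ z : ℤ, |Q * α i - z| * (P : ℝ) ^ deg t ν μ k i ≤ W := by
    rintro ⟨l, n, m₀⟩
    obtain ⟨S, hST, hScard⟩ := Finset.exists_subset_card_eq (hT l)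
    set σ : Fin (μ l) → Fin s := fun m => S.orderEmbOfFin hScard m with hσ
    have hσinj : Function.Injective σ := (S.orderEmbOfFin hScard).injective
    have hσT : ∀ m, σ m ∈ T := fun m => hST (Finset.orderEmbOfFin_mem S hScard m)
    set B : Matrix (Fin (μ l)) (Fin (μ l)) ℤ := Matrix.of fun m m' => c ⟨l, (n, m)⟩ (σ m') with hB
    have hdet : B.det ≠ 0 := hns.2 l n σ hσinj
    refine ⟨R * B.det.natAbs, Nat.mul_pos (Nat.factorial_pos _) (Int.natAbs_pos.2 hdet),
      ∑ m', (R * K ^ A) * |(B.adjugate m' m₀ : ℝ)|, by positivity, fun P hP α hα => ?_⟩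
    choose z hz using fun m' => hγ P hP α (σ m') (hα _ (hσT m')) ⟨l, n⟩
    have hadj : ∑ m', (∑ m, (c ⟨l, (n, m)⟩ (σ m') : ℝ) * α ⟨l, (n, m)⟩) * (B.adjugate m' m₀ : ℝ) =
        (B.det : ℝ) * α ⟨l, (n, m₀)⟩ := by
      have h1 : ∀ m, ∑ m', (c ⟨l, (n, m)⟩ (σ m') : ℝ) * (B.adjugate m' m₀ : ℝ) =
          if m = m₀ then (B.det : ℝ) else 0 := by
        intro m
        have h2 := congrFun (congrFun (Matrix.mul_adjugate B) m) m₀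
        rw [Matrix.mul_apply, Matrix.smul_apply, Matrix.one_apply, smul_eq_mul, mul_ite, mul_one,
          mul_zero] at h2
        have h3 := congrArg (Int.cast : ℤ → ℝ) h2
        simp only [Int.cast_sum, Int.cast_mul, Int.cast_ite, Int.cast_zero] at h3
        exact h3
      simp_rw [Finset.sum_mul]
      rw [Finset.sum_comm]
      have h4 : ∀ m, ∑ m', (c ⟨l, (n, m)⟩ (σ m') : ℝ) * α ⟨l, (n, m)⟩ * (B.adjugate m' m₀ : ℝ) =
          if m = m₀ then (B.det : ℝ) * α ⟨l, (n, m)⟩ else 0 := by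
        intro m
        rw [← ite_zero_mul, ← h1, Finset.sum_mul]
        exact Finset.sum_congr rfl fun m' _ => by ring
      simp_rw [h4]
      simp
    have hmain : |R * ((B.det : ℝ) * α ⟨l, (n, m₀)⟩) - ((∑ m', z m' * B.adjugate m' m₀ : ℤ) : ℝ)| *
        (P : ℝ) ^ k l n ≤ ∑ m', (R * K ^ A) * |(B.adjugate m' m₀ : ℝ)| := by
      rw [← hadj, Finset.mul_sum]
      push_cast
      rw [← Finset.sum_sub_distrib]
      refine (mul_le_mul_of_nonneg_right (Finset.abs_sum_le_sum_abs _ _) (by positivity)).trans ?_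
      rw [Finset.sum_mul]
      refine Finset.sum_le_sum fun m' _ => ?_
      rw [← mul_assoc, ← sub_mul, abs_mul, mul_right_comm]
      exact mul_le_mul_of_nonneg_right (hz m') (abs_nonneg _)
    have hcast : ((B.det.natAbs : ℕ) : ℝ) = |(B.det : ℝ)| := by
      rw [Nat.cast_natAbs, Int.cast_abs]
    push_cast
    rw [hcast]
    rcases abs_choice (B.det : ℝ) with h | h <;> rw [h]
    · refine ⟨∑ m', z m' * B.adjugate m' m₀, le_trans (le_of_eq ?_) hmain⟩
      rw [mul_assoc]
      rfl
    · refine ⟨-∑ m', z m' * B.adjugate m' m₀, le_trans (le_of_eq ?_) hmain⟩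
      rw [← abs_neg]
      push_cast
      congr 2
      ring
  choose q hq W hW hqW using hi
  refine ⟨∏ i, q i, Finset.prod_pos fun i _ => hq i, ∑ i, (∏ i, q i : ℕ) * W i,
    Finset.sum_nonneg fun i _ => mul_nonneg (Nat.cast_nonneg _) (hW i), fun P hP α hα i => ?_⟩
  obtain ⟨z, hz⟩ := hqW i P hP α hα
  obtain ⟨d, hd⟩ := Finset.dvd_prod_of_mem q (Finset.mem_univ i)
  refine ⟨d * z, ?_⟩
  have h1 : ((∏ i, q i : ℕ) : ℝ) * W i ≤ ∑ i, ((∏ i, q i : ℕ) : ℝ) * W i :=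
    Finset.single_le_sum (f := fun i => ((∏ i, q i : ℕ) : ℝ) * W i)
      (fun i _ => mul_nonneg (Nat.cast_nonneg _) (hW i)) (Finset.mem_univ i)
  refine le_trans ?_ h1
  rw [hd]
  push_cast
  rw [mul_comm (q i : ℝ) d, mul_assoc (d : ℝ) (q i), ← mul_sub, abs_mul, Nat.abs_cast, mul_assoc,
    mul_assoc]
  have h2 : (1 : ℝ) ≤ q i := by exact_mod_cast hq i
  have h3 : W i ≤ q i * W i := le_mul_of_one_le_left (hW i) h2
  exact mul_le_mul_of_nonneg_left (hz.trans h3) (Nat.cast_nonneg _)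

end major

section count
variable {t : ℕ} {ν μ : Fin t → ℕ} {k : (l : Fin t) → Fin (ν l) → ℕ} {s : ℕ}
  {c : EqIdx t ν μ → Fin s → ℤ}

lemma norm_fj_le_of_subset {A : Finset ℕ} {P : ℕ} (hA : A ⊆ Icc 1 P) (α : EqIdx t ν μ → ℝ)
    (j : Fin s) : ‖fj t ν μ k s c A α j‖ ≤ P := by
  refine (norm_fj_le A α j).trans ?_
  have h := Finset.card_le_card hA
  rw [Nat.card_Icc, Nat.add_sub_cancel] at h
  exact_mod_cast h

lemma norm_prod_fj_mul_le {A : Fin s → Finset ℕ} {P : ℕ} {J : Finset (Fin s)}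
    (hA : ∀ j, A j ⊆ Icc 1 P) (hAJ : ∀ j ∈ Jᶜ, A j = Icc 1 P) {ε w : ℝ} (hw0 : 0 ≤ w)
    (hw1 : w ≤ 1) (α : EqIdx t ν μ → ℝ)
    (h : (∀ j ∈ Jᶜ, ε * P ≤ ‖fj t ν μ k s c (Icc 1 P) α j‖) → w ≤ ε) :
    (∏ j, ‖fj t ν μ k s c (A j) α j‖) * w ≤
      ε * (P : ℝ) ^ #Jᶜ * ∏ j ∈ J, ‖fj t ν μ k s c (A j) α j‖ := by
  rw [← Finset.prod_mul_prod_compl J, mul_assoc, mul_comm]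
  refine mul_le_mul_of_nonneg_right ?_ (Finset.prod_nonneg fun _ _ => norm_nonneg _)
  have hb : ∀ S : Finset (Fin s), ∏ j ∈ S, ‖fj t ν μ k s c (A j) α j‖ ≤ (P : ℝ) ^ #S := fun S =>
    (Finset.prod_le_prod (fun _ _ => norm_nonneg _)
      fun j _ => norm_fj_le_of_subset (hA j) α j).trans_eq (Finset.prod_const _)
  by_cases hl : ∀ j ∈ Jᶜ, ε * P ≤ ‖fj t ν μ k s c (Icc 1 P) α j‖
  · rw [mul_comm]
    exact mul_le_mul (h hl) (hb _) (Finset.prod_nonneg fun _ _ => norm_nonneg _) (hw0.trans (h hl))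
  · push Not at hl
    obtain ⟨j₀, hj₀, hlt⟩ := hl
    rw [← hAJ j₀ hj₀] at hlt
    refine (mul_le_of_le_one_right (Finset.prod_nonneg fun _ _ => norm_nonneg _) hw1).trans ?_
    rw [← Finset.mul_prod_erase _ _ hj₀, ← Finset.card_erase_add_one hj₀, pow_succ',
      ← mul_assoc]
    exact mul_le_mul hlt.le (hb _) (Finset.prod_nonneg fun _ _ => norm_nonneg _)
      ((norm_nonneg _).trans hlt.le)

lemma le_card_zeros_add {A : Fin s → Finset ℕ} {P : ℕ} {J : Finset (Fin s)}
    (hA : ∀ j, A j ⊆ Icc 1 P) (hAJ : ∀ j ∈ Jᶜ, A j = Icc 1 P) {ε : ℝ}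
    {H : EqIdx t ν μ → ℕ} (hH : ∀ i, 0 < H i) {Q : ℕ} (hQ : 0 < Q)
    (h : ∀ α : EqIdx t ν μ → ℝ, (∀ j ∈ Jᶜ, ε * P ≤ ‖fj t ν μ k s c (Icc 1 P) α j‖) →
      1 - ∏ i, fejer (H i) Q (α i) ≤ ε) :
    #((Fintype.piFinset A).filter fun x =>
        ∀ i, (Q : ℤ) ∣ Fval k c x i ∧ 2 * |Fval k c x i| ≤ Q * H i) / ∏ i, (2 * H i : ℝ) ≤
      #((Fintype.piFinset A).filter fun x => Fval k c x = 0) +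
        ε * (P : ℝ) ^ #Jᶜ * ∫ α in ubox (EqIdx t ν μ), ∏ j ∈ J, ‖fj t ν μ k s c (A j) α j‖ := by
  obtain ⟨W, hW, hWle⟩ := weighted_integral_ge (k := k) (c := c) A hH hQ
  refine hWle.trans ?_
  have hc : Continuous fun α : EqIdx t ν μ → ℝ => ∏ j, fj t ν μ k s c (A j) α j :=
    continuous_finsetProd _ fun j _ => continuous_fj (A j) j
  have hg : Continuous fun α : EqIdx t ν μ → ℝ => ∏ i, fejer (H i) Q (α i) :=
    continuous_finsetProd _ fun i _ => (continuous_fejer _ _).comp (continuous_apply i)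
  have hcJ : Continuous fun α : EqIdx t ν μ → ℝ => ∏ j ∈ J, ‖fj t ν μ k s c (A j) α j‖ :=
    continuous_finsetProd _ fun j _ => (continuous_fj (A j) j).norm
  have hcg : Continuous fun α : EqIdx t ν μ → ℝ => (∏ j, fj t ν μ k s c (A j) α j) *
      ((∏ i, fejer (H i) Q (α i) : ℝ) : ℂ) := hc.mul (Complex.continuous_ofReal.comp hg)
  have hsub : (W : ℂ) - (#((Fintype.piFinset A).filter fun x => Fval k c x = 0) : ℂ) =
      -∫ α in ubox (EqIdx t ν μ), (∏ j, fj t ν μ k s c (A j) α j) *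
        ((1 - ∏ i, fejer (H i) Q (α i) : ℝ) : ℂ) := by
    rw [← hW, ← integral_prod_fj A, ← neg_sub, ← integral_sub (integrableOn_ubox hc)
      (integrableOn_ubox hcg)]
    congr 1
    refine integral_congr_ae (Eventually.of_forall fun α => ?_)
    change _ = _ * _
    push_cast
    ring
  have hnorm : W - #((Fintype.piFinset A).filter fun x => Fval k c x = 0) ≤
      ‖(W : ℂ) - (#((Fintype.piFinset A).filter fun x => Fval k c x = 0) : ℂ)‖ := by
    have := Complex.re_le_norm ((W : ℂ) -
      (#((Fintype.piFinset A).filter fun x => Fval k c x = 0) : ℂ))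
    simpa using this
  rw [hsub, norm_neg] at hnorm
  rw [← sub_le_iff_le_add']
  refine hnorm.trans ?_
  rw [← integral_const_mul]
  refine norm_integral_le_of_norm_le (integrableOn_ubox (continuous_const.mul hcJ))
    (Eventually.of_forall fun α => ?_)
  have h0 : 0 ≤ ∏ i, fejer (H i) Q (α i) := Finset.prod_nonneg fun _ _ => fejer_nonneg _ _ _
  have h1 : ∏ i, fejer (H i) Q (α i) ≤ 1 :=
    Finset.prod_le_one (fun _ _ => fejer_nonneg _ _ _) fun _ _ => fejer_le_one _ _ _
  rw [norm_mul, norm_prod, Complex.norm_real, Real.norm_of_nonneg (by linarith)]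
  exact norm_prod_fj_mul_le hA hAJ (by linarith) (by linarith) α (h α)

lemma one_sub_prod_fejer_le {H : EqIdx t ν μ → ℕ} (hH : ∀ i, 0 < H i) {Q P : ℕ} {V W : ℝ}
    (hV : 0 < V) (hHV : ∀ i, (H i : ℝ) ≤ (P : ℝ) ^ deg t ν μ k i / V) {α : EqIdx t ν μ → ℝ}
    (h : ∀ i, ∃ z : ℤ, |Q * α i - z| * (P : ℝ) ^ deg t ν μ k i ≤ W) :
    1 - ∏ i, fejer (H i) Q (α i) ≤ Fintype.card (EqIdx t ν μ) * (4 * Real.pi * W) / V := by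
  refine (one_sub_prod_le _ _ (fun _ _ => fejer_nonneg _ _ _)
    fun _ _ => fejer_le_one _ _ _).trans ?_
  rw [mul_div_assoc, ← nsmul_eq_mul, ← Finset.card_univ]
  refine Finset.sum_le_card_nsmul _ _ _ fun i _ => ?_
  obtain ⟨z, hz⟩ := h i
  refine (one_sub_fejer_le (hH i) (α i) z).trans ?_
  rw [mul_div_assoc]
  refine mul_le_mul_of_nonneg_left ?_ (by positivity)
  calc (H i : ℝ) * |Q * α i - z| ≤ (P : ℝ) ^ deg t ν μ k i / V * |Q * α i - z| := by
        gcongr; exact hHV i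
    _ = |Q * α i - z| * (P : ℝ) ^ deg t ν μ k i / V := by ring
    _ ≤ W / V := by gcongr

/-- The hypotheses guarantee that the box of side `P` contains a positive proportion of the
expected number of solutions, and in particular at least one. -/
lemma exists_zero_of_mean_value (hgrp : GroupedDegrees t ν μ k)
    (hns : HighlyNonSingular t ν μ s c)
    (hreal : ∃ x : Fin s → ℝ, (∀ j, 0 < x j) ∧ IsSol t ν μ k s c x ∧ JacFullRank t ν μ k s c x)
    {A : ℕ → Finset ℕ} (hA : Equi A) {J : Finset (Fin s)} (hJ : mu1 t μ 1 ≤ #Jᶜ) {C χ₀ : ℝ}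
    (hC0 : 0 ≤ C)
    (hC : ∀ᶠ P : ℕ in atTop, ∫ α in ubox (EqIdx t ν μ), ∏ j ∈ J, ‖fj t ν μ k s c (A P) α j‖ ≤
      C * (P : ℝ) ^ #J / (P : ℝ) ^ Ktot t ν μ k)
    (hχ₀ : 0 < χ₀) (hχ : ∀ Q, 0 < Q → χ₀ ≤ chi k c Q) :
    ∃ x : Fin s → ℕ, (∀ j, 0 < x j) ∧ Fval k c x = 0 := by
  set r := Fintype.card (EqIdx t ν μ) with hr
  have hkpos : ∀ i, 0 < deg t ν μ k i := fun i => hgrp.2.2.2.2.1 _ _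
  set B : Fin s → ℕ → Finset ℕ := fun j => if j ∈ J then A else fun P => Icc 1 P with hBdef
  have hB : ∀ j, Equi (B j) := fun j => by
    simp only [hBdef]
    split_ifs
    exacts [hA, equi_complete]
  obtain ⟨κ, hκ, hmany⟩ := many_small_values (k := k) (c := c) hB hreal
  set c₀ := κ * χ₀ / 8 ^ r with hc₀
  have hc₀pos : 0 < c₀ := by positivity
  set ε := c₀ / (2 * (C + 1)) with hε
  have hεpos : 0 < ε := by positivity
  obtain ⟨Q, hQ, W, hW, happ⟩ := approx_of_large hgrp hns
    (fun l => (le_mu1_one hgrp.2.2.2.1 l).trans hJ) hεpos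
  set V : ℝ := max 1 (max Q (r * (4 * Real.pi * W) / ε)) with hVdef
  have hV1 : 1 ≤ V := le_max_left _ _
  have hVQ : (Q : ℝ) ≤ V := (le_max_left _ _).trans (le_max_right _ _)
  have hVW : r * (4 * Real.pi * W) / V ≤ ε := by
    have h : r * (4 * Real.pi * W) / ε ≤ V := (le_max_right _ _).trans (le_max_right _ _)
    rw [div_le_iff₀ hεpos] at h
    rw [div_le_iff₀ (by positivity)]
    linarith
  have hQ1 : (1 : ℝ) ≤ Q := by exact_mod_cast hQ
  have hτ : (0 : ℝ) < Q / (4 * V) := by positivity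
  have hτ1 : (Q : ℝ) / (4 * V) ≤ 1 := by
    rw [div_le_one (by positivity)]
    linarith
  obtain ⟨P, hP1, hPV, hPC, hPM⟩ := ((eventually_ge_atTop 1).and
    ((eventually_ge_atTop ⌈2 * V⌉₊).and (hC.and (hmany Q hQ _ hτ hτ1)))).exists
  have hP1' : (1 : ℝ) ≤ P := by exact_mod_cast hP1
  have hPV' : 2 * V ≤ P := (Nat.le_ceil _).trans (by exact_mod_cast hPV)
  have hPd : ∀ i, 2 * V ≤ (P : ℝ) ^ deg t ν μ k i := fun i =>
    hPV'.trans (le_self_pow₀ hP1' (hkpos i).ne')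
  set H : EqIdx t ν μ → ℕ := fun i => ⌊(P : ℝ) ^ deg t ν μ k i / V⌋₊ with hH
  have hHle : ∀ i, (H i : ℝ) ≤ (P : ℝ) ^ deg t ν μ k i / V := fun i =>
    Nat.floor_le (by positivity)
  have hHge : ∀ i, (P : ℝ) ^ deg t ν μ k i / (2 * V) ≤ H i := fun i => by
    have h1 := Nat.lt_floor_add_one ((P : ℝ) ^ deg t ν μ k i / V)
    have h2 : 1 ≤ (P : ℝ) ^ deg t ν μ k i / (2 * V) := by
      rw [one_le_div (by positivity)]; exact hPd i
    have h3 : (P : ℝ) ^ deg t ν μ k i / V = 2 * ((P : ℝ) ^ deg t ν μ k i / (2 * V)) := by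
      field_simp
    change _ ≤ ((⌊(P : ℝ) ^ deg t ν μ k i / V⌋₊ : ℕ) : ℝ)
    linarith
  have hHpos : ∀ i, 0 < H i := fun i => by
    have h2 : 0 < (P : ℝ) ^ deg t ν μ k i / (2 * V) := by positivity
    exact_mod_cast h2.trans_le (hHge i)
  have hBJ : ∀ j ∈ Jᶜ, B j P = Icc 1 P := fun j hj => by
    simp only [hBdef, if_neg (Finset.mem_compl.1 hj)]
  have key := le_card_zeros_add (k := k) (c := c) (A := fun j => B j P) (J := J)
    (fun j => (hB j).1 P) hBJ hHpos hQ
    fun α hα => (one_sub_prod_fejer_le hHpos (by positivity) hHle (happ P hP1 α hα)).trans hVW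
  have hInt : ∫ α in ubox (EqIdx t ν μ), ∏ j ∈ J, ‖fj t ν μ k s c (B j P) α j‖ ≤
      C * (P : ℝ) ^ #J / (P : ℝ) ^ Ktot t ν μ k := by
    refine le_trans (le_of_eq ?_) hPC
    refine integral_congr_ae (Eventually.of_forall fun α => ?_)
    exact Finset.prod_congr rfl fun j hj => by simp only [hBdef, if_pos hj]
  have hPK : (0 : ℝ) < (P : ℝ) ^ s / (P : ℝ) ^ Ktot t ν μ k := by positivity
  have herr : ε * (P : ℝ) ^ #Jᶜ *
      ∫ α in ubox (EqIdx t ν μ), ∏ j ∈ J, ‖fj t ν μ k s c (B j P) α j‖ <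
      c₀ * ((P : ℝ) ^ s / (P : ℝ) ^ Ktot t ν μ k) := by
    have hcard : #Jᶜ + #J = s := by
      rw [add_comm, Finset.card_add_card_compl, Fintype.card_fin]
    calc _ ≤ ε * (P : ℝ) ^ #Jᶜ * (C * (P : ℝ) ^ #J / (P : ℝ) ^ Ktot t ν μ k) := by gcongr
      _ = ε * C * ((P : ℝ) ^ (#Jᶜ + #J) / (P : ℝ) ^ Ktot t ν μ k) := by rw [pow_add]; ring
      _ = ε * C * ((P : ℝ) ^ s / (P : ℝ) ^ Ktot t ν μ k) := by rw [hcard]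
      _ < _ := by
        refine mul_lt_mul_of_pos_right ?_ hPK
        have h : ε * (2 * (C + 1)) = c₀ := div_mul_cancel₀ _ (by positivity)
        nlinarith
  have hmain : c₀ * ((P : ℝ) ^ s / (P : ℝ) ^ Ktot t ν μ k) ≤
      #((Fintype.piFinset fun j => B j P).filter fun x =>
        ∀ i, (Q : ℤ) ∣ Fval k c x i ∧ 2 * |Fval k c x i| ≤ Q * H i) / ∏ i, (2 * H i : ℝ) := by
    have hprod : ∏ i, (2 * H i : ℝ) ≤ (2 / V) ^ r * (P : ℝ) ^ Ktot t ν μ k := by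
      calc ∏ i, (2 * H i : ℝ) ≤ ∏ i, (2 / V * (P : ℝ) ^ deg t ν μ k i) := by
            refine Finset.prod_le_prod (fun i _ => by positivity) fun i _ => ?_
            calc 2 * (H i : ℝ) ≤ 2 * ((P : ℝ) ^ deg t ν μ k i / V) := by gcongr; exact hHle i
              _ = _ := by ring
        _ = _ := by
            rw [Finset.prod_mul_distrib, Finset.prod_const, Finset.card_univ,
              Finset.prod_pow_eq_pow_sum]
            rfl
    have hHprod : 0 < ∏ i, (2 * H i : ℝ) :=
      Finset.prod_pos fun i _ => by have := hHpos i; positivity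
    rw [le_div_iff₀ hHprod]
    calc c₀ * ((P : ℝ) ^ s / (P : ℝ) ^ Ktot t ν μ k) * ∏ i, (2 * H i : ℝ) ≤
          c₀ * ((P : ℝ) ^ s / (P : ℝ) ^ Ktot t ν μ k) *
            ((2 / V) ^ r * (P : ℝ) ^ Ktot t ν μ k) := by gcongr
      _ = κ * (χ₀ / (Q : ℝ) ^ r) * (Q / (4 * V)) ^ r * (P : ℝ) ^ s := by
          have h8 : (8 : ℝ) ^ r = 2 ^ r * 4 ^ r := by rw [← mul_pow]; norm_num
          rw [hc₀, h8, div_pow, div_pow, mul_pow]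
          field_simp
      _ ≤ κ * (zsol k c Q / (Q : ℝ) ^ s) * (Q / (4 * V)) ^ r * (P : ℝ) ^ s := by
          have h := hχ Q hQ
          have h' : χ₀ / (Q : ℝ) ^ r ≤ zsol k c Q / (Q : ℝ) ^ s := by
            rw [div_le_iff₀ (by positivity)]
            refine h.trans (le_of_eq ?_)
            rw [chi, ← hr]
            ring
          gcongr
      _ ≤ _ := hPM
      _ ≤ _ := by
          refine Nat.cast_le.2 (Finset.card_le_card fun x hx => ?_)
          rw [Finset.mem_filter] at hx ⊢
          refine ⟨hx.1, fun i => ⟨(hx.2 i).1, ?_⟩⟩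
          have h1 := (hx.2 i).2
          have h2 : 2 * |(Fval k c x i : ℝ)| ≤ Q * H i := by
            calc 2 * |(Fval k c x i : ℝ)| ≤ 2 * (Q / (4 * V) * (P : ℝ) ^ deg t ν μ k i) := by
                  gcongr
              _ = Q * ((P : ℝ) ^ deg t ν μ k i / (2 * V)) := by field_simp; ring
              _ ≤ _ := by gcongr; exact hHge i
          exact_mod_cast h2
  have hpos : 0 < #((Fintype.piFinset fun j => B j P).filter fun x => Fval k c x = 0) := by
    have h : (0 : ℝ) < #((Fintype.piFinset fun j => B j P).filter fun x => Fval k c x = 0) := by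
      linarith
    exact_mod_cast h
  obtain ⟨x, hx⟩ := Finset.card_pos.1 hpos
  rw [Finset.mem_filter, Fintype.mem_piFinset] at hx
  exact ⟨x, fun j => (Finset.mem_Icc.1 ((hB j).1 P (hx.1 j))).1, hx.2⟩

end count

/-- Theorem 1.1 (A) of Brandes–Parsell: if
`s ≥ 2 Σ_h (μ_h - μ_{h+1}) max{u_0(𝐤_h), (k/2)(1+ϖ_h)} + M`, then every highly
non-singular system with a non-singular positive real solution and non-singular
`p`-adic solutions for all `p` has a solution in positive integers. -/
theorem statement0
    (t : ℕ) (ν μ : Fin t → ℕ) (k : (l : Fin t) → Fin (ν l) → ℕ)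
    (hgrp : GroupedDegrees t ν μ k)
    (s : ℕ)
    (hs : 2 * (∑ h ∈ Finset.Icc 1 t,
        ((mu1 t μ h : ℝ) - (mu1 t μ (h + 1) : ℝ)) *
          max (u0 t ν k h : ℝ) ((kmax t ν k : ℝ) * (1 + (varpi t ν h : ℝ)) / 2))
      + (mu1 t μ 1 : ℝ) ≤ (s : ℝ))
    (c : EqIdx t ν μ → Fin s → ℤ)
    (hns : HighlyNonSingular t ν μ s c)
    (hreal : ∃ x : Fin s → ℝ, (∀ j, 0 < x j) ∧ IsSol t ν μ k s c x ∧ JacFullRank t ν μ k s c x)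
    (hpadic : ∀ (p : ℕ) [Fact p.Prime], ∃ x : Fin s → ℚ_[p],
      IsSol t ν μ k s c x ∧ JacFullRank t ν μ k s c x) :
    ∃ x : Fin s → ℤ, (∀ j, 0 < x j) ∧ IsSol t ν μ k s c x := by
  obtain ⟨η, hη, -, J, hJ, C, hC0, P₀, -, hC⟩ := smooth_mean_value hgrp hs hns
  have hC' : ∀ᶠ P : ℕ in atTop, ∫ α in ubox (EqIdx t ν μ),
      ∏ j ∈ J, ‖fj t ν μ k s c (smoothFS P ((P : ℝ) ^ η)) α j‖ ≤
        C * (P : ℝ) ^ #J / (P : ℝ) ^ Ktot t ν μ k := by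
    filter_upwards [tendsto_natCast_atTop_atTop.eventually_ge_atTop P₀] with P hP
    exact hC P hP
  obtain ⟨C', hB⟩ := BQ_le (equi_smooth hη) hgrp.2.2.2.2.1 J hC'
  obtain ⟨χ₀, hχ₀, hχ⟩ := chi_lower J hB fun p hp => hpadic p
  obtain ⟨x, hx, h0⟩ := exists_zero_of_mean_value hgrp hns hreal (equi_smooth hη) hJ hC0 hC' hχ₀ hχ
  refine ⟨fun j => x j, fun j => Int.natCast_pos.2 (hx j), fun i => ?_⟩
  simpa [Fval] using congrFun h0 i

end
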